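/- arXiv:1504.05257 — 4 statements merged into one kernel-verified Lean document; each statement's English description precedes it below -/
import Mathlib

section
/- Let k be a number field and C₀ ≥ 0. There exists a constant C, depending only on k and C₀, such that for every nonnegative-valued multiplicative function g on the nonzero ideals of 𝓞_k whose values on all prime power ideals are at most C₀, every set 𝒫 of nonzero prime ideals of 𝓞_k, and every real x ≥ 2: Σ g(𝔞) ≤ C·x·∏_{𝔭 : |𝔭| ≤ x, 𝔭 ∉ 𝒫} (1 + (g(𝔭) − 1)/|𝔭|) · ∏_{𝔭 : |𝔭| ≤ x, 𝔭 ∈ 𝒫} (1 − 1/|𝔭|), where the sum on the left runs over all squarefree nonzero ideals 𝔞 of 𝓞_k with |𝔞| ≤ x that are not divisible by any prime ideal belonging to 𝒫, and the two products run over the finitely many nonzero prime ideals of norm at most x lying outside and inside 𝒫, respectively. -/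
open NumberField

open Finset in
theorem Finset.sum_le_sum_of_injOn_of_le {ι κ : Type*} {s : Finset ι} {t : Finset κ} {f : ι → ℝ}
    {g : κ → ℝ} (e : ι → κ) (he : ∀ i ∈ s, e i ∈ t) (hinj : Set.InjOn e s)
    (hfg : ∀ i ∈ s, f i ≤ g (e i)) (hg : ∀ j ∈ t, 0 ≤ g j) :
    ∑ i ∈ s, f i ≤ ∑ j ∈ t, g j := by
  classical
  calc ∑ i ∈ s, f i ≤ ∑ i ∈ s, g (e i) := sum_le_sum hfg
    _ = ∑ j ∈ s.image e, g j := (sum_image hinj).symm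
    _ ≤ ∑ j ∈ t, g j :=
      sum_le_sum_of_subset_of_nonneg (image_subset_iff.2 he) fun j hj _ ↦ hg j hj

open Finset in
/-- Dyadic decomposition: if the weights `w` have partial sums `O(y)` when ordered by `N`, then
`∑ w / N ^ (1 + t)` is dominated by a geometric series. -/
theorem sum_div_rpow_le_geom_sum {ι : Type*} (F : Finset ι) (N w : ι → ℝ)
    (hN : ∀ i ∈ F, 1 ≤ N i) (hw : ∀ i ∈ F, 0 ≤ w i) {A : ℝ}
    (hA : ∀ y : ℝ, 1 ≤ y → ∑ i ∈ F with N i ≤ y, w i ≤ A * y) {t : ℝ} (ht : 0 ≤ t) (J : ℕ) :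
    ∑ i ∈ F with N i < 2 ^ J, w i / N i ^ (1 + t) ≤
      ∑ j ∈ range J, 2 * A * ((2 : ℝ) ^ (-t)) ^ j := by
  induction J with
  | zero =>
    rw [filter_false_of_mem fun i hi ↦ by simpa using hN i hi]
    simp
  | succ J ih =>
    have hsplit : ∑ i ∈ F with N i < 2 ^ (J + 1), w i / N i ^ (1 + t) =
        ∑ i ∈ F with N i < 2 ^ J, w i / N i ^ (1 + t) +
          ∑ i ∈ F with 2 ^ J ≤ N i ∧ N i < 2 ^ (J + 1), w i / N i ^ (1 + t) := by
      rw [← sum_filter_add_sum_filter_not (F.filter fun i ↦ N i < 2 ^ (J + 1))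
        (fun i ↦ N i < 2 ^ J), filter_filter, filter_filter]
      congr 2
      · refine filter_congr fun i _ ↦ ⟨fun h ↦ h.2, fun h ↦ ⟨h.trans ?_, h⟩⟩
        exact pow_lt_pow_right₀ one_lt_two (Nat.lt_succ_self J)
      · exact filter_congr fun i _ ↦ by rw [not_lt, and_comm]
    rw [hsplit, sum_range_succ]
    refine add_le_add ih ?_
    have hJ : (0 : ℝ) < 2 ^ J := by positivity
    have hpow : ((2 : ℝ) ^ J) ^ (1 + t) = 2 ^ J * (2 ^ t) ^ J := by
      rw [Real.rpow_add hJ, Real.rpow_one, ← Real.rpow_natCast, ← Real.rpow_natCast,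
        ← Real.rpow_mul zero_le_two, ← Real.rpow_mul zero_le_two, mul_comm t]
    calc ∑ i ∈ F with 2 ^ J ≤ N i ∧ N i < 2 ^ (J + 1), w i / N i ^ (1 + t)
        ≤ ∑ i ∈ F with 2 ^ J ≤ N i ∧ N i < 2 ^ (J + 1), w i / ((2 : ℝ) ^ J) ^ (1 + t) := by
          refine sum_le_sum fun i hi ↦ ?_
          rw [mem_filter] at hi
          exact div_le_div_of_nonneg_left (hw i hi.1) (by positivity)
            (Real.rpow_le_rpow hJ.le hi.2.1 (by linarith))
      _ ≤ ∑ i ∈ F with N i ≤ 2 ^ (J + 1), w i / ((2 : ℝ) ^ J) ^ (1 + t) := by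
          refine sum_le_sum_of_subset_of_nonneg ?_ fun i hi _ ↦
            div_nonneg (hw i (mem_filter.1 hi).1) (by positivity)
          exact monotone_filter_right _ fun i _ h ↦ h.2.le
      _ = (∑ i ∈ F with N i ≤ 2 ^ (J + 1), w i) / (2 ^ J * (2 ^ t) ^ J) := by
          rw [← sum_div, hpow]
      _ ≤ A * 2 ^ (J + 1) / (2 ^ J * (2 ^ t) ^ J) := by
          gcongr
          exact hA _ (one_le_pow₀ one_le_two)
      _ = 2 * A * ((2 : ℝ) ^ (-t)) ^ J := by
          rw [Real.rpow_neg zero_le_two, inv_pow]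
          field_simp
          ring

open Finset in
theorem sum_rpow_neg_le_div {ι : Type*} (F : Finset ι) (N : ι → ℝ) (hN : ∀ i ∈ F, 1 ≤ N i)
    {A : ℝ} (hA0 : 0 ≤ A) (hA : ∀ y : ℝ, 1 ≤ y → ((F.filter fun i ↦ N i ≤ y).card : ℝ) ≤ A * y)
    {t : ℝ} (ht : 0 < t) (ht2 : t ≤ 2) :
    ∑ i ∈ F, N i ^ (-(1 + t)) ≤ 12 * A / t := by
  obtain ⟨J, hJ⟩ : ∃ J : ℕ, ∀ i ∈ F, N i < 2 ^ J := by
    obtain ⟨J, hJ⟩ := pow_unbounded_of_one_lt (∑ i ∈ F, N i) (one_lt_two (α := ℝ))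
    exact ⟨J, fun i hi ↦ (single_le_sum (f := N)
      (fun j hj ↦ zero_le_one.trans (hN j hj)) hi).trans_lt hJ⟩
  have h := sum_div_rpow_le_geom_sum F N (fun _ ↦ 1) hN (fun _ _ ↦ zero_le_one)
    (A := A) (by simpa using hA) ht.le J
  rw [filter_true_of_mem hJ, ← mul_sum] at h
  have hlog : (1 : ℝ) / 2 < Real.log 2 := by linarith [Real.log_two_gt_d9]
  have hlog' : Real.log 2 < 1 := by linarith [Real.log_two_lt_d9]
  have hr0 : (0 : ℝ) ≤ 2 ^ (-t) := by positivity
  have hr : (2 : ℝ) ^ (-t) ≤ 1 - t / 6 := by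
    have h1 : 1 + t / 2 ≤ (2 : ℝ) ^ t := by
      rw [Real.rpow_def_of_pos two_pos]
      nlinarith [Real.add_one_le_exp (Real.log 2 * t)]
    rw [Real.rpow_neg zero_le_two]
    refine (inv_anti₀ (by positivity) h1).trans ?_
    rw [inv_le_iff_one_le_mul₀ (by positivity)]
    nlinarith
  have hgeom : ∑ j ∈ range J, ((2 : ℝ) ^ (-t)) ^ j ≤ 6 / t := by
    have hm := geom_sum_mul_neg ((2 : ℝ) ^ (-t)) J
    have h0 : 0 ≤ ∑ j ∈ range J, ((2 : ℝ) ^ (-t)) ^ j := by positivity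
    rw [le_div_iff₀ ht]
    have : 0 ≤ ((2 : ℝ) ^ (-t)) ^ J := by positivity
    nlinarith
  calc ∑ i ∈ F, N i ^ (-(1 + t)) = ∑ i ∈ F, 1 / N i ^ (1 + t) := by
        refine sum_congr rfl fun i hi ↦ ?_
        rw [Real.rpow_neg (zero_le_one.trans (hN i hi)), one_div]
    _ ≤ 2 * A * (6 / t) := h.trans (by gcongr)
    _ = 12 * A / t := by ring

open Finset in
theorem sum_log_div_le_log {ι : Type*} (F : Finset ι) (N : ι → ℝ) (hN : ∀ i ∈ F, 1 ≤ N i)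
    {A : ℝ} (hA0 : 0 ≤ A)
    (hA : ∀ y : ℝ, 1 ≤ y → ∑ i ∈ F with N i ≤ y, Real.log (N i) ≤ A * y)
    {x : ℝ} (hx : 2 ≤ x) (hF : ∀ i ∈ F, N i ≤ x) :
    ∑ i ∈ F, Real.log (N i) / N i ≤ 8 * A * Real.log x := by
  have hlog : (1 : ℝ) / 2 < Real.log 2 := by linarith [Real.log_two_gt_d9]
  have hlogx : Real.log 2 ≤ Real.log x := Real.log_le_log two_pos hx
  set J := ⌊Real.log x / Real.log 2⌋₊ + 1 with hJdef
  have hxJ : x < 2 ^ J := by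
    rw [← Real.log_lt_log_iff (by linarith) (by positivity), Real.log_pow,
      ← div_lt_iff₀ (by linarith)]
    exact_mod_cast Nat.lt_floor_add_one _
  have hJ : (J : ℝ) ≤ 4 * Real.log x := by
    have h1 : (⌊Real.log x / Real.log 2⌋₊ : ℝ) ≤ Real.log x / Real.log 2 :=
      Nat.floor_le (div_nonneg (by linarith) (by linarith))
    have h2 : Real.log x / Real.log 2 ≤ 2 * Real.log x := by
      rw [div_le_iff₀ (by linarith)]; nlinarith
    push_cast [hJdef]
    linarith
  have h := sum_div_rpow_le_geom_sum F N (fun i ↦ Real.log (N i)) hN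
    (fun i hi ↦ Real.log_nonneg (hN i hi)) hA le_rfl J
  rw [filter_true_of_mem fun i hi ↦ (hF i hi).trans_lt hxJ] at h
  simp only [add_zero, Real.rpow_one, neg_zero, Real.rpow_zero, one_pow, mul_one, sum_const,
    card_range, nsmul_eq_mul] at h
  nlinarith

open Finset in
/-- Hall–Tenenbaum type bound for sums over squarefree products: `∑ g(S)` over products of norm at
most `x` is `O(x / log x)` times the Euler product of `1 + g / N`. -/
theorem log_mul_sum_powerset_le {ι : Type*} (T : Finset ι) (N g : ι → ℝ)
    (hN : ∀ i ∈ T, 1 ≤ N i) (hg : ∀ i ∈ T, 0 ≤ g i) {c A : ℝ} (hgc : ∀ i ∈ T, g i ≤ c)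
    (hc : 0 ≤ c) (hA : ∀ y : ℝ, 1 ≤ y → ∑ i ∈ T with N i ≤ y, Real.log (N i) ≤ A * y)
    (hA0 : 0 ≤ A) {x : ℝ} (hx : 1 ≤ x) :
    Real.log x * ∑ S ∈ T.powerset with ∏ i ∈ S, N i ≤ x, ∏ i ∈ S, g i ≤
      (1 + c * A) * x * ∏ i ∈ T, (1 + g i / N i) := by
  classical
  set D := T.powerset.filter fun S ↦ ∏ i ∈ S, N i ≤ x with hD
  have hsub : ∀ S ∈ D, S ⊆ T := fun S hS ↦ mem_powerset.1 (mem_filter.1 hS).1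
  have hle : ∀ S ∈ D, ∏ i ∈ S, N i ≤ x := fun S hS ↦ (mem_filter.1 hS).2
  have hN1 : ∀ S ⊆ T, 1 ≤ ∏ i ∈ S, N i := fun S hS ↦ by
    simpa using prod_le_prod (f := fun _ ↦ (1 : ℝ)) (fun _ _ ↦ zero_le_one)
      fun i hi ↦ hN i (hS hi)
  have hG0 : ∀ S ⊆ T, 0 ≤ ∏ i ∈ S, g i := fun S hS ↦ prod_nonneg fun i hi ↦ hg i (hS hi)
  set M := ∑ S ∈ D, (∏ i ∈ S, g i) / ∏ i ∈ S, N i with hM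
  have hMle : M ≤ ∏ i ∈ T, (1 + g i / N i) := by
    rw [prod_one_add, hM]
    simp only [prod_div_distrib]
    exact sum_le_sum_of_subset_of_nonneg (filter_subset _ _) fun S hS _ ↦
      div_nonneg (hG0 S (mem_powerset.1 hS)) (zero_le_one.trans (hN1 S (mem_powerset.1 hS)))
  have h1 : ∑ S ∈ D, (∏ i ∈ S, g i) * Real.log (x / ∏ i ∈ S, N i) ≤ x * M := by
    rw [hM, mul_sum]
    refine sum_le_sum fun S hS ↦ ?_
    have hpos := zero_lt_one.trans_le (hN1 S (hsub S hS))
    calc (∏ i ∈ S, g i) * Real.log (x / ∏ i ∈ S, N i)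
        ≤ (∏ i ∈ S, g i) * (x / ∏ i ∈ S, N i) := by
          refine mul_le_mul_of_nonneg_left ?_ (hG0 S (hsub S hS))
          exact Real.log_le_self (by positivity)
      _ = x * ((∏ i ∈ S, g i) / ∏ i ∈ S, N i) := by ring
  have h2 : ∑ S ∈ D, (∏ i ∈ S, g i) * Real.log (∏ i ∈ S, N i) ≤ c * A * x * M := by
    calc ∑ S ∈ D, (∏ i ∈ S, g i) * Real.log (∏ i ∈ S, N i)
        = ∑ q ∈ D.sigma fun S ↦ S, (∏ i ∈ q.1, g i) * Real.log (N q.2) := by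
          rw [sum_sigma]
          refine sum_congr rfl fun S hS ↦ ?_
          rw [Real.log_prod fun i hi ↦ (zero_lt_one.trans_le (hN i (hsub S hS hi))).ne', mul_sum]
      _ ≤ ∑ q ∈ D.sigma fun S ↦ T.filter fun p ↦ N p ≤ x / ∏ i ∈ S, N i,
            (∏ i ∈ q.1, g i) * (c * Real.log (N q.2)) := by
          refine sum_le_sum_of_injOn_of_le (fun q ↦ ⟨q.1.erase q.2, q.2⟩) ?_ ?_ ?_ ?_
          · rintro ⟨S, p⟩ hq
            obtain ⟨hS, hp⟩ := mem_sigma.1 hq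
            have hpT := hsub S hS hp
            have hE : S.erase p ⊆ T := (erase_subset _ _).trans (hsub S hS)
            have hprod : N p * ∏ i ∈ S.erase p, N i = ∏ i ∈ S, N i := mul_prod_erase S N hp
            have hE1 := hN1 _ hE
            have hSx := hle S hS
            simp only [mem_sigma, mem_filter, hD, mem_powerset]
            refine ⟨⟨hE, ?_⟩, hpT, ?_⟩
            · nlinarith [hN p hpT]
            · rw [le_div_iff₀ (by linarith), hprod]
              exact hSx
          · rintro ⟨S, p⟩ hq ⟨S', p'⟩ hq' h
            obtain ⟨-, hp⟩ := mem_sigma.1 hq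
            obtain ⟨-, hp'⟩ := mem_sigma.1 hq'
            simp only [Sigma.mk.injEq, heq_eq_eq] at h hp hp' ⊢
            obtain ⟨h, rfl⟩ := h
            exact ⟨by rw [← insert_erase hp, h, insert_erase hp'], rfl⟩
          · rintro ⟨S, p⟩ hq
            obtain ⟨hS, hp⟩ := mem_sigma.1 hq
            have hpT := hsub S hS hp
            have hE : S.erase p ⊆ T := (erase_subset _ _).trans (hsub S hS)
            change (∏ i ∈ S, g i) * _ ≤ (∏ i ∈ S.erase p, g i) * (c * _)
            rw [← prod_erase_mul S g hp, mul_assoc]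
            have := hG0 _ hE
            have := Real.log_nonneg (hN p hpT)
            have := hgc p hpT
            gcongr
          · rintro ⟨S, p⟩ hq
            simp only [mem_sigma, mem_filter] at hq
            exact mul_nonneg (hG0 S (hsub S hq.1))
              (mul_nonneg hc (Real.log_nonneg (hN p hq.2.1)))
      _ = ∑ S ∈ D, (∏ i ∈ S, g i) * (c * ∑ p ∈ T with N p ≤ x / ∏ i ∈ S, N i,
            Real.log (N p)) := by
          rw [sum_sigma]
          simp only [mul_sum]
      _ ≤ ∑ S ∈ D, (∏ i ∈ S, g i) * (c * (A * (x / ∏ i ∈ S, N i))) := by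
          refine sum_le_sum fun S hS ↦ ?_
          refine mul_le_mul_of_nonneg_left (mul_le_mul_of_nonneg_left (hA _ ?_) hc)
            (hG0 S (hsub S hS))
          rw [one_le_div (zero_lt_one.trans_le (hN1 S (hsub S hS)))]
          exact hle S hS
      _ = c * A * x * M := by
          rw [hM, mul_sum]
          exact sum_congr rfl fun S _ ↦ by ring
  calc Real.log x * ∑ S ∈ D, ∏ i ∈ S, g i
      = ∑ S ∈ D, (∏ i ∈ S, g i) * Real.log (x / ∏ i ∈ S, N i) +
          ∑ S ∈ D, (∏ i ∈ S, g i) * Real.log (∏ i ∈ S, N i) := by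
        rw [mul_sum, ← sum_add_distrib]
        refine sum_congr rfl fun S hS ↦ ?_
        rw [Real.log_div (by linarith) (zero_lt_one.trans_le (hN1 S (hsub S hS))).ne']
        ring
    _ ≤ (1 + c * A) * x * M := by linarith
    _ ≤ (1 + c * A) * x * ∏ i ∈ T, (1 + g i / N i) := by gcongr

theorem two_le_absNorm_of_isPrime {k : Type*} [Field k] [NumberField k] {P : Ideal (𝓞 k)}
    (hP : P ≠ ⊥) (hp : P.IsPrime) : (2 : ℝ) ≤ Ideal.absNorm P := by
  have h0 : Ideal.absNorm P ≠ 0 := Ideal.absNorm_eq_zero_iff.not.2 hP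
  have h1 : Ideal.absNorm P ≠ 1 := Ideal.absNorm_eq_one_iff.not.2 hp.ne_top
  have : 2 ≤ Ideal.absNorm P := by omega
  exact_mod_cast this

open Finset in
theorem sum_log_absNorm_le (k : Type*) [Field k] [NumberField k] (T : Finset (Ideal (𝓞 k)))
    (hT : ∀ P ∈ T, P ≠ ⊥ ∧ P.IsPrime) {x : ℝ} (hx : 0 ≤ x)
    (hTx : ∀ P ∈ T, (Ideal.absNorm P : ℝ) ≤ x) :
    ∑ P ∈ T, Real.log (Ideal.absNorm P) ≤ Module.finrank ℤ (𝓞 k) * Real.log 4 * x := by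
  have hdvd : ∏ P ∈ T, P ∣ Ideal.span {((primorial ⌊x⌋₊ : ℕ) : 𝓞 k)} := by
    refine prod_primes_dvd _ (fun P hP ↦ Ideal.prime_of_isPrime (hT P hP).1 (hT P hP).2)
      fun P hP ↦ ?_
    have := (hT P hP).2
    have hn0 : Ideal.absNorm P ≠ 0 := Ideal.absNorm_eq_zero_iff.not.2 (hT P hP).1
    obtain ⟨p, hp, hpP⟩ : ∃ p ∈ (Ideal.absNorm P).primeFactorsList, (p : 𝓞 k) ∈ P := by
      have hmem := Ideal.absNorm_mem P
      rw [← Nat.prod_primeFactorsList hn0, Nat.cast_list_prod] at hmem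
      simpa using (Ideal.IsPrime.multiset_prod_mem_iff_exists_mem (I := P) this
        ((Ideal.absNorm P).primeFactorsList.map (Nat.cast : ℕ → 𝓞 k) : Multiset (𝓞 k))).1
          (by simpa using hmem)
    rw [Ideal.dvd_span_singleton]
    have hpd : p ∣ primorial ⌊x⌋₊ := by
      refine dvd_prod_of_mem (fun p ↦ p) (mem_filter.2 ⟨mem_range.2 (Nat.lt_succ_of_le ?_),
        Nat.prime_of_mem_primeFactorsList hp⟩)
      exact (Nat.le_of_mem_primeFactorsList hp).trans (Nat.le_floor (hTx P hP))
    obtain ⟨m, hm⟩ := hpd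
    rw [hm, Nat.cast_mul]
    exact P.mul_mem_right _ hpP
  have hle : ∏ P ∈ T, Ideal.absNorm P ≤ primorial ⌊x⌋₊ ^ Module.finrank ℤ (𝓞 k) := by
    have h := Nat.le_of_dvd ?_ (map_dvd Ideal.absNorm hdvd)
    · rwa [map_prod, Ideal.absNorm_span_natCast] at h
    · rw [Ideal.absNorm_span_natCast]
      exact pow_pos (primorial_pos _) _
  have hpos : ∀ P ∈ T, 0 < Ideal.absNorm P := fun P hP ↦
    Nat.pos_of_ne_zero (Ideal.absNorm_eq_zero_iff.not.2 (hT P hP).1)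
  have hle' : (∏ P ∈ T, Ideal.absNorm P : ℝ) ≤ ((4 : ℝ) ^ ⌊x⌋₊) ^ Module.finrank ℤ (𝓞 k) := by
    exact_mod_cast hle.trans (Nat.pow_le_pow_left (primorial_le_four_pow _) _)
  rw [← Real.log_prod fun P hP ↦ by exact_mod_cast (hpos P hP).ne']
  refine (Real.log_le_log (prod_pos fun P hP ↦ by exact_mod_cast hpos P hP) hle').trans ?_
  rw [Real.log_pow, Real.log_pow, mul_assoc, mul_comm (Real.log 4)]
  have := Nat.floor_le hx
  have : 0 ≤ Real.log 4 := Real.log_nonneg (by norm_num)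
  gcongr

open Finset in
theorem exists_card_absNorm_le_le_mul (k : Type*) [Field k] [NumberField k] :
    ∃ A : ℝ, 0 ≤ A ∧ ∀ (F : Finset (Ideal (𝓞 k))) (y : ℝ), 1 ≤ y →
      ((F.filter fun I ↦ (Ideal.absNorm I : ℝ) ≤ y).card : ℝ) ≤ A * y := by
  obtain ⟨B, hB⟩ := (Ideal.tendsto_norm_le_div_atTop k).isBoundedUnder_le
  obtain ⟨s, hs⟩ := Filter.eventually_atTop.1 (Filter.eventually_map.1 hB)
  refine ⟨|B| * (|s| + 1), by positivity, fun F y hy ↦ ?_⟩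
  set z := max y (|s| + 1) with hz
  have hz1 : 1 ≤ z := hy.trans (le_max_left _ _)
  have hzs : s ≤ z := (le_abs_self s).trans ((le_add_of_nonneg_right zero_le_one).trans
    (le_max_right _ _))
  have hzy : z ≤ (|s| + 1) * y := by
    have := abs_nonneg s
    refine max_le ?_ ?_ <;> nlinarith
  have hfin : {I : Ideal (𝓞 k) | (Ideal.absNorm I : ℝ) ≤ z}.Finite := by
    refine (Ideal.finite_setOfPred_absNorm_le ⌊z⌋₊).subset fun I hI ↦ ?_
    exact Nat.le_floor hI
  have hcard : ((F.filter fun I ↦ (Ideal.absNorm I : ℝ) ≤ y).card : ℝ) ≤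
      Nat.card {I : Ideal (𝓞 k) // (Ideal.absNorm I : ℝ) ≤ z} := by
    rw [← Set.ncard_coe_finset]
    exact_mod_cast Set.ncard_le_ncard (fun I hI ↦ show (Ideal.absNorm I : ℝ) ≤ z from
      le_trans (mem_filter.1 (mem_coe.1 hI)).2 (le_max_left _ _)) hfin
  have h : (Nat.card {I : Ideal (𝓞 k) // (Ideal.absNorm I : ℝ) ≤ z} : ℝ) / z ≤ B := hs z hzs
  rw [div_le_iff₀ (by linarith)] at h
  calc _ ≤ _ := hcard
    _ ≤ B * z := h
    _ ≤ |B| * z := by gcongr; exact le_abs_self B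
    _ ≤ |B| * (|s| + 1) * y := by rw [mul_assoc]; gcongr

open Finset in
theorem Ideal.injOn_finset_prod_of_prime {R : Type*} [CommRing R] [IsDedekindDomain R] :
    Set.InjOn (fun S : Finset (Ideal R) ↦ ∏ P ∈ S, P) {S | ∀ P ∈ S, Prime P} := by
  have key : ∀ S S' : Finset (Ideal R), (∀ P ∈ S, Prime P) → (∀ P ∈ S', Prime P) →
      ∏ P ∈ S, P = ∏ P ∈ S', P → S ⊆ S' := by
    intro S S' hS hS' h P hP
    have hd : P ∣ ∏ Q ∈ S', Q := h ▸ dvd_prod_of_mem (fun Q ↦ Q) hP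
    obtain ⟨Q, hQ, hPQ⟩ := (hS P hP).exists_mem_finset_dvd hd
    have : P = Q := associated_iff_eq.1 (((hS P hP).dvd_prime_iff_associated (hS' Q hQ)).1 hPQ)
    exact this ▸ hQ
  exact fun S hS S' hS' h ↦ (key S S' hS hS' h).antisymm (key S' S hS' hS h.symm)

open Finset in
/-- Weak Mertens estimate: `∏ (1 - 1 / |𝔭|)⁻¹ = O(log x)` over prime ideals of norm at most `x`. -/
theorem exists_one_le_mul_log_mul_prod (k : Type*) [Field k] [NumberField k] :
    ∃ B : ℝ, 0 ≤ B ∧ ∀ (T : Finset (Ideal (𝓞 k))), (∀ P ∈ T, P ≠ ⊥ ∧ P.IsPrime) →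
      ∀ x : ℝ, 2 ≤ x → (∀ P ∈ T, (Ideal.absNorm P : ℝ) ≤ x) →
        1 ≤ B * Real.log x * ∏ P ∈ T, (1 - 1 / (Ideal.absNorm P : ℝ)) := by
  obtain ⟨A, hA0, hA⟩ := exists_card_absNorm_le_le_mul k
  set A' : ℝ := Module.finrank ℤ (𝓞 k) * Real.log 4 with hA'
  have hA'0 : 0 ≤ A' := mul_nonneg (Nat.cast_nonneg _) (Real.log_nonneg (by norm_num))
  refine ⟨12 * A * Real.exp (8 * A' + 24 * A), by positivity, fun T hT x hx hTx ↦ ?_⟩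
  set N : Ideal (𝓞 k) → ℝ := fun P ↦ (Ideal.absNorm P : ℝ) with hNdef
  have hN2 : ∀ P ∈ T, 2 ≤ N P := fun P hP ↦
    two_le_absNorm_of_isPrime (hT P hP).1 (hT P hP).2
  have hlog : (1 : ℝ) / 2 < Real.log 2 := by linarith [Real.log_two_gt_d9]
  have hlogx : Real.log 2 ≤ Real.log x := Real.log_le_log two_pos hx
  have hlogpos : 0 < Real.log x := by linarith
  set t : ℝ := 1 / Real.log x with ht
  have ht0 : 0 < t := by positivity
  have ht2 : t ≤ 2 := by
    rw [ht, div_le_iff₀ hlogpos]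
    linarith
  have hzeta : ∏ P ∈ T, (1 + N P ^ (-(1 + t))) ≤ 12 * A / t := by
    classical
    have hinj : Set.InjOn (fun S : Finset (Ideal (𝓞 k)) ↦ ∏ P ∈ S, P) T.powerset :=
      Ideal.injOn_finset_prod_of_prime.mono fun S hS P hP ↦
        have h := hT P (mem_powerset.1 (mem_coe.1 hS) hP)
        Ideal.prime_of_isPrime h.1 h.2
    have h := sum_rpow_neg_le_div (T.powerset.image fun S ↦ ∏ P ∈ S, P) N ?_ hA0
      (hA _) ht0 ht2
    · rw [sum_image hinj] at h
      rw [prod_one_add]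
      refine le_of_eq_of_le (sum_congr rfl fun S hS ↦ ?_) h
      simp only [hNdef, map_prod, Nat.cast_prod]
      exact Real.finsetProd_rpow S _ (fun _ _ ↦ Nat.cast_nonneg _) _
    · intro I hI
      obtain ⟨S, hS, rfl⟩ := mem_image.1 hI
      simp only [hNdef, map_prod, Nat.cast_prod]
      simpa using prod_le_prod (f := fun _ ↦ (1 : ℝ)) (fun _ _ ↦ zero_le_one)
        fun i hi ↦ one_le_two.trans (hN2 i (mem_powerset.1 hS hi))
  have hsq : ∑ P ∈ T, N P ^ (-(1 + 1 : ℝ)) ≤ 12 * A := by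
    simpa using sum_rpow_neg_le_div T N (fun P hP ↦ one_le_two.trans (hN2 P hP)) hA0 (hA T)
      one_pos one_le_two
  have hlogsum : ∑ P ∈ T, Real.log (N P) / N P ≤ 8 * A' * Real.log x := by
    refine sum_log_div_le_log T N (fun P hP ↦ one_le_two.trans (hN2 P hP)) hA'0
      (fun y hy ↦ ?_) hx hTx
    exact sum_log_absNorm_le k _ (fun P hP ↦ hT P (mem_filter.1 hP).1) (by linarith)
      fun P hP ↦ (mem_filter.1 hP).2
  have hterm : ∀ P ∈ T, 1 ≤ (1 - 1 / N P) * ((1 + N P ^ (-(1 + t))) *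
      Real.exp (t * (Real.log (N P) / N P) + 2 * N P ^ (-(1 + 1 : ℝ)))) := by
    intro P hP
    have h2 := hN2 P hP
    have hpos : 0 < N P := by linarith
    have hsq' : N P ^ (-(1 + 1 : ℝ)) = (1 / N P) ^ 2 := by
      rw [Real.rpow_neg hpos.le, one_add_one_eq_two, Real.rpow_two]
      simp
    have hy : N P ^ (-(1 + t)) = 1 / N P * Real.exp (-(t * Real.log (N P))) := by
      rw [neg_add, Real.rpow_add hpos, Real.rpow_neg_one, one_div,
        Real.rpow_def_of_pos hpos (-t)]
      ring_nf
    have hz : 1 / N P - t * (Real.log (N P) / N P) ≤ N P ^ (-(1 + t)) := by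
      rw [hy]
      calc 1 / N P - t * (Real.log (N P) / N P)
          = 1 / N P * (-(t * Real.log (N P)) + 1) := by ring
        _ ≤ _ := by gcongr; exact Real.add_one_le_exp _
    have hy0 : 0 ≤ N P ^ (-(1 + t)) := by positivity
    rw [hsq']
    set y := N P ^ (-(1 + t))
    set u := 1 / N P with hu
    have hu0 : 0 < u := by positivity
    have hu2 : u ≤ 1 / 2 := one_div_le_one_div_of_le two_pos h2
    set v := t * (Real.log (N P) / N P)
    have hv : 0 ≤ v := mul_nonneg ht0.le (div_nonneg (Real.log_nonneg (by linarith)) hpos.le)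
    have he := Real.add_one_le_exp (v + 2 * u ^ 2)
    calc (1 : ℝ) ≤ (1 - u) * (1 + u + 2 * u ^ 2) := by nlinarith [sq_nonneg u]
      _ ≤ (1 - u) * ((1 + y) * (v + 2 * u ^ 2 + 1)) := by
          refine mul_le_mul_of_nonneg_left ?_ (by linarith)
          nlinarith [mul_nonneg hy0 hv, mul_nonneg hy0 (sq_nonneg u)]
      _ ≤ _ := by
          refine mul_le_mul_of_nonneg_left (mul_le_mul_of_nonneg_left he ?_) (by linarith)
          linarith
  have hP0 : 0 ≤ ∏ P ∈ T, (1 - 1 / N P) := prod_nonneg fun P hP ↦ by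
    have := one_div_le_one_div_of_le two_pos (hN2 P hP)
    linarith
  have hexp : t * ∑ P ∈ T, Real.log (N P) / N P + 2 * ∑ P ∈ T, N P ^ (-(1 + 1 : ℝ)) ≤
      8 * A' + 24 * A := by
    have : t * ∑ P ∈ T, Real.log (N P) / N P ≤ 8 * A' := by
      rw [ht, div_mul_eq_mul_div, one_mul, div_le_iff₀ hlogpos]
      exact hlogsum
    exact add_le_add this ((mul_le_mul_of_nonneg_left hsq zero_le_two).trans_eq (by ring))
  calc (1 : ℝ) ≤ ∏ P ∈ T, ((1 - 1 / N P) * ((1 + N P ^ (-(1 + t))) *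
        Real.exp (t * (Real.log (N P) / N P) + 2 * N P ^ (-(1 + 1 : ℝ))))) := by
        simpa using prod_le_prod (f := fun _ ↦ (1 : ℝ)) (fun _ _ ↦ zero_le_one) hterm
    _ = (∏ P ∈ T, (1 - 1 / N P)) * ((∏ P ∈ T, (1 + N P ^ (-(1 + t)))) *
        Real.exp (t * ∑ P ∈ T, Real.log (N P) / N P + 2 * ∑ P ∈ T, N P ^ (-(1 + 1 : ℝ)))) := by
        rw [prod_mul_distrib, prod_mul_distrib, ← Real.exp_sum, sum_add_distrib, mul_sum, mul_sum]
    _ ≤ (∏ P ∈ T, (1 - 1 / N P)) * (12 * A / t * Real.exp (8 * A' + 24 * A)) := by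
        gcongr
    _ = 12 * A * Real.exp (8 * A' + 24 * A) * Real.log x * ∏ P ∈ T, (1 - 1 / N P) := by
        rw [ht]
        field_simp

open UniqueFactorizationMonoid Classical in
theorem Ideal.prod_toFinset_normalizedFactors_of_squarefree {R : Type*} [CommRing R]
    [IsDedekindDomain R] {I : Ideal R} (hI : I ≠ ⊥) (hsq : Squarefree I) :
    ∏ P ∈ (normalizedFactors I).toFinset, P = I := by
  have h := (squarefree_iff_nodup_normalizedFactors hI).1 hsq
  rw [Finset.prod, Multiset.toFinset_val, h.dedup, Multiset.map_id',
    Ideal.prod_normalizedFactors_eq_self hI]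

theorem Ideal.map_finset_prod_of_prime {R : Type*} [CommRing R] [IsDedekindDomain R]
    {g : Ideal R → ℝ} (hg1 : g ⊤ = 1)
    (hmul : ∀ I J : Ideal R, I ≠ ⊥ → J ≠ ⊥ → I ⊔ J = ⊤ → g (I * J) = g I * g J)
    (S : Finset (Ideal R)) (hS : ∀ P ∈ S, P ≠ ⊥ ∧ P.IsPrime) :
    g (∏ P ∈ S, P) = ∏ P ∈ S, g P := by
  classical
  induction S using Finset.induction_on with
  | empty => simpa using hg1
  | insert P S hP ih =>
    have hS' : ∀ Q ∈ S, Q ≠ ⊥ ∧ Q.IsPrime := fun Q hQ ↦ hS Q (Finset.mem_insert_of_mem hQ)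
    obtain ⟨hP0, hPp⟩ := hS P (Finset.mem_insert_self P S)
    rw [Finset.prod_insert hP, Finset.prod_insert hP, hmul P _ hP0 _ _, ih hS']
    · exact Finset.prod_ne_zero_iff.2 fun Q hQ ↦ (hS' Q hQ).1
    · rw [← Ideal.isCoprime_iff_sup_eq]
      refine IsCoprime.prod_right fun Q hQ ↦ ?_
      have hPm := hPp.isMaximal hP0
      have hQm := (hS' Q hQ).2.isMaximal (hS' Q hQ).1
      exact Ideal.isCoprime_iff_sup_eq.2 (hPm.coprime_of_ne hQm fun h ↦ hP (h ▸ hQ))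

open UniqueFactorizationMonoid in
/-- **Sieve lemma**: upper bound for sums of a bounded nonnegative multiplicative function over
squarefree ideals of bounded norm avoiding a set of primes `Pset`. -/
theorem stmt_3 (k : Type*) [Field k] [NumberField k] (C₀ : ℝ) (hC₀ : 0 ≤ C₀) :
    ∃ C : ℝ, ∀ g : Ideal (𝓞 k) → ℝ,
      (∀ I : Ideal (𝓞 k), I ≠ ⊥ → 0 ≤ g I) → g ⊤ = 1 →
      (∀ I J : Ideal (𝓞 k), I ≠ ⊥ → J ≠ ⊥ → I ⊔ J = ⊤ → g (I * J) = g I * g J) →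
      (∀ (P : Ideal (𝓞 k)) (ν : ℕ), P ≠ ⊥ → P.IsPrime → 1 ≤ ν → g (P ^ ν) ≤ C₀) →
      ∀ Pset : Set (Ideal (𝓞 k)), (∀ P ∈ Pset, P ≠ ⊥ ∧ P.IsPrime) →
      ∀ x : ℝ, 2 ≤ x →
      (∑ᶠ 𝔞 ∈ {𝔞 : Ideal (𝓞 k) | 𝔞 ≠ ⊥ ∧ Squarefree 𝔞 ∧ (Ideal.absNorm 𝔞 : ℝ) ≤ x ∧
          ∀ P ∈ Pset, ¬ P ∣ 𝔞}, g 𝔞) ≤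
        C * x *
          (∏ᶠ P ∈ {P : Ideal (𝓞 k) | P ≠ ⊥ ∧ P.IsPrime ∧ (Ideal.absNorm P : ℝ) ≤ x ∧ P ∉ Pset},
            (1 + (g P - 1) / (Ideal.absNorm P : ℝ))) *
          ∏ᶠ P ∈ {P : Ideal (𝓞 k) | P ≠ ⊥ ∧ P.IsPrime ∧ (Ideal.absNorm P : ℝ) ≤ x ∧ P ∈ Pset},
            (1 - 1 / (Ideal.absNorm P : ℝ)) := by
  classical
  obtain ⟨B, hB0, hB⟩ := exists_one_le_mul_log_mul_prod k
  set A : ℝ := Module.finrank ℤ (𝓞 k) * Real.log 4 with hA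
  have hA0 : 0 ≤ A := mul_nonneg (Nat.cast_nonneg _) (Real.log_nonneg (by norm_num))
  refine ⟨B * (1 + C₀ * A), fun g hg hg1 hmul hgC Pset hPset x hx ↦ ?_⟩
  have hfin : {I : Ideal (𝓞 k) | (Ideal.absNorm I : ℝ) ≤ x}.Finite :=
    (Ideal.finite_setOfPred_absNorm_le ⌊x⌋₊).subset fun I hI ↦ Nat.le_floor hI
  have hfinA : {𝔞 : Ideal (𝓞 k) | 𝔞 ≠ ⊥ ∧ Squarefree 𝔞 ∧ (Ideal.absNorm 𝔞 : ℝ) ≤ x ∧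
      ∀ P ∈ Pset, ¬ P ∣ 𝔞}.Finite := hfin.subset fun I hI ↦ hI.2.2.1
  have hfinT : {P : Ideal (𝓞 k) | P ≠ ⊥ ∧ P.IsPrime ∧ (Ideal.absNorm P : ℝ) ≤ x ∧
      P ∉ Pset}.Finite := hfin.subset fun I hI ↦ hI.2.2.1
  have hfinU : {P : Ideal (𝓞 k) | P ≠ ⊥ ∧ P.IsPrime ∧ (Ideal.absNorm P : ℝ) ≤ x ∧
      P ∈ Pset}.Finite := hfin.subset fun I hI ↦ hI.2.2.1
  rw [finsum_mem_eq_finite_toFinset_sum _ hfinA, finprod_mem_eq_finite_toFinset_prod _ hfinT,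
    finprod_mem_eq_finite_toFinset_prod _ hfinU]
  set T := hfinT.toFinset with hTdef
  set U := hfinU.toFinset with hUdef
  set N : Ideal (𝓞 k) → ℝ := fun P ↦ (Ideal.absNorm P : ℝ) with hNdef
  have hT : ∀ P, P ∈ T ↔ P ≠ ⊥ ∧ P.IsPrime ∧ N P ≤ x ∧ P ∉ Pset := fun P ↦ by
    simp [hTdef, hNdef]
  have hU : ∀ P, P ∈ U ↔ P ≠ ⊥ ∧ P.IsPrime ∧ N P ≤ x ∧ P ∈ Pset := fun P ↦ by
    simp [hUdef, hNdef]
  have hN2 : ∀ P : Ideal (𝓞 k), P ≠ ⊥ → P.IsPrime → 2 ≤ N P := fun P ↦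
    two_le_absNorm_of_isPrime
  have hT2 : ∀ P ∈ T, 2 ≤ N P := fun P hP ↦ hN2 P ((hT P).1 hP).1 ((hT P).1 hP).2.1
  have hU2 : ∀ P ∈ U, 2 ≤ N P := fun P hP ↦ hN2 P ((hU P).1 hP).1 ((hU P).1 hP).2.1
  have hgT : ∀ P ∈ T, 0 ≤ g P := fun P hP ↦ hg P ((hT P).1 hP).1
  have hsum : ∑ 𝔞 ∈ hfinA.toFinset, g 𝔞 ≤
      ∑ S ∈ T.powerset with ∏ P ∈ S, N P ≤ x, ∏ P ∈ S, g P := by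
    have hprod : ∀ 𝔞 ∈ hfinA.toFinset, ∏ P ∈ (normalizedFactors 𝔞).toFinset, P = 𝔞 := by
      intro 𝔞 h𝔞
      have h := hfinA.mem_toFinset.1 h𝔞
      exact Ideal.prod_toFinset_normalizedFactors_of_squarefree h.1 h.2.1
    have hfac : ∀ 𝔞 ∈ hfinA.toFinset, ∀ P ∈ (normalizedFactors 𝔞).toFinset, P ∈ T := by
      intro 𝔞 h𝔞 P hP
      obtain ⟨h0, -, hx𝔞, hnd⟩ := hfinA.mem_toFinset.1 h𝔞
      rw [Multiset.mem_toFinset] at hP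
      have hPp := prime_of_normalized_factor P hP
      have hPd := dvd_of_mem_normalizedFactors hP
      refine (hT P).2 ⟨hPp.ne_zero, Ideal.isPrime_of_prime hPp, ?_, fun h ↦ hnd P h hPd⟩
      refine le_trans (Nat.cast_le.2 ?_) hx𝔞
      exact Nat.le_of_dvd (Nat.pos_of_ne_zero (Ideal.absNorm_eq_zero_iff.not.2 h0))
        (map_dvd Ideal.absNorm hPd)
    refine Finset.sum_le_sum_of_injOn_of_le (fun 𝔞 ↦ (normalizedFactors 𝔞).toFinset) ?_ ?_ ?_ ?_
    · intro 𝔞 h𝔞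
      refine Finset.mem_filter.2 ⟨Finset.mem_powerset.2 (hfac 𝔞 h𝔞), ?_⟩
      have : ∏ P ∈ (normalizedFactors 𝔞).toFinset, N P = N 𝔞 := by
        conv_rhs => rw [← hprod 𝔞 h𝔞]
        simp [hNdef, map_prod]
      rw [this]
      exact (hfinA.mem_toFinset.1 h𝔞).2.2.1
    · intro 𝔞 h𝔞 𝔟 h𝔟 h
      rw [← hprod 𝔞 h𝔞, ← hprod 𝔟 h𝔟]
      exact congrArg (fun S : Finset (Ideal (𝓞 k)) ↦ ∏ P ∈ S, P) h
    · intro 𝔞 h𝔞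
      rw [← Ideal.map_finset_prod_of_prime hg1 hmul _ fun P hP ↦
        ⟨((hT P).1 (hfac 𝔞 h𝔞 P hP)).1, ((hT P).1 (hfac 𝔞 h𝔞 P hP)).2.1⟩, hprod 𝔞 h𝔞]
    · intro S hS
      exact Finset.prod_nonneg fun P hP ↦
        hgT P (Finset.mem_powerset.1 (Finset.mem_filter.1 hS).1 hP)
  have hmain := log_mul_sum_powerset_le T N g (fun P hP ↦ one_le_two.trans (hT2 P hP)) hgT
    (c := C₀) (A := A) (fun P hP ↦ by
      simpa using hgC P 1 ((hT P).1 hP).1 ((hT P).1 hP).2.1 le_rfl) hC₀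
    (fun y hy ↦ sum_log_absNorm_le k _ (fun P hP ↦
      have h := (hT P).1 (Finset.mem_filter.1 hP).1
      ⟨h.1, h.2.1⟩) (by linarith) fun P hP ↦ (Finset.mem_filter.1 hP).2)
    hA0 (x := x) (by linarith)
  have hmertens := hB (T ∪ U) (fun P hP ↦ by
    rcases Finset.mem_union.1 hP with h | h
    · exact ⟨((hT P).1 h).1, ((hT P).1 h).2.1⟩
    · exact ⟨((hU P).1 h).1, ((hU P).1 h).2.1⟩) x hx (fun P hP ↦ by
    rcases Finset.mem_union.1 hP with h | h
    · exact ((hT P).1 h).2.2.1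
    · exact ((hU P).1 h).2.2.1)
  rw [Finset.prod_union (Finset.disjoint_left.2 fun P h h' ↦
    ((hT P).1 h).2.2.2 ((hU P).1 h').2.2.2)] at hmertens
  have hhalf : ∀ P, 2 ≤ N P → 0 ≤ 1 - 1 / N P := fun P hP ↦ by
    have := one_div_le_one_div_of_le two_pos hP
    linarith
  set W := ∑ 𝔞 ∈ hfinA.toFinset, g 𝔞
  have hW0 : 0 ≤ W := Finset.sum_nonneg fun 𝔞 h𝔞 ↦ hg 𝔞 (hfinA.mem_toFinset.1 h𝔞).1
  have hlog0 : 0 ≤ Real.log x := Real.log_nonneg (by linarith)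
  have hpT0 : 0 ≤ ∏ P ∈ T, (1 - 1 / N P) := Finset.prod_nonneg fun P hP ↦ hhalf P (hT2 P hP)
  have hpU0 : 0 ≤ ∏ P ∈ U, (1 - 1 / N P) := Finset.prod_nonneg fun P hP ↦ hhalf P (hU2 P hP)
  have hcomb : (∏ P ∈ T, (1 + g P / N P)) * ∏ P ∈ T, (1 - 1 / N P) ≤
      ∏ P ∈ T, (1 + (g P - 1) / N P) := by
    rw [← Finset.prod_mul_distrib]
    have hpos : ∀ P ∈ T, 0 ≤ g P / N P := fun P hP ↦
      div_nonneg (hgT P hP) (zero_le_two.trans (hT2 P hP))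
    refine Finset.prod_le_prod (fun P hP ↦ mul_nonneg ?_ (hhalf P (hT2 P hP))) fun P hP ↦ ?_
    · linarith [hpos P hP]
    · have h := hpos P hP
      have h' : 0 ≤ 1 / N P := one_div_nonneg.2 (zero_le_two.trans (hT2 P hP))
      rw [sub_div]
      nlinarith [mul_nonneg h h']
  calc W ≤ (B * Real.log x * ((∏ P ∈ T, (1 - 1 / N P)) * ∏ P ∈ U, (1 - 1 / N P))) * W :=
        le_mul_of_one_le_left hW0 hmertens
    _ = B * ((∏ P ∈ T, (1 - 1 / N P)) * ∏ P ∈ U, (1 - 1 / N P)) * (Real.log x * W) := by ring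
    _ ≤ B * ((∏ P ∈ T, (1 - 1 / N P)) * ∏ P ∈ U, (1 - 1 / N P)) *
          ((1 + C₀ * A) * x * ∏ P ∈ T, (1 + g P / N P)) := by
        refine mul_le_mul_of_nonneg_left ?_ (by positivity)
        exact (mul_le_mul_of_nonneg_left hsum hlog0).trans hmain
    _ = B * (1 + C₀ * A) * x * ((∏ P ∈ T, (1 + g P / N P)) * ∏ P ∈ T, (1 - 1 / N P)) *
          ∏ P ∈ U, (1 - 1 / N P) := by ring
    _ ≤ B * (1 + C₀ * A) * x * (∏ P ∈ T, (1 + (g P - 1) / N P)) *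
          ∏ P ∈ U, (1 - 1 / N P) := by
        gcongr
end

section
/- Let L/k be a quadratic extension of number fields (L is a number field containing k with [L : k] = 2). There exists a constant C, depending on L and k, such that for all real y ≥ 3: |Σ_{𝔭 : |𝔭| ≤ y, 𝔭 splits in L} 1/|𝔭| − (1/2)·log log y| ≤ C, where the sum runs over the nonzero prime ideals 𝔭 of 𝓞_k of absolute norm at most y that split in L. -/
open NumberField

/-- A nonzero prime ideal `P` of `𝓞 k` splits in the extension `L/k` if there are two distinct
(nonzero) prime ideals of `𝓞 L` lying above `P`. -/
def SplitsIn (k L : Type*) [Field k] [NumberField k] [Field L] [NumberField L]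
    [Algebra k L] (P : Ideal (𝓞 k)) : Prop :=
  ∃ Q₁ Q₂ : Ideal (𝓞 L), Q₁ ≠ Q₂ ∧ Q₁.IsPrime ∧ Q₂.IsPrime ∧ Q₁ ≠ ⊥ ∧ Q₂ ≠ ⊥ ∧
    Q₁.comap (algebraMap (𝓞 k) (𝓞 L)) = P ∧ Q₂.comap (algebraMap (𝓞 k) (𝓞 L)) = P


section PrimeIdealSum

open Filter Topology

variable (K : Type*) [Field K] [NumberField K]

/-- The set of nonzero prime ideals of the ring of integers of `K`. -/
def primeIdeals : Set (Ideal (𝓞 K)) := {P | P ≠ ⊥ ∧ P.IsPrime}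

variable {K}

theorem one_le_absNorm_of_ne_bot {I : Ideal (𝓞 K)} (hI : I ≠ ⊥) :
    (1 : ℝ) ≤ Ideal.absNorm I := by
  exact_mod_cast Nat.one_le_iff_ne_zero.mpr (mt Ideal.absNorm_eq_zero_iff.mp hI)

theorem two_le_absNorm_of_mem_primeIdeals {P : Ideal (𝓞 K)} (hP : P ∈ primeIdeals K) :
    (2 : ℝ) ≤ Ideal.absNorm P := by
  have h0 := mt Ideal.absNorm_eq_zero_iff.mp hP.1
  have h1 := mt Ideal.absNorm_eq_one_iff.mp hP.2.ne_top
  exact_mod_cast (by omega : 2 ≤ Ideal.absNorm P)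

theorem absNorm_rpow_antitone (I : Ideal (𝓞 K)) {s t : ℝ} (hs : 0 < s) (hst : s ≤ t) :
    (Ideal.absNorm I : ℝ) ^ (-t) ≤ (Ideal.absNorm I : ℝ) ^ (-s) := by
  rcases eq_or_ne I ⊥ with rfl | hI
  · simp [Real.zero_rpow (neg_ne_zero.mpr hs.ne'),
      Real.zero_rpow (neg_ne_zero.mpr (hs.trans_le hst).ne')]
  · exact Real.rpow_le_rpow_of_exponent_le (one_le_absNorm_of_ne_bot hI) (by linarith)

theorem hasSum_absNorm_rpow_fiber (s : ℝ) (n : ℕ) :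
    HasSum (fun I : {I : Ideal (𝓞 K) // Ideal.absNorm I = n} ↦ (Ideal.absNorm I.1 : ℝ) ^ (-s))
      (Nat.card {I : Ideal (𝓞 K) // Ideal.absNorm I = n} * (n : ℝ) ^ (-s)) := by
  have : Finite {I : Ideal (𝓞 K) // Ideal.absNorm I = n} := Ideal.finite_setOfPred_absNorm_eq n
  have := Fintype.ofFinite {I : Ideal (𝓞 K) // Ideal.absNorm I = n}
  have h := hasSum_fintype fun I : {I : Ideal (𝓞 K) // Ideal.absNorm I = n} ↦
    (Ideal.absNorm I.1 : ℝ) ^ (-s)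
  rw [Finset.sum_congr rfl (g := fun _ ↦ (n : ℝ) ^ (-s)) (fun I _ ↦ by rw [I.2])] at h
  simpa using h

theorem LSeries_term_card_absNorm {s : ℝ} (hs : s ≠ 0) (n : ℕ) :
    LSeries.term (fun n ↦ Nat.card {I : Ideal (𝓞 K) // Ideal.absNorm I = n}) s n =
      ((Nat.card {I : Ideal (𝓞 K) // Ideal.absNorm I = n} * (n : ℝ) ^ (-s) : ℝ) : ℂ) := by
  rcases eq_or_ne n 0 with rfl | hn
  · simp [Real.zero_rpow (neg_ne_zero.mpr hs)]
  · rw [LSeries.term_of_ne_zero hn, Complex.ofReal_mul,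
      Complex.ofReal_cpow (Nat.cast_nonneg n), Complex.ofReal_neg, Complex.cpow_neg]
    simp [div_eq_mul_inv]

theorem summable_absNorm_rpow_iff {s : ℝ} (hs : s ≠ 0) :
    (Summable fun I : Ideal (𝓞 K) ↦ (Ideal.absNorm I : ℝ) ^ (-s)) ↔
      LSeriesSummable (fun n ↦ Nat.card {I : Ideal (𝓞 K) // Ideal.absNorm I = n}) s := by
  rw [← (Equiv.sigmaFiberEquiv (Ideal.absNorm (S := 𝓞 K))).summable_iff,
    summable_sigma_of_nonneg fun x ↦ by simp only [Function.comp]; positivity, LSeriesSummable,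
    funext (LSeries_term_card_absNorm hs), Complex.summable_ofReal]
  refine ⟨fun h ↦ h.2.congr fun n ↦ (hasSum_absNorm_rpow_fiber s n).tsum_eq, fun h ↦
    ⟨fun n ↦ (hasSum_absNorm_rpow_fiber s n).summable,
      h.congr fun n ↦ (hasSum_absNorm_rpow_fiber s n).tsum_eq.symm⟩⟩

theorem tsum_absNorm_rpow_eq_dedekindZeta {s : ℝ} (hs : s ≠ 0)
    (h : Summable fun I : Ideal (𝓞 K) ↦ (Ideal.absNorm I : ℝ) ^ (-s)) :
    ((∑' I : Ideal (𝓞 K), (Ideal.absNorm I : ℝ) ^ (-s) : ℝ) : ℂ) = dedekindZeta K s := by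
  have h' := (Equiv.sigmaFiberEquiv (Ideal.absNorm (S := 𝓞 K))).summable_iff.mpr h
  rw [dedekindZeta, LSeries, funext (LSeries_term_card_absNorm hs), ← Complex.ofReal_tsum,
    ← (Equiv.sigmaFiberEquiv (Ideal.absNorm (S := 𝓞 K))).tsum_eq]
  congr 1
  exact h'.tsum_sigma.trans (tsum_congr fun n ↦ (hasSum_absNorm_rpow_fiber s n).tsum_eq)

variable (K) in
theorem summable_absNorm_rpow {s : ℝ} (hs : 1 < s) :
    Summable fun I : Ideal (𝓞 K) ↦ (Ideal.absNorm I : ℝ) ^ (-s) := by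
  have h0 : ∀ᶠ t : ℝ in 𝓝[>] 1, (t - 1) * dedekindZeta K t ≠ 0 :=
    (tendsto_sub_one_mul_dedekindZeta_nhdsGT K).eventually_ne
      (Complex.ofReal_ne_zero.mpr (dedekindZeta_residue_ne_zero K))
  obtain ⟨t, ht0, ht1, hts⟩ := (h0.and (Ioo_mem_nhdsGT hs)).exists
  have htz := right_ne_zero_of_mul ht0
  have hsum : Summable fun I : Ideal (𝓞 K) ↦ (Ideal.absNorm I : ℝ) ^ (-t) := by
    rw [summable_absNorm_rpow_iff (by linarith)]
    by_contra h
    exact htz (tsum_eq_zero_of_not_summable h)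
  exact hsum.of_nonneg_of_le (fun I ↦ by positivity)
    fun I ↦ absNorm_rpow_antitone I (by linarith) hts.le

theorem one_le_tsum_absNorm_rpow {s : ℝ} (hs : 1 < s) :
    1 ≤ ∑' I : Ideal (𝓞 K), (Ideal.absNorm I : ℝ) ^ (-s) := by
  simpa using (summable_absNorm_rpow K hs).le_tsum ⊤ fun I _ ↦ by positivity

variable (K) in
/-- The logarithm of the Dedekind zeta function is `- log (s - 1) + O(1)` as `s → 1⁺`. -/
theorem exists_abs_log_tsum_absNorm_add_log_le :
    ∃ C : ℝ, ∀ s : ℝ, 1 < s → s ≤ 2 →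
      |Real.log (∑' I : Ideal (𝓞 K), (Ideal.absNorm I : ℝ) ^ (-s)) + Real.log (s - 1)| ≤ C := by
  set Z : ℝ → ℝ := fun s ↦ ∑' I : Ideal (𝓞 K), (Ideal.absNorm I : ℝ) ^ (-s)
  have hlim : Tendsto (fun s : ℝ ↦ (s - 1) * Z s) (𝓝[>] 1) (𝓝 (dedekindZeta_residue K)) := by
    have := (Complex.continuous_re.tendsto _).comp (tendsto_sub_one_mul_dedekindZeta_nhdsGT K)
    rw [Complex.ofReal_re] at this
    refine this.congr' ?_
    filter_upwards [self_mem_nhdsWithin] with s hs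
    have hs' : (1 : ℝ) < s := hs
    rw [Function.comp, ← tsum_absNorm_rpow_eq_dedekindZeta (by linarith)
      (summable_absNorm_rpow K hs'), ← Complex.ofReal_one, ← Complex.ofReal_sub,
      ← Complex.ofReal_mul, Complex.ofReal_re]
  have hκ := dedekindZeta_residue_pos K
  have hlog := (hlim.log hκ.ne').abs
  have hev := hlog.eventually_le_const (lt_add_one _)
  obtain ⟨t, ht, hbd⟩ := (mem_nhdsGT_iff_exists_Ioc_subset).mp hev
  have ht1 : (1 : ℝ) < t := ht
  refine ⟨max (|Real.log (dedekindZeta_residue K)| + 1) (|Real.log (Z t)| + |Real.log (t - 1)|),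
    fun s hs hs2 ↦ ?_⟩
  have hZ1 : 1 ≤ Z s := one_le_tsum_absNorm_rpow hs
  rcases le_total s t with hst | hst
  · have h := hbd ⟨hs, hst⟩
    simp only [Set.mem_ofPred_eq] at h
    rw [Real.log_mul (by linarith) (by linarith), add_comm] at h
    exact h.trans (le_max_left _ _)
  · have hmono : Z s ≤ Z t := (summable_absNorm_rpow K hs).tsum_le_tsum
      (fun I ↦ absNorm_rpow_antitone I (by linarith) hst) (summable_absNorm_rpow K ht)
    refine le_trans ((abs_add_le _ _).trans (add_le_add ?_ ?_)) (le_max_right _ _)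
    · rw [abs_of_nonneg (Real.log_nonneg hZ1), abs_of_nonneg (Real.log_nonneg (hZ1.trans hmono))]
      exact Real.log_le_log (by linarith) hmono
    · rw [abs_of_nonpos (Real.log_nonpos (by linarith) (by linarith)),
        abs_of_nonpos (Real.log_nonpos (by linarith) (by linarith))]
      exact neg_le_neg (Real.log_le_log (by linarith) (by linarith))

/-- Removing finitely many Euler factors from the Dedekind zeta function. -/
theorem tsum_absNorm_mul_prod_eq {s : ℝ} (hs : 1 < s) (T : Finset (Ideal (𝓞 K)))
    (hT : ∀ P ∈ T, P ∈ primeIdeals K) :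
    (∑' I : Ideal (𝓞 K), (Ideal.absNorm I : ℝ) ^ (-s)) *
        ∏ P ∈ T, (1 - (Ideal.absNorm P : ℝ) ^ (-s)) =
      ∑' I : Ideal (𝓞 K), {I : Ideal (𝓞 K) | ∀ P ∈ T, ¬ P ∣ I}.indicator
        (fun I ↦ (Ideal.absNorm I : ℝ) ^ (-s)) I := by
  classical
  induction T using Finset.induction_on with
  | empty => simp
  | insert Q T hQ ih =>
    have hQp := hT Q (Finset.mem_insert_self _ _)
    have hT' : ∀ P ∈ T, P ∈ primeIdeals K := fun P hP ↦ hT P (Finset.mem_insert_of_mem hP)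
    set g : Ideal (𝓞 K) → ℝ := fun I ↦ (Ideal.absNorm I : ℝ) ^ (-s)
    set A : Set (Ideal (𝓞 K)) := {I | ∀ P ∈ T, ¬ P ∣ I}
    have hg : Summable g := summable_absNorm_rpow K hs
    have hinj : Function.Injective fun I : Ideal (𝓞 K) ↦ Q * I :=
      fun I J h ↦ mul_left_cancel₀ (show Q ≠ 0 from hQp.1) h
    have hshift : ∀ I, (A ∩ {I | Q ∣ I}).indicator g (Q * I) = g Q * A.indicator g I := by
      intro I
      have hmem : Q * I ∈ A ∩ {I | Q ∣ I} ↔ I ∈ A := by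
        refine ⟨fun h P hP hPI ↦ h.1 P hP (hPI.mul_left Q), fun h ↦ ⟨fun P hP hPI ↦ ?_,
          dvd_mul_right Q I⟩⟩
        have hPp := hT' P hP
        rcases (Ideal.prime_of_isPrime hPp.1 hPp.2).dvd_or_dvd hPI with h' | h'
        · have : P = Q := ((hQp.2.isMaximal hQp.1).eq_of_le hPp.2.ne_top (Ideal.le_of_dvd h')).symm
          exact hQ (this ▸ hP)
        · exact h P hP h'
      by_cases hI : I ∈ A
      · rw [Set.indicator_of_mem (hmem.mpr hI), Set.indicator_of_mem hI]
        simp only [g, map_mul, Nat.cast_mul]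
        exact Real.mul_rpow (Nat.cast_nonneg _) (Nat.cast_nonneg _)
      · rw [Set.indicator_of_notMem (mt hmem.mp hI), Set.indicator_of_notMem hI, mul_zero]
    have hdvd : ∑' I, (A ∩ {I | Q ∣ I}).indicator g I = g Q * ∑' I, A.indicator g I := by
      rw [← tsum_mul_left, ← hinj.tsum_eq]
      · exact tsum_congr hshift
      · intro I hI
        obtain ⟨J, rfl⟩ := (Set.mem_of_indicator_ne_zero hI).2
        exact ⟨J, rfl⟩
    have hsplit : {I : Ideal (𝓞 K) | ∀ P ∈ insert Q T, ¬ P ∣ I} = A \ (A ∩ {I | Q ∣ I}) := by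
      ext I
      simp only [Finset.mem_insert, forall_eq_or_imp, Set.mem_ofPred_eq, Set.mem_sdiff,
        Set.mem_inter_iff, A]
      tauto
    rw [Finset.prod_insert hQ, mul_left_comm, ih hT', hsplit,
      Set.indicator_sdiff Set.inter_subset_left]
    simp only [Pi.sub_apply]
    rw [(hg.indicator A).tsum_sub (hg.indicator _), hdvd]
    ring

theorem absNorm_rpow_le_half {P : Ideal (𝓞 K)} (hP : P ∈ primeIdeals K) {s : ℝ} (hs : 1 ≤ s) :
    (Ideal.absNorm P : ℝ) ^ (-s) ≤ 1 / 2 := by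
  have h2 := two_le_absNorm_of_mem_primeIdeals hP
  refine (absNorm_rpow_antitone P one_pos hs).trans ?_
  rw [Real.rpow_neg_one, one_div]
  exact inv_anti₀ two_pos h2

theorem one_le_tsum_absNorm_mul_prod {s : ℝ} (hs : 1 < s) (T : Finset (Ideal (𝓞 K)))
    (hT : ∀ P ∈ T, P ∈ primeIdeals K) :
    1 ≤ (∑' I : Ideal (𝓞 K), (Ideal.absNorm I : ℝ) ^ (-s)) *
        ∏ P ∈ T, (1 - (Ideal.absNorm P : ℝ) ^ (-s)) := by
  rw [tsum_absNorm_mul_prod_eq hs T hT]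
  refine le_trans ?_ (((summable_absNorm_rpow K hs).indicator _).le_tsum ⊤
    fun I _ ↦ Set.indicator_nonneg (fun _ _ ↦ by positivity) I)
  rw [Set.indicator_of_mem]
  · simp
  · exact fun P hP h ↦ (hT P hP).2.ne_top (top_le_iff.mp (Ideal.le_of_dvd h))

theorem exists_tsum_absNorm_mul_prod_le_two {s : ℝ} (hs : 1 < s) :
    ∃ T : Finset (Ideal (𝓞 K)), (∀ P ∈ T, P ∈ primeIdeals K) ∧
      (∑' I : Ideal (𝓞 K), (Ideal.absNorm I : ℝ) ^ (-s)) *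
        ∏ P ∈ T, (1 - (Ideal.absNorm P : ℝ) ^ (-s)) ≤ 2 := by
  classical
  set g : Ideal (𝓞 K) → ℝ := fun I ↦ (Ideal.absNorm I : ℝ) ^ (-s)
  have hg : Summable g := summable_absNorm_rpow K hs
  obtain ⟨F, hF⟩ := ((hg.hasSum.eventually_const_lt (sub_one_lt _))).exists
  have hex : ∀ I : Ideal (𝓞 K), I ≠ ⊥ → I ≠ ⊤ → ∃ P ∈ primeIdeals K, P ∣ I := by
    intro I h0 h1
    obtain ⟨P, hP, hIP⟩ := Ideal.exists_le_maximal I h1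
    exact ⟨P, ⟨fun h ↦ h0 (le_bot_iff.mp (h ▸ hIP)), hP.isPrime⟩, Ideal.dvd_iff_le.mpr hIP⟩
  choose! p hp hpd using hex
  set F' := F.filter fun I ↦ I ≠ ⊥ ∧ I ≠ ⊤
  have hF' : ∀ I ∈ F', I ∈ F ∧ I ≠ ⊥ ∧ I ≠ ⊤ := fun I hI ↦ Finset.mem_filter.mp hI
  have hT : ∀ P ∈ F'.image p, P ∈ primeIdeals K := by
    intro P hP
    obtain ⟨I, hI, rfl⟩ := Finset.mem_image.mp hP
    exact hp I (hF' I hI).2.1 (hF' I hI).2.2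
  refine ⟨F'.image p, hT, ?_⟩
  rw [tsum_absNorm_mul_prod_eq hs _ hT]
  have hbot : g ⊥ = 0 := by simp [g, Real.zero_rpow (by linarith : -s ≠ 0)]
  have hle : ∀ I, {I : Ideal (𝓞 K) | ∀ P ∈ F'.image p, ¬ P ∣ I}.indicator g I ≤
      (if I = ⊤ then 1 else 0) + (g I - if I ∈ F then g I else 0) := by
    intro I
    have hgI : 0 ≤ g I := by positivity
    by_cases hI : I ∈ {I : Ideal (𝓞 K) | ∀ P ∈ F'.image p, ¬ P ∣ I}
    · rw [Set.indicator_of_mem hI]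
      by_cases h1 : I = ⊤
      · have : g ⊤ = 1 := by simp [g]
        subst h1
        rw [if_pos rfl]
        split_ifs <;> simp [this]
      · by_cases h0 : I = ⊥
        · subst h0; simp [hbot, h1]
        · have : I ∉ F := fun h ↦ hI (p I)
            (Finset.mem_image_of_mem p (Finset.mem_filter.mpr ⟨h, h0, h1⟩)) (hpd I h0 h1)
          simp [this, h1]
    · rw [Set.indicator_of_notMem hI]
      split_ifs <;> simp [hgI, add_nonneg]
  have h1 : HasSum (fun I : Ideal (𝓞 K) ↦ if I = ⊤ then (1 : ℝ) else 0) 1 := hasSum_ite_eq ⊤ 1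
  have h2 : HasSum (fun I ↦ if I ∈ F then g I else 0) (∑ I ∈ F, g I) := by
    have : HasSum (fun I ↦ if I ∈ F then g I else 0) (∑ I ∈ F, if I ∈ F then g I else 0) :=
      hasSum_sum_of_ne_finset_zero fun I hI ↦ if_neg hI
    rwa [Finset.sum_congr rfl (fun I hI ↦ if_pos hI)] at this
  have h3 := h1.add (hg.hasSum.sub h2)
  have h4 := (hg.indicator _).tsum_le_tsum hle h3.summable
  rw [h3.tsum_eq] at h4
  linarith

theorem summable_primeIdeals_absNorm_rpow {s : ℝ} (hs : 1 < s) :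
    Summable fun P : primeIdeals K ↦ (Ideal.absNorm P.1 : ℝ) ^ (-s) :=
  (summable_absNorm_rpow K hs).subtype _

theorem neg_log_one_sub_le {x : ℝ} (hx0 : 0 ≤ x) (hx : x ≤ 1 / 2) :
    -Real.log (1 - x) ≤ x + 2 * x ^ 2 := by
  rw [← Real.log_inv]
  refine (Real.log_le_sub_one_of_pos (inv_pos.mpr (by linarith))).trans ?_
  rw [sub_le_iff_le_add, inv_le_iff_one_le_mul₀ (by linarith)]
  nlinarith [mul_nonneg hx0 hx0, mul_nonneg (mul_nonneg hx0 hx0) (by linarith : 0 ≤ 1 / 2 - x)]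

theorem log_tsum_absNorm_mul_prod {s : ℝ} (hs : 1 < s) (T : Finset (Ideal (𝓞 K)))
    (hT : ∀ P ∈ T, P ∈ primeIdeals K) :
    Real.log ((∑' I : Ideal (𝓞 K), (Ideal.absNorm I : ℝ) ^ (-s)) *
        ∏ P ∈ T, (1 - (Ideal.absNorm P : ℝ) ^ (-s))) =
      Real.log (∑' I : Ideal (𝓞 K), (Ideal.absNorm I : ℝ) ^ (-s)) +
        ∑ P ∈ T, Real.log (1 - (Ideal.absNorm P : ℝ) ^ (-s)) := by
  have hne : ∀ P ∈ T, 1 - (Ideal.absNorm P : ℝ) ^ (-s) ≠ 0 := fun P hP ↦ by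
    linarith [absNorm_rpow_le_half (hT P hP) hs.le]
  rw [Real.log_mul (by linarith [one_le_tsum_absNorm_rpow (K := K) hs])
    (Finset.prod_ne_zero_iff.mpr hne), Real.log_prod hne]

theorem tsum_primeIdeals_le_log {s : ℝ} (hs : 1 < s) :
    ∑' P : primeIdeals K, (Ideal.absNorm P.1 : ℝ) ^ (-s) ≤
      Real.log (∑' I : Ideal (𝓞 K), (Ideal.absNorm I : ℝ) ^ (-s)) := by
  refine (summable_primeIdeals_absNorm_rpow hs).tsum_le_of_sum_le fun T ↦ ?_
  set T' : Finset (Ideal (𝓞 K)) := T.map (Function.Embedding.subtype _)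
  have hT' : ∀ P ∈ T', P ∈ primeIdeals K := by
    intro P hP
    obtain ⟨Q, -, rfl⟩ := Finset.mem_map.mp hP
    exact Q.2
  have h := Real.log_nonneg (one_le_tsum_absNorm_mul_prod hs T' hT')
  rw [log_tsum_absNorm_mul_prod hs T' hT'] at h
  have h' : ∑ P ∈ T', Real.log (1 - (Ideal.absNorm P : ℝ) ^ (-s)) ≤
      ∑ P ∈ T', -(Ideal.absNorm P : ℝ) ^ (-s) := Finset.sum_le_sum fun P hP ↦ by
    have := Real.log_le_sub_one_of_pos (x := 1 - (Ideal.absNorm P : ℝ) ^ (-s))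
      (by linarith [absNorm_rpow_le_half (hT' P hP) hs.le])
    linarith
  have h2 : ∑ P ∈ T', (Ideal.absNorm P : ℝ) ^ (-s) = ∑ P ∈ T, (Ideal.absNorm P.1 : ℝ) ^ (-s) :=
    Finset.sum_map _ _ _
  rw [Finset.sum_neg_distrib] at h'
  linarith

theorem log_le_tsum_primeIdeals_add {s : ℝ} (hs : 1 < s) :
    Real.log (∑' I : Ideal (𝓞 K), (Ideal.absNorm I : ℝ) ^ (-s)) ≤
      ∑' P : primeIdeals K, (Ideal.absNorm P.1 : ℝ) ^ (-s) +
        (2 * (∑' I : Ideal (𝓞 K), (Ideal.absNorm I : ℝ) ^ (-(2 : ℝ))) + Real.log 2) := by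
  obtain ⟨T, hT, hle⟩ := exists_tsum_absNorm_mul_prod_le_two (K := K) hs
  have h := Real.log_le_log
    (one_pos.trans_le (one_le_tsum_absNorm_mul_prod hs T hT)) hle
  rw [log_tsum_absNorm_mul_prod hs T hT] at h
  have h1 : ∑ P ∈ T, -Real.log (1 - (Ideal.absNorm P : ℝ) ^ (-s)) ≤
      ∑ P ∈ T, ((Ideal.absNorm P : ℝ) ^ (-s) + 2 * (Ideal.absNorm P : ℝ) ^ (-(2 : ℝ))) := by
    refine Finset.sum_le_sum fun P hP ↦ ?_
    refine (neg_log_one_sub_le (by positivity) (absNorm_rpow_le_half (hT P hP) hs.le)).trans ?_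
    rw [← Real.rpow_mul_natCast (Nat.cast_nonneg _)]
    gcongr
    · linarith [two_le_absNorm_of_mem_primeIdeals (hT P hP)]
    · push_cast; linarith
  rw [Finset.sum_neg_distrib, Finset.sum_add_distrib, ← Finset.mul_sum] at h1
  have h2 : ∑ P ∈ T, (Ideal.absNorm P : ℝ) ^ (-s) ≤
      ∑' P : primeIdeals K, (Ideal.absNorm P.1 : ℝ) ^ (-s) := by
    rw [tsum_subtype (primeIdeals K) (fun P ↦ (Ideal.absNorm P : ℝ) ^ (-s)),
      ← Finset.sum_congr rfl fun P hP ↦ Set.indicator_of_mem (hT P hP)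
        fun P ↦ (Ideal.absNorm P : ℝ) ^ (-s)]
    exact ((summable_absNorm_rpow K hs).indicator _).sum_le_tsum T
      fun P _ ↦ Set.indicator_nonneg (fun _ _ ↦ by positivity) P
  have h3 : ∑ P ∈ T, (Ideal.absNorm P : ℝ) ^ (-(2 : ℝ)) ≤
      ∑' I : Ideal (𝓞 K), (Ideal.absNorm I : ℝ) ^ (-(2 : ℝ)) :=
    (summable_absNorm_rpow K one_lt_two).sum_le_tsum T fun P _ ↦ by positivity
  linarith

variable (K) in
/-- The sum of `|P|⁻ˢ` over the nonzero prime ideals is `- log (s - 1) + O(1)` as `s → 1⁺`. -/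
theorem exists_abs_tsum_primeIdeals_add_log_le :
    ∃ C : ℝ, ∀ s : ℝ, 1 < s → s ≤ 2 →
      |∑' P : primeIdeals K, (Ideal.absNorm P.1 : ℝ) ^ (-s) + Real.log (s - 1)| ≤ C := by
  obtain ⟨C, hC⟩ := exists_abs_log_tsum_absNorm_add_log_le K
  refine ⟨C + (2 * (∑' I : Ideal (𝓞 K), (Ideal.absNorm I : ℝ) ^ (-(2 : ℝ))) + Real.log 2),
    fun s hs hs2 ↦ ?_⟩
  have h0 : 0 ≤ ∑' I : Ideal (𝓞 K), (Ideal.absNorm I : ℝ) ^ (-(2 : ℝ)) :=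
    tsum_nonneg fun _ ↦ by positivity
  have hlog2 := Real.log_nonneg one_le_two
  have h1 := tsum_primeIdeals_le_log (K := K) hs
  have h2 := log_le_tsum_primeIdeals_add (K := K) hs
  have h3 := abs_le.mp (hC s hs hs2)
  rw [abs_le]
  constructor <;> linarith

end PrimeIdealSum

section Tauberian

theorem abs_indicator_sub_exp_le {u : ℝ} (hu : 0 ≤ u) :
    |(if u ≤ 1 then (1 : ℝ) else 0) - Real.exp (-u)| ≤
      3 * (Real.exp (-(u / 2)) - Real.exp (-u)) := by
  set v := Real.exp (-(u / 2)) with hv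
  have hsq : Real.exp (-u) = v ^ 2 := by
    rw [hv, ← Real.exp_nat_mul]; congr 1; push_cast; ring
  have hv0 : 0 < v := Real.exp_pos _
  have hv1 : v ≤ 1 := Real.exp_le_one_iff.mpr (by linarith)
  have he : Real.exp (1 / 2) * Real.exp (-(1 / 2)) = 1 := by
    rw [← Real.exp_add]; simp
  have hsq1 : Real.exp (1 / 2) ^ 2 = Real.exp 1 := by
    rw [← Real.exp_nat_mul]; congr 1; norm_num
  have hlow : 3 / 2 ≤ Real.exp (1 / 2) := by linarith [Real.add_one_le_exp (1 / 2 : ℝ)]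
  have hupp : Real.exp (1 / 2) ≤ 2 := by
    nlinarith [Real.exp_one_lt_d9, Real.exp_pos (1 / 2)]
  rw [hsq]
  split_ifs with h
  · have : Real.exp (-(1 / 2)) ≤ v := Real.exp_le_exp.mpr (by linarith)
    have hv2 : 1 / 2 ≤ v := by nlinarith
    rw [abs_of_nonneg (by nlinarith)]
    nlinarith
  · have : v ≤ Real.exp (-(1 / 2)) := Real.exp_le_exp.mpr (by linarith)
    have hv2 : v ≤ 2 / 3 := by nlinarith [Real.exp_pos (-(1 / 2))]
    rw [zero_sub, abs_neg, abs_of_nonneg (by positivity)]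
    nlinarith

/-- If `∑ n i ^ (-s) = - c * log (s - 1) + O(1)` as `s → 1⁺`, then the sum of `(n i)⁻¹` over
`n i ≤ y` is `c * log (log y) + O(1)`. -/
theorem exists_abs_tsum_inv_sub_loglog_le {ι : Type*} {n : ι → ℝ} (hn : ∀ i, 1 ≤ n i)
    (hsum : ∀ s : ℝ, 1 < s → Summable fun i ↦ n i ^ (-s)) {c C : ℝ}
    (hC : ∀ s : ℝ, 1 < s → s ≤ 2 → |∑' i, n i ^ (-s) + c * Real.log (s - 1)| ≤ C) :
    ∃ C' : ℝ, ∀ y : ℝ, 3 ≤ y →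
      |∑' i, (if n i ≤ y then 1 / n i else 0) - c * Real.log (Real.log y)| ≤ C' := by
  refine ⟨3 * (2 * C + |c| * Real.log 2) + C, fun y hy ↦ ?_⟩
  have hlog : 1 < Real.log y := by
    rw [Real.lt_log_iff_exp_lt (by linarith)]
    linarith [Real.exp_one_lt_d9]
  set δ := (Real.log y)⁻¹ with hδ
  have hδ0 : 0 < δ := by positivity
  have hδ1 : δ < 1 := inv_lt_one_of_one_lt₀ hlog
  have hexp : ∀ (i : ι) (a : ℝ),
      n i ^ (-(1 + a * δ)) = 1 / n i * Real.exp (-(a * (Real.log (n i) * δ))) := by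
    intro i a
    have hpos : 0 < n i := one_pos.trans_le (hn i)
    rw [neg_add, Real.rpow_add hpos, Real.rpow_neg_one, one_div, Real.rpow_def_of_pos hpos]
    congr 2; ring
  have hs1 := hsum (1 + 1 * δ) (by linarith)
  have hs2 := hsum (1 + 1 / 2 * δ) (by linarith)
  have hpt : ∀ i, |(if n i ≤ y then 1 / n i else 0) - n i ^ (-(1 + 1 * δ))| ≤
      3 * (n i ^ (-(1 + 1 / 2 * δ)) - n i ^ (-(1 + 1 * δ))) := by
    intro i
    have hpos : 0 < n i := one_pos.trans_le (hn i)
    have hiff : n i ≤ y ↔ Real.log (n i) * δ ≤ 1 := by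
      rw [hδ, ← div_eq_mul_inv, div_le_one (by linarith),
        Real.log_le_log_iff hpos (by linarith)]
    have h := abs_indicator_sub_exp_le (u := Real.log (n i) * δ)
      (mul_nonneg (Real.log_nonneg (hn i)) hδ0.le)
    have hite : (if n i ≤ y then 1 / n i else 0) =
        1 / n i * (if Real.log (n i) * δ ≤ 1 then (1 : ℝ) else 0) := by
      simp only [hiff]; split_ifs <;> simp
    rw [hexp, hexp, hite, ← mul_sub, ← mul_sub, abs_mul, abs_of_pos (one_div_pos.mpr hpos),
      mul_left_comm 3]
    refine mul_le_mul_of_nonneg_left ?_ (one_div_pos.mpr hpos).le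
    rw [one_mul, show 1 / 2 * (Real.log (n i) * δ) = Real.log (n i) * δ / 2 by ring]
    exact h
  have hs3 := (hs2.sub hs1).mul_left 3
  have hd : Summable fun i ↦ (if n i ≤ y then 1 / n i else 0) - n i ^ (-(1 + 1 * δ)) :=
    hs3.of_norm_bounded hpt
  have hs4 : Summable fun i ↦ (if n i ≤ y then 1 / n i else 0) := by
    simpa using hd.add hs1
  have hmain : |∑' i, (if n i ≤ y then 1 / n i else 0) - ∑' i, n i ^ (-(1 + 1 * δ))| ≤
      3 * (∑' i, n i ^ (-(1 + 1 / 2 * δ)) - ∑' i, n i ^ (-(1 + 1 * δ))) := by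
    rw [← hs4.tsum_sub hs1, ← hs2.tsum_sub hs1, ← tsum_mul_left]
    exact (norm_tsum_le_tsum_norm hd.norm).trans (hd.norm.tsum_le_tsum hpt hs3)
  have hC1 := abs_le.mp (hC (1 + 1 * δ) (by linarith) (by linarith))
  have hC2 := abs_le.mp (hC (1 + 1 / 2 * δ) (by linarith) (by linarith))
  have hl1 : Real.log (1 + 1 * δ - 1) = -Real.log (Real.log y) := by
    rw [one_mul, add_sub_cancel_left, hδ, Real.log_inv]
  have hl2 : Real.log (1 + 1 / 2 * δ - 1) = -Real.log (Real.log y) - Real.log 2 := by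
    rw [add_sub_cancel_left, hδ, Real.log_mul (by norm_num) hδ0.ne', Real.log_inv, one_div,
      Real.log_inv]
    ring
  rw [hl1] at hC1
  rw [hl2] at hC2
  have hc := abs_le.mp (abs_mul c (Real.log 2)).le
  rw [abs_of_nonneg (Real.log_nonneg one_le_two)] at hc
  have hm := abs_le.mp hmain
  rw [abs_le]
  constructor <;> nlinarith

end Tauberian

section Different

variable (k L : Type*) [Field k] [NumberField k] [Field L] [NumberField L] [Algebra k L]

theorem differentIdeal_ringOfIntegers_ne_bot : differentIdeal (𝓞 k) (𝓞 L) ≠ ⊥ := by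
  rw [ne_eq, ← FractionalIdeal.coeIdeal_inj (K := L), coeIdeal_differentIdeal (𝓞 k) k L (𝓞 L)]
  simp

theorem finite_setOf_isPrime_dvd_differentIdeal :
    {Q : Ideal (𝓞 L) | Q ≠ ⊥ ∧ Q.IsPrime ∧ Q ∣ differentIdeal (𝓞 k) (𝓞 L)}.Finite := by
  refine ((Ideal.finite_factors (differentIdeal_ringOfIntegers_ne_bot k L)).image
    IsDedekindDomain.HeightOneSpectrum.asIdeal).subset ?_
  rintro Q ⟨hQ, hQ', hd⟩
  exact ⟨⟨Q, hQ', hQ⟩, hd, rfl⟩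

variable {k L}

theorem dvd_differentIdeal_of_sq_dvd_map {P : Ideal (𝓞 k)} (hP : P ≠ ⊥) (hP' : P.IsPrime)
    {Q : Ideal (𝓞 L)} (h : Q ^ 2 ∣ P.map (algebraMap (𝓞 k) (𝓞 L))) :
    Q ∣ differentIdeal (𝓞 k) (𝓞 L) := by
  have := hP'.isMaximal hP
  simpa using pow_sub_one_dvd_differentIdeal_aux (𝓞 k) k L Q two_ne_zero hP h

theorem absNorm_map_of_finrank_eq_two (hdeg : Module.finrank k L = 2) (P : Ideal (𝓞 k)) :
    Ideal.absNorm (P.map (algebraMap (𝓞 k) (𝓞 L))) = Ideal.absNorm P ^ 2 := by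
  have h : Module.finrank (𝓞 k) (𝓞 L) = 2 := by
    rw [← hdeg]; exact (IsFractionRing.finrank_eq (𝓞 k) k (𝓞 L) L).symm
  rw [Ideal.absNorm_algebraMap, h]

theorem exists_absNorm_eq_pow {Q : Ideal (𝓞 L)} (hQ' : Q.IsPrime) {P : Ideal (𝓞 k)}
    (h : Q.comap (algebraMap (𝓞 k) (𝓞 L)) = P) :
    ∃ f, 0 < f ∧ Ideal.absNorm Q = Ideal.absNorm P ^ f := by
  have : Q.LiesOver P := ⟨h.symm⟩
  exact ⟨_, Ideal.inertiaDeg_pos Q (𝓞 k), (Ideal.absNorm_pow_inertiaDeg P Q).symm⟩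

end Different

section Splitting

variable {k L : Type*} [Field k] [NumberField k] [Field L] [NumberField L] [Algebra k L]

theorem dvd_map_of_comap_eq {P : Ideal (𝓞 k)} {Q : Ideal (𝓞 L)}
    (h : Q.comap (algebraMap (𝓞 k) (𝓞 L)) = P) : Q ∣ P.map (algebraMap (𝓞 k) (𝓞 L)) :=
  Ideal.dvd_iff_le.mpr (Ideal.map_le_iff_le_comap.mpr h.ge)

theorem comap_eq_of_dvd_map {P : Ideal (𝓞 k)} (hP : P ∈ primeIdeals k) {Q : Ideal (𝓞 L)}
    (hQ : Q.IsPrime) (h : Q ∣ P.map (algebraMap (𝓞 k) (𝓞 L))) :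
    Q.comap (algebraMap (𝓞 k) (𝓞 L)) = P :=
  ((hP.2.isMaximal hP.1).eq_of_le (Ideal.comap_ne_top _ hQ.ne_top)
    (Ideal.map_le_iff_le_comap.mp (Ideal.dvd_iff_le.mp h))).symm

theorem one_lt_absNorm_of_mem_primeIdeals {P : Ideal (𝓞 k)} (hP : P ∈ primeIdeals k) :
    1 < Ideal.absNorm P := by
  exact_mod_cast (two_le_absNorm_of_mem_primeIdeals hP).trans_lt' one_lt_two

theorem comap_mem_primeIdeals {Q : Ideal (𝓞 L)} (hQ : Q ∈ primeIdeals L) :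
    Q.comap (algebraMap (𝓞 k) (𝓞 L)) ∈ primeIdeals k := by
  have := hQ.2
  exact ⟨mt Ideal.eq_bot_of_comap_eq_bot hQ.1, Ideal.comap_isPrime _ _⟩

theorem absNorm_eq_of_comap_eq_of_ne (hdeg : Module.finrank k L = 2) {P : Ideal (𝓞 k)}
    (hP : P ∈ primeIdeals k) {Q₁ Q₂ : Ideal (𝓞 L)} (hne : Q₁ ≠ Q₂)
    (hQ₁ : Q₁ ∈ primeIdeals L) (hQ₂ : Q₂ ∈ primeIdeals L)
    (h₁ : Q₁.comap (algebraMap (𝓞 k) (𝓞 L)) = P) (h₂ : Q₂.comap (algebraMap (𝓞 k) (𝓞 L)) = P) :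
    Ideal.absNorm Q₁ = Ideal.absNorm P ∧ Ideal.absNorm Q₂ = Ideal.absNorm P ∧
      P.map (algebraMap (𝓞 k) (𝓞 L)) = Q₁ * Q₂ := by
  have := hQ₁.2.isMaximal hQ₁.1
  have := hQ₂.2.isMaximal hQ₂.1
  obtain ⟨J, hJ⟩ := (Ideal.isCoprime_of_isMaximal hne).mul_dvd (dvd_map_of_comap_eq h₁)
    (dvd_map_of_comap_eq h₂)
  obtain ⟨f₁, hf₁, e₁⟩ := exists_absNorm_eq_pow hQ₁.2 h₁
  obtain ⟨f₂, hf₂, e₂⟩ := exists_absNorm_eq_pow hQ₂.2 h₂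
  have hN := one_lt_absNorm_of_mem_primeIdeals hP
  have hnorm := congrArg Ideal.absNorm hJ
  rw [absNorm_map_of_finrank_eq_two hdeg, map_mul, map_mul, e₁, e₂, ← pow_add] at hnorm
  have hJ0 : Ideal.absNorm J ≠ 0 := by
    intro h
    rw [h, mul_zero] at hnorm
    exact absurd hnorm (by positivity)
  have hf : f₁ + f₂ ≤ 2 := by
    refine (Nat.pow_le_pow_iff_right hN).mp ?_
    rw [hnorm]
    exact Nat.le_mul_of_pos_right _ (Nat.pos_of_ne_zero hJ0)
  obtain rfl : f₁ = 1 := by omega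
  obtain rfl : f₂ = 1 := by omega
  refine ⟨by simpa using e₁, by simpa using e₂, ?_⟩
  have hJ1 : Ideal.absNorm J = 1 := by
    have : Ideal.absNorm P ^ 2 * 1 = Ideal.absNorm P ^ 2 * Ideal.absNorm J := by simpa using hnorm
    exact (Nat.eq_of_mul_eq_mul_left (by positivity) this).symm
  rw [hJ, Ideal.absNorm_eq_one_iff.mp hJ1, Ideal.mul_top]

theorem exists_unique_comap_eq_of_not_splitsIn (hdeg : Module.finrank k L = 2) {P : Ideal (𝓞 k)}
    (hP : P ∈ primeIdeals k) (hs : ¬ SplitsIn k L P) :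
    ∃ Q ∈ primeIdeals L, Q.comap (algebraMap (𝓞 k) (𝓞 L)) = P ∧
      (∀ Q' ∈ primeIdeals L, Q'.comap (algebraMap (𝓞 k) (𝓞 L)) = P → Q' = Q) ∧
      (Ideal.absNorm Q = Ideal.absNorm P ^ 2 ∨ Q ∣ differentIdeal (𝓞 k) (𝓞 L)) := by
  have := hP.2.isMaximal hP.1
  have hN := one_lt_absNorm_of_mem_primeIdeals hP
  have hM : P.map (algebraMap (𝓞 k) (𝓞 L)) ≠ ⊥ := by
    rw [ne_eq, ← Ideal.absNorm_eq_zero_iff, absNorm_map_of_finrank_eq_two hdeg]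
    positivity
  obtain ⟨Q, hQmax, hQP⟩ := Ideal.exists_maximal_ideal_liesOver_of_isIntegral (S := 𝓞 L) P
  have h : Q.comap (algebraMap (𝓞 k) (𝓞 L)) = P := hQP.over.symm
  have hQ : Q ∈ primeIdeals L :=
    ⟨fun h0 ↦ hM (le_bot_iff.mp (h0 ▸ Ideal.dvd_iff_le.mp (dvd_map_of_comap_eq h))), hQmax.isPrime⟩
  have huniq : ∀ Q' ∈ primeIdeals L, Q'.comap (algebraMap (𝓞 k) (𝓞 L)) = P → Q' = Q := by
    intro Q' hQ' h'
    by_contra hne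
    exact hs ⟨Q', Q, hne, hQ'.2, hQ.2, hQ'.1, hQ.1, h', h⟩
  refine ⟨Q, hQ, h, huniq, ?_⟩
  obtain ⟨J, hJ⟩ := dvd_map_of_comap_eq h
  obtain ⟨f, hf, e⟩ := exists_absNorm_eq_pow hQ.2 h
  have hJ0 : J ≠ ⊥ := by
    rintro rfl
    exact hM (by simpa using hJ)
  have hnorm := congrArg Ideal.absNorm hJ
  rw [absNorm_map_of_finrank_eq_two hdeg, map_mul, e] at hnorm
  have hf2 : f ≤ 2 := by
    refine (Nat.pow_le_pow_iff_right hN).mp ?_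
    rw [hnorm]
    exact Nat.le_mul_of_pos_right _ (Nat.pos_of_ne_zero (mt Ideal.absNorm_eq_zero_iff.mp hJ0))
  obtain rfl | rfl : f = 2 ∨ f = 1 := by omega
  · exact Or.inl e
  · right
    have hJ1 : J ≠ ⊤ := by
      rintro rfl
      rw [Ideal.absNorm_top] at hnorm
      nlinarith
    obtain ⟨Q', hQ', hJQ'⟩ := Ideal.exists_le_maximal J hJ1
    have hdvd : Q' ∣ J := Ideal.dvd_iff_le.mpr hJQ'
    have hQ'Q : Q' = Q := huniq Q' ⟨fun h0 ↦ hJ0 (le_bot_iff.mp (h0 ▸ hJQ')), hQ'.isPrime⟩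
      (comap_eq_of_dvd_map hP hQ'.isPrime (hdvd.trans ⟨Q, by rw [hJ, mul_comm]⟩))
    refine dvd_differentIdeal_of_sq_dvd_map hP.1 hP.2 ?_
    rw [hJ, sq]
    exact mul_dvd_mul_left Q (hQ'Q ▸ hdvd)

/-- The restriction of nonzero prime ideals of `𝓞 L` to `𝓞 k`. -/
def primeIdealsComap (k : Type*) {L : Type*} [Field k] [NumberField k] [Field L] [NumberField L]
    [Algebra k L] (Q : primeIdeals L) : primeIdeals k :=
  ⟨Q.1.comap (algebraMap (𝓞 k) (𝓞 L)), comap_mem_primeIdeals Q.2⟩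

theorem tsum_fiber_eq_of_splitsIn (hdeg : Module.finrank k L = 2) (P : primeIdeals k)
    (hs : SplitsIn k L P.1) (s : ℝ) :
    ∑' Q : primeIdealsComap (L := L) k ⁻¹' {P}, (Ideal.absNorm Q.1.1 : ℝ) ^ (-s) =
      2 * (Ideal.absNorm P.1 : ℝ) ^ (-s) := by
  obtain ⟨Q₁, Q₂, hne, hp₁, hp₂, h0₁, h0₂, h₁, h₂⟩ := hs
  obtain ⟨e₁, e₂, hmap⟩ :=
    absNorm_eq_of_comap_eq_of_ne hdeg P.2 hne ⟨h0₁, hp₁⟩ ⟨h0₂, hp₂⟩ h₁ h₂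
  have hfib : primeIdealsComap (L := L) k ⁻¹' {P} =
      (({⟨Q₁, h0₁, hp₁⟩, ⟨Q₂, h0₂, hp₂⟩} : Finset (primeIdeals L)) : Set (primeIdeals L)) := by
    ext Q
    simp only [Set.mem_preimage, Set.mem_singleton_iff, Finset.coe_insert, Finset.coe_singleton,
      Set.mem_insert_iff, Subtype.ext_iff, primeIdealsComap]
    constructor
    · intro h
      have hd := dvd_map_of_comap_eq h
      rw [hmap, (Ideal.prime_of_isPrime Q.2.1 Q.2.2).dvd_mul] at hd
      have hmax : Q.1.IsMaximal := Q.2.2.isMaximal Q.2.1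
      exact hd.imp (fun hd ↦ ((hp₁.isMaximal h0₁).eq_of_le hmax.ne_top
        (Ideal.dvd_iff_le.mp hd)).symm) (fun hd ↦ ((hp₂.isMaximal h0₂).eq_of_le hmax.ne_top
        (Ideal.dvd_iff_le.mp hd)).symm)
    · rintro (h | h)
      · rw [h, h₁]
      · rw [h, h₂]
  rw [hfib, Finset.tsum_subtype' _ (fun Q : primeIdeals L ↦ (Ideal.absNorm Q.1 : ℝ) ^ (-s)),
    Finset.sum_pair fun h ↦ hne (congrArg Subtype.val h), e₁, e₂]
  ring

theorem abs_tsum_fiber_le_of_not_splitsIn (hdeg : Module.finrank k L = 2) (P : primeIdeals k)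
    (hs : ¬ SplitsIn k L P.1) {s : ℝ} (h1 : 1 < s) :
    |∑' Q : primeIdealsComap (L := L) k ⁻¹' {P}, (Ideal.absNorm Q.1.1 : ℝ) ^ (-s)| ≤
      (Ideal.absNorm P.1 : ℝ) ^ (-2 : ℝ) +
        (primeIdealsComap k '' {Q : primeIdeals L |
          Q.1 ∣ differentIdeal (𝓞 k) (𝓞 L)}).indicator 1 P := by
  obtain ⟨Q, hQ, h, huniq, hor⟩ := exists_unique_comap_eq_of_not_splitsIn hdeg P.2 hs
  have hfib : primeIdealsComap (L := L) k ⁻¹' {P} = {⟨Q, hQ⟩} := by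
    ext Q'
    simp only [Set.mem_preimage, Set.mem_singleton_iff, Subtype.ext_iff, primeIdealsComap]
    exact ⟨huniq Q' Q'.2, fun h' ↦ by rw [h', h]⟩
  rw [hfib, tsum_singleton (⟨Q, hQ⟩ : primeIdeals L)
    (fun Q : primeIdeals L ↦ (Ideal.absNorm Q.1 : ℝ) ^ (-s)), abs_of_nonneg (by positivity)]
  rcases hor with e | hd
  · refine le_add_of_le_of_nonneg ?_ (Set.indicator_nonneg (fun _ _ ↦ zero_le_one) _)
    rw [e, Nat.cast_pow, ← Real.rpow_natCast, ← Real.rpow_mul (by positivity)]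
    exact Real.rpow_le_rpow_of_exponent_le (one_le_absNorm_of_ne_bot P.2.1) (by push_cast; linarith)
  · have hmem : P ∈ primeIdealsComap k '' {Q : primeIdeals L |
        Q.1 ∣ differentIdeal (𝓞 k) (𝓞 L)} := ⟨⟨Q, hQ⟩, hd, Subtype.ext h⟩
    rw [Set.indicator_of_mem hmem]
    refine le_add_of_nonneg_of_le (by positivity) ?_
    exact Real.rpow_le_one_of_one_le_of_nonpos (one_le_absNorm_of_ne_bot hQ.1) (by linarith)

theorem exists_abs_tsum_splitsIn_add_log_le (hdeg : Module.finrank k L = 2) :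
    ∃ C : ℝ, ∀ s : ℝ, 1 < s → s ≤ 2 →
      |∑' P : {P : Ideal (𝓞 k) | P ∈ primeIdeals k ∧ SplitsIn k L P},
        (Ideal.absNorm P.1 : ℝ) ^ (-s) + 1 / 2 * Real.log (s - 1)| ≤ C := by
  obtain ⟨C, hC⟩ := exists_abs_tsum_primeIdeals_add_log_le L
  set R := primeIdealsComap k '' {Q : primeIdeals L | Q.1 ∣ differentIdeal (𝓞 k) (𝓞 L)}
  have hR : R.Finite := by
    refine Set.Finite.image _ (Set.Finite.of_finite_image (f := Subtype.val) ?_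
      Subtype.val_injective.injOn)
    refine (finite_setOf_isPrime_dvd_differentIdeal k L).subset ?_
    rintro _ ⟨Q, hQ, rfl⟩
    exact ⟨Q.2.1, Q.2.2, hQ⟩
  have hRsum : Summable (R.indicator (1 : primeIdeals k → ℝ)) :=
    summable_of_hasFiniteSupport (hR.subset Set.support_indicator_subset)
  have hb := (summable_primeIdeals_absNorm_rpow (K := k) one_lt_two).add hRsum
  refine ⟨(C + ∑' P : primeIdeals k, ((Ideal.absNorm P.1 : ℝ) ^ (-2 : ℝ) +
    R.indicator 1 P)) / 2, fun s h1 h2 ↦ ?_⟩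
  have hL := (summable_primeIdeals_absNorm_rpow (K := L) h1).hasSum.tsum_fiberwise
    (primeIdealsComap k)
  set S := {P : Ideal (𝓞 k) | P ∈ primeIdeals k ∧ SplitsIn k L P}
  set f : Ideal (𝓞 k) → ℝ := fun P ↦ (Ideal.absNorm P : ℝ) ^ (-s)
  have hSk : ∑' P : S, f P.1 = ∑' P : primeIdeals k, S.indicator f P.1 := by
    have hsub : primeIdeals k ∩ S = S := Set.inter_eq_right.mpr fun P hP ↦ hP.1
    rw [tsum_subtype S f, tsum_subtype (primeIdeals k) (S.indicator f), Set.indicator_indicator,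
      hsub]
  have hS : HasSum (fun P : primeIdeals k ↦ S.indicator f P.1) (∑' P : S, f P.1) := by
    rw [hSk]
    exact (((summable_absNorm_rpow k h1).indicator S).subtype (primeIdeals k)).hasSum
  have hbound := tsum_of_norm_bounded hb.hasSum
    (f := fun P : primeIdeals k ↦ (∑' Q : primeIdealsComap (L := L) k ⁻¹' {P},
      (Ideal.absNorm Q.1.1 : ℝ) ^ (-s)) - 2 * S.indicator f P.1) ?_
  · rw [(hL.sub (hS.mul_left 2)).tsum_eq, Real.norm_eq_abs] at hbound
    have h := hC s h1 h2
    change |∑' P : S, f P.1 + _| ≤ _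
    rw [abs_le] at h hbound ⊢
    constructor <;> linarith [h.1, h.2, hbound.1, hbound.2]
  · intro P
    rw [Real.norm_eq_abs]
    by_cases hs : SplitsIn k L P.1
    · rw [tsum_fiber_eq_of_splitsIn hdeg P hs,
        Set.indicator_of_mem (show P.1 ∈ S from ⟨P.2, hs⟩), sub_self, abs_zero]
      exact add_nonneg (by positivity) (Set.indicator_nonneg (fun _ _ ↦ zero_le_one) _)
    · rw [Set.indicator_of_notMem fun h ↦ hs h.2, mul_zero, sub_zero]
      exact abs_tsum_fiber_le_of_not_splitsIn hdeg P hs h1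

end Splitting

/-- Mertens-type estimate: the sum of `1/|𝔭|` over primes of `k` of norm at most `y` that split
in a quadratic extension `L/k` is `(1/2)·log log y + O_{L,k}(1)`. -/
theorem stmt_4 (k L : Type*) [Field k] [NumberField k] [Field L] [NumberField L]
    [Algebra k L] (hdeg : Module.finrank k L = 2) :
    ∃ C : ℝ, ∀ y : ℝ, 3 ≤ y →
      |(∑ᶠ P ∈ {P : Ideal (𝓞 k) | P ≠ ⊥ ∧ P.IsPrime ∧ (Ideal.absNorm P : ℝ) ≤ y ∧
          SplitsIn k L P}, (1 : ℝ) / (Ideal.absNorm P : ℝ)) -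
        (1 / 2) * Real.log (Real.log y)| ≤ C := by
  set S := {P : Ideal (𝓞 k) | P ∈ primeIdeals k ∧ SplitsIn k L P}
  obtain ⟨C₀, hC₀⟩ := exists_abs_tsum_splitsIn_add_log_le (k := k) (L := L) hdeg
  obtain ⟨C, hC⟩ := exists_abs_tsum_inv_sub_loglog_le
    (n := fun P : S ↦ (Ideal.absNorm P.1 : ℝ)) (fun P ↦ one_le_absNorm_of_ne_bot P.2.1.1)
    (fun s hs ↦ (summable_absNorm_rpow k hs).subtype S) hC₀
  refine ⟨C, fun y hy ↦ ?_⟩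
  convert hC y hy using 3
  set A := {P : Ideal (𝓞 k) | P ≠ ⊥ ∧ P.IsPrime ∧ (Ideal.absNorm P : ℝ) ≤ y ∧ SplitsIn k L P}
  have hA : A.Finite := by
    refine (Ideal.finite_setOfPred_absNorm_le (S := 𝓞 k) ⌊y⌋₊).subset fun P hP ↦ ?_
    exact Nat.le_floor hP.2.2.1
  rw [finsum_mem_eq_finite_toFinset_sum _ hA, ← Finset.tsum_subtype', hA.coe_toFinset,
    tsum_subtype A (fun P ↦ (1 : ℝ) / (Ideal.absNorm P : ℝ)),
    tsum_subtype S (fun P ↦ if (Ideal.absNorm P : ℝ) ≤ y then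
      (1 : ℝ) / (Ideal.absNorm P : ℝ) else 0)]
  refine tsum_congr fun P ↦ ?_
  have hAS : P ∈ A ↔ P ∈ S ∧ (Ideal.absNorm P : ℝ) ≤ y := by
    simp only [A, S, primeIdeals, Set.mem_ofPred_eq]
    tauto
  by_cases hS : P ∈ S <;> by_cases hPy : (Ideal.absNorm P : ℝ) ≤ y <;>
    simp [hAS, hS, hPy]
end

section
/- Let L/k be a quadratic extension of number fields. There exists a constant C, depending on L and k, such that for all real y ≥ 3: ∏_{𝔭 : |𝔭| ≤ y, 𝔭 splits in L} (1 − 1/|𝔭|) ≤ C·(log y)^{-1/2}, where the product runs over the finitely many nonzero prime ideals 𝔭 of 𝓞_k of absolute norm at most y that split in L. -/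
open NumberField

section

open Ideal

section NumberField

variable {K : Type*} [Field K] [NumberField K]

theorem absNorm_pos {I : Ideal (𝓞 K)} (hI : I ≠ ⊥) : 0 < absNorm I :=
  Nat.pos_of_ne_zero (absNorm_eq_zero_iff.not.mpr hI)

theorem inv_absNorm_le_half {P : Ideal (𝓞 K)} (hP : P.IsPrime) (hP0 : P ≠ ⊥) :
    (absNorm P : ℝ)⁻¹ ≤ 1 / 2 := by
  have h0 := absNorm_pos hP0
  have h1 : absNorm P ≠ 1 := fun h ↦ hP.ne_top (absNorm_eq_one_iff.mp h)
  have h2 : (2 : ℝ) ≤ absNorm P := by exact_mod_cast (by omega : 2 ≤ absNorm P)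
  rw [one_div]
  gcongr

theorem one_le_inv_one_sub {P : Ideal (𝓞 K)}
    (hP : P.IsPrime) (hP0 : P ≠ ⊥) : 1 ≤ (1 - (absNorm P : ℝ)⁻¹)⁻¹ := by
  have h := inv_absNorm_le_half hP hP0
  have h0 : 0 ≤ (absNorm P : ℝ)⁻¹ := by positivity
  exact (one_le_inv₀ (by linarith)).mpr (by linarith)

theorem sum_inv_absNorm_le_prod_primes (S : Finset (Ideal (𝓞 K)))
    (hS : ∀ P ∈ S, P.IsPrime ∧ P ≠ ⊥) (F : Finset (Ideal (𝓞 K)))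
    (hF : ∀ I ∈ F, I ≠ ⊥ ∧ ∀ P : Ideal (𝓞 K), P.IsPrime → P ≠ ⊥ → P ∣ I → P ∈ S) :
    ∑ I ∈ F, (absNorm I : ℝ)⁻¹ ≤ ∏ P ∈ S, (1 - (absNorm P : ℝ)⁻¹)⁻¹ := by
  classical
  induction S using Finset.induction_on generalizing F with
  | empty =>
    have hsub : F ⊆ {⊤} := fun I hI ↦ by
      obtain ⟨hI0, hI1⟩ := hF I hI
      rw [Finset.mem_singleton]
      by_contra hne
      obtain ⟨M, hM, hIM⟩ := exists_le_maximal I hne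
      exact absurd (hI1 M hM.isPrime (ne_bot_of_le_ne_bot hI0 hIM) (dvd_iff_le.mpr hIM))
        (Finset.notMem_empty M)
    calc ∑ I ∈ F, (absNorm I : ℝ)⁻¹ ≤ ∑ I ∈ {(⊤ : Ideal (𝓞 K))}, (absNorm I : ℝ)⁻¹ :=
          Finset.sum_le_sum_of_subset_of_nonneg hsub fun _ _ _ ↦ by positivity
      _ ≤ _ := by simp
  | insert P S hPS ih =>
    obtain ⟨hP, hP0⟩ := hS P (Finset.mem_insert_self P S)
    have hdec : ∀ I ∈ F, ∃ a J, ¬ P ∣ J ∧ I = P ^ a * J := fun I hI ↦ by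
      obtain ⟨J, h1, h2⟩ := (FiniteMultiplicity.of_prime_left (prime_of_isPrime hP0 hP)
        (hF I hI).1).exists_eq_pow_mul_and_not_dvd
      exact ⟨_, J, h2, h1⟩
    choose! a J hJ hI using hdec
    obtain ⟨n, hn⟩ := (F.image a).bddAbove
    have hinj : Set.InjOn (fun I ↦ (a I, J I)) F := fun I₁ h₁ I₂ h₂ h ↦ by
      rw [Prod.mk.injEq] at h
      rw [hI I₁ h₁, hI I₂ h₂, h.1, h.2]
    have hJS : ∑ I ∈ F.image J, (absNorm I : ℝ)⁻¹ ≤ ∏ P ∈ S, (1 - (absNorm P : ℝ)⁻¹)⁻¹ := by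
      refine ih (fun Q hQ ↦ hS Q (Finset.mem_insert_of_mem hQ)) _ fun I hIJ ↦ ?_
      obtain ⟨I, hIF, rfl⟩ := Finset.mem_image.mp hIJ
      refine ⟨fun h ↦ hJ I hIF (h ▸ dvd_zero P), fun Q hQ hQ0 hdvd ↦ ?_⟩
      refine (Finset.mem_insert.mp ((hF I hIF).2 Q hQ hQ0 ?_)).resolve_left ?_
      · rw [hI I hIF]
        exact hdvd.mul_left _
      · rintro rfl
        exact hJ I hIF hdvd
    have hx : (absNorm P : ℝ)⁻¹ < 1 := (inv_absNorm_le_half hP hP0).trans_lt (by norm_num)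
    have hgeom : ∑ i ∈ Finset.range (n + 1), ((absNorm P : ℝ)⁻¹) ^ i ≤
        (1 - (absNorm P : ℝ)⁻¹)⁻¹ :=
      (summable_geometric_of_lt_one (by positivity) hx).sum_le_tsum _
        (fun _ _ ↦ by positivity) |>.trans_eq (tsum_geometric_of_lt_one (by positivity) hx)
    calc ∑ I ∈ F, (absNorm I : ℝ)⁻¹
        = ∑ x ∈ F.image (fun I ↦ (a I, J I)), ((absNorm P : ℝ)⁻¹) ^ x.1 * (absNorm x.2 : ℝ)⁻¹ := by
          rw [Finset.sum_image hinj]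
          refine Finset.sum_congr rfl fun I h ↦ ?_
          conv_lhs => rw [hI I h]
          simp [mul_comm]
      _ ≤ ∑ x ∈ Finset.range (n + 1) ×ˢ F.image J,
            ((absNorm P : ℝ)⁻¹) ^ x.1 * (absNorm x.2 : ℝ)⁻¹ := by
          refine Finset.sum_le_sum_of_subset_of_nonneg (fun x hx ↦ ?_) fun _ _ _ ↦ by positivity
          obtain ⟨I, h, rfl⟩ := Finset.mem_image.mp hx
          exact Finset.mem_product.mpr ⟨Finset.mem_range.mpr (Nat.lt_succ_of_le
            (hn (by exact_mod_cast Finset.mem_image_of_mem a h))), Finset.mem_image_of_mem J h⟩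
      _ = (∑ i ∈ Finset.range (n + 1), ((absNorm P : ℝ)⁻¹) ^ i) *
            ∑ I ∈ F.image J, (absNorm I : ℝ)⁻¹ := by
          rw [Finset.sum_product, Finset.sum_mul_sum]
      _ ≤ _ := by
          rw [Finset.prod_insert hPS]
          gcongr

variable (K) in
theorem tendsto_card_absNorm_le_div :
    Filter.Tendsto (fun n : ℕ ↦
      (Nat.card {I : Ideal (𝓞 K) // I ≠ ⊥ ∧ absNorm I ≤ n} : ℝ) / n) Filter.atTop
      (nhds (dedekindZeta_residue K)) := by
  refine ((NumberField.Ideal.tendsto_norm_le_div_atTop₀ K).comp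
    tendsto_natCast_atTop_atTop).congr fun n ↦ ?_
  simp only [Function.comp_apply, Nat.cast_le]
  congr 2
  exact Nat.card_congr ((Equiv.subtypeSubtypeEquivSubtypeInter _ (fun I ↦ absNorm I ≤ n)).trans
    (Equiv.subtypeEquivRight fun I ↦ by rw [mem_nonZeroDivisors_iff_ne_zero, zero_eq_bot]))

variable (K) in
theorem exists_mul_le_card_absNorm_le :
    ∃ c : ℝ, 0 < c ∧ ∀ n : ℕ, 1 ≤ n →
      c * n ≤ Nat.card {I : Ideal (𝓞 K) // I ≠ ⊥ ∧ absNorm I ≤ n} := by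
  have hρ := dedekindZeta_residue_pos K
  obtain ⟨N, hN⟩ := Filter.eventually_atTop.mp
    ((tendsto_card_absNorm_le_div K).eventually_const_lt (half_lt_self hρ))
  refine ⟨min (dedekindZeta_residue K / 2) ((N : ℝ) + 1)⁻¹, by positivity, fun n hn ↦ ?_⟩
  have hn0 : (0 : ℝ) < n := by exact_mod_cast hn
  rcases le_total N n with h | h
  · calc _ ≤ dedekindZeta_residue K / 2 * n := by gcongr; exact min_le_left _ _
      _ ≤ _ := (le_div_iff₀ hn0).mp (hN n h).le
  · calc _ ≤ ((N : ℝ) + 1)⁻¹ * n := by gcongr; exact min_le_right _ _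
      _ ≤ 1 := by
        rw [inv_mul_le_one₀ (by positivity)]
        exact_mod_cast h.trans N.le_succ
      _ ≤ _ := by
        have : Finite {I : Ideal (𝓞 K) // I ≠ ⊥ ∧ absNorm I ≤ n} :=
          (finite_setOfPred_absNorm_le n).subset fun I hI ↦ hI.2
        have : Nonempty {I : Ideal (𝓞 K) // I ≠ ⊥ ∧ absNorm I ≤ n} :=
          ⟨⟨⊤, top_ne_bot, by simpa using hn⟩⟩
        exact_mod_cast Nat.card_pos

variable (K) in
theorem exists_mul_log_le_sum_inv_absNorm :
    ∃ c : ℝ, 0 < c ∧ ∀ y : ℝ, 1 ≤ y → ∀ F : Finset (Ideal (𝓞 K)),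
      (∀ I, I ∈ F ↔ I ≠ ⊥ ∧ (absNorm I : ℝ) ≤ y) →
      c * Real.log y ≤ ∑ I ∈ F, (absNorm I : ℝ)⁻¹ := by
  classical
  obtain ⟨c, hc, hcard⟩ := exists_mul_le_card_absNorm_le K
  refine ⟨c / 2, by positivity, fun y hy F hF ↦ ?_⟩
  have htel : ∀ N m : ℕ, 1 ≤ N → N ≤ m + 1 →
      ∑ n ∈ Finset.Ico N (m + 1), ((n : ℝ) * (n + 1))⁻¹ = (N : ℝ)⁻¹ - ((m : ℝ) + 1)⁻¹ := by
    intro N m hN hNm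
    have := Finset.sum_Ico_sub (fun n : ℕ ↦ - (n : ℝ)⁻¹) hNm
    rw [neg_sub_neg] at this
    push_cast at this
    rw [← this]
    refine Finset.sum_congr rfl fun n hn ↦ ?_
    have : 0 < (n : ℝ) := by exact_mod_cast hN.trans (Finset.mem_Ico.mp hn).1
    field_simp
    ring
  set m := ⌊y⌋₊ with hm
  have hF' : ∀ I, I ∈ F ↔ I ≠ ⊥ ∧ absNorm I ≤ m := fun I ↦ by
    rw [hF, hm, Nat.le_floor_iff (by linarith)]
  calc c / 2 * Real.log y ≤ c / 2 * (harmonic m : ℝ) := by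
        gcongr
        exact log_le_harmonic_floor y (by linarith)
    _ ≤ ∑ n ∈ Finset.Ico 1 (m + 1), (c * n) * ((n : ℝ) * (n + 1))⁻¹ := by
        rw [harmonic_eq_sum_Icc, Rat.cast_sum, Finset.mul_sum]
        refine Finset.sum_le_sum fun n hn ↦ ?_
        have : 1 ≤ (n : ℝ) := by exact_mod_cast (Finset.mem_Icc.mp hn).1
        push_cast
        rw [← div_eq_mul_inv, ← div_eq_mul_inv, div_div,
          div_le_div_iff₀ (by positivity) (by positivity)]
        nlinarith [mul_nonneg (mul_nonneg hc.le (by positivity : (0 : ℝ) ≤ n))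
          (sub_nonneg.mpr this)]
    _ ≤ ∑ n ∈ Finset.Ico 1 (m + 1), ∑ I ∈ F with absNorm I ≤ n, ((n : ℝ) * (n + 1))⁻¹ := by
        refine Finset.sum_le_sum fun n hn ↦ ?_
        obtain ⟨hn1, hn2⟩ := Finset.mem_Ico.mp hn
        rw [Finset.sum_const, nsmul_eq_mul]
        gcongr
        refine (hcard n hn1).trans_eq ?_
        rw [Nat.subtype_card]
        intro I
        rw [Finset.mem_filter, hF']
        grind
    _ = ∑ I ∈ F, ∑ n ∈ Finset.Ico (absNorm I) (m + 1), ((n : ℝ) * (n + 1))⁻¹ := by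
        refine Finset.sum_comm' fun n I ↦ ?_
        rw [Finset.mem_filter, Finset.mem_Ico, Finset.mem_Ico, hF']
        have h0 : I ≠ ⊥ → 0 < absNorm I := absNorm_pos
        grind
    _ ≤ _ := by
        refine Finset.sum_le_sum fun I hI ↦ ?_
        obtain ⟨hI0, hI1⟩ := (hF' I).mp hI
        rw [htel _ _ (absNorm_pos hI0) (by omega)]
        exact sub_le_self _ (by positivity)

variable (K) in
theorem exists_sum_inv_absNorm_sq_le :
    ∃ C : ℝ, ∀ F : Finset (Ideal (𝓞 K)), (∀ I ∈ F, I ≠ ⊥) →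
      ∑ I ∈ F, ((absNorm I : ℝ)⁻¹) ^ 2 ≤ C := by
  classical
  let a : ℕ → ℕ := fun n ↦ Nat.card {I : Ideal (𝓞 K) // absNorm I = n}
  have hsum (n : ℕ) : ∑ i ∈ Finset.Icc 1 n, (a i : ℝ) =
      Nat.card {I : Ideal (𝓞 K) // I ≠ ⊥ ∧ absNorm I ≤ n} := by
    have hfin := finite_setOfPred_absNorm_le (S := 𝓞 K) n
    have hb (I : Ideal (𝓞 K)) : I ≠ ⊥ ↔ 1 ≤ absNorm I := by
      rw [Nat.one_le_iff_ne_zero, Ne, Ne, absNorm_eq_zero_iff]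
    rw [Nat.subtype_card (hfin.toFinset.filter (· ≠ ⊥)) (by
        intro I
        rw [Finset.mem_filter, Set.Finite.mem_toFinset, and_comm]
        rfl),
      Finset.card_eq_sum_card_fiberwise (f := fun I ↦ absNorm I) (t := Finset.Icc 1 n)]
    · push_cast
      refine Finset.sum_congr rfl fun i hi ↦ ?_
      rw [Finset.mem_Icc] at hi
      congr 1
      refine Nat.subtype_card _ fun I ↦ ?_
      simp only [Finset.mem_filter, Set.Finite.mem_toFinset, Set.mem_ofPred_eq, hb]
      omega
    · intro I hI
      simp only [Finset.coe_filter, Set.Finite.mem_toFinset, Set.mem_ofPred_eq, hb] at hI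
      simp only [Finset.coe_Icc, Set.mem_Icc]
      exact hI.symm
  have hO : (fun n ↦ ∑ i ∈ Finset.Icc 1 n, (a i : ℝ)) =O[Filter.atTop]
      fun n : ℕ ↦ (n : ℝ) ^ (1 : ℝ) := by
    simp only [hsum, Real.rpow_one]
    refine Asymptotics.isBigO_of_div_tendsto_nhds ?_ _ (tendsto_card_absNorm_le_div K)
    filter_upwards [Filter.eventually_ge_atTop 1] with n hn h
    exact absurd h (by positivity)
  have hL : LSeriesSummable (fun n ↦ ((a n : ℝ) : ℂ)) 2 :=
    LSeriesSummable_of_sum_norm_bigO_and_nonneg hO (fun _ ↦ Nat.cast_nonneg _) zero_le_one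
      (by norm_num)
  have hS : Summable fun n : ℕ ↦ (a n : ℝ) * ((n : ℝ)⁻¹) ^ 2 := by
    refine hL.norm.congr fun n ↦ ?_
    rw [LSeries.norm_term_eq]
    rcases eq_or_ne n 0 with rfl | hn
    · simp
    · simp [hn, div_eq_mul_inv]
  refine ⟨∑' n : ℕ, (a n : ℝ) * ((n : ℝ)⁻¹) ^ 2, fun F hF ↦ ?_⟩
  rw [← Finset.sum_fiberwise_of_maps_to (t := F.image fun I ↦ absNorm I)
    (g := fun I ↦ absNorm I) fun I hI ↦ Finset.mem_image_of_mem _ hI]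
  refine le_trans (Finset.sum_le_sum fun n hn ↦ ?_)
    (hS.sum_le_tsum (F.image fun I ↦ absNorm I) fun _ _ ↦ by positivity)
  obtain ⟨J, hJ, hJn⟩ := Finset.mem_image.mp hn
  rw [Finset.sum_congr rfl (g := fun _ ↦ ((n : ℝ)⁻¹) ^ 2) fun I hI ↦ by
    rw [(Finset.mem_filter.mp hI).2], Finset.sum_const, nsmul_eq_mul]
  gcongr
  have hfin : Finite {I : Ideal (𝓞 K) // absNorm I = n} := finite_setOfPred_absNorm_eq n
  rw [← Nat.card_eq_finsetCard]
  exact Nat.card_le_card_of_injective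
    (fun I ↦ ⟨I.1, (Finset.mem_filter.mp I.2).2⟩) fun I J h ↦ Subtype.ext (congrArg (·.1) h)

variable (K) in
theorem exists_prod_inv_one_sub_inv_absNorm_sq_le :
    ∃ C : ℝ, ∀ F : Finset (Ideal (𝓞 K)), (∀ P ∈ F, P.IsPrime ∧ P ≠ ⊥) →
      ∏ P ∈ F, (1 - ((absNorm P : ℝ)⁻¹) ^ 2)⁻¹ ≤ C := by
  obtain ⟨C, hC⟩ := exists_sum_inv_absNorm_sq_le K
  refine ⟨Real.exp (2 * C), fun F hF ↦ ?_⟩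
  calc ∏ P ∈ F, (1 - ((absNorm P : ℝ)⁻¹) ^ 2)⁻¹
      ≤ ∏ P ∈ F, Real.exp (2 * ((absNorm P : ℝ)⁻¹) ^ 2) := by
        refine Finset.prod_le_prod (fun P hP ↦ ?_) fun P hP ↦ ?_
        all_goals
          have h := inv_absNorm_le_half (hF P hP).1 (hF P hP).2
          have h0 : 0 ≤ (absNorm P : ℝ)⁻¹ := by positivity
          have h2 : ((absNorm P : ℝ)⁻¹) ^ 2 ≤ 1 / 4 := by nlinarith
        · exact inv_nonneg.mpr (by linarith)
        · refine le_trans ?_ (Real.add_one_le_exp _)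
          rw [inv_le_iff_one_le_mul₀ (by linarith)]
          nlinarith [sq_nonneg ((absNorm P : ℝ)⁻¹)]
    _ = Real.exp (2 * ∑ P ∈ F, ((absNorm P : ℝ)⁻¹) ^ 2) := by
        rw [← Real.exp_sum, Finset.mul_sum]
    _ ≤ _ := by
        gcongr
        exact hC F fun P hP ↦ (hF P hP).2

variable (K) in
theorem finite_setOf_isPrime_absNorm_le (y : ℝ) :
    {P : Ideal (𝓞 K) | P.IsPrime ∧ P ≠ ⊥ ∧ (absNorm P : ℝ) ≤ y}.Finite :=
  (finite_setOfPred_absNorm_le ⌊y⌋₊).subset fun _ hP ↦ Nat.le_floor hP.2.2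

variable (K) in
theorem exists_mul_log_le_prod_primes :
    ∃ c : ℝ, 0 < c ∧ ∀ y : ℝ, 1 ≤ y → c * Real.log y ≤
      ∏ P ∈ (finite_setOf_isPrime_absNorm_le K y).toFinset, (1 - (absNorm P : ℝ)⁻¹)⁻¹ := by
  obtain ⟨c, hc, h⟩ := exists_mul_log_le_sum_inv_absNorm K
  refine ⟨c, hc, fun y hy ↦ ?_⟩
  have hfin : {I : Ideal (𝓞 K) | I ≠ ⊥ ∧ (absNorm I : ℝ) ≤ y}.Finite :=
    (finite_setOfPred_absNorm_le ⌊y⌋₊).subset fun _ hI ↦ Nat.le_floor hI.2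
  refine (h y hy hfin.toFinset fun I ↦ hfin.mem_toFinset).trans
    (sum_inv_absNorm_le_prod_primes _ (fun P hP ↦ ?_) _ fun I hI ↦ ?_)
  · have := (Set.Finite.mem_toFinset _).mp hP
    exact ⟨this.1, this.2.1⟩
  · obtain ⟨hI0, hIy⟩ := hfin.mem_toFinset.mp hI
    refine ⟨hI0, fun P hP hP0 hdvd ↦ (Set.Finite.mem_toFinset _).mpr ⟨hP, hP0, le_trans ?_ hIy⟩⟩
    exact_mod_cast Nat.le_of_dvd (absNorm_pos hI0)
      (map_dvd absNorm hdvd)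

end NumberField

section Extension

variable {k L : Type*} [Field k] [NumberField k] [Field L] [NumberField L] [Algebra k L]

theorem absNorm_eq_absNorm_under_pow {P : Ideal (𝓞 L)} (hP : P.IsPrime) (hP0 : P ≠ ⊥) :
    absNorm P = absNorm (P.under (𝓞 k)) ^ P.inertiaDeg (𝓞 k) := by
  have : P.IsMaximal := hP.isMaximal hP0
  have : (P.under (𝓞 k)).IsMaximal := inferInstance
  rw [← absNorm_relNorm (𝓞 k), relNorm_eq_pow_of_isMaximal P (P.under (𝓞 k)), map_pow]

theorem absNorm_under_le {P : Ideal (𝓞 L)} (hP : P.IsPrime) (hP0 : P ≠ ⊥) :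
    absNorm (P.under (𝓞 k)) ≤ absNorm P := by
  rw [absNorm_eq_absNorm_under_pow (k := k) hP hP0]
  exact Nat.le_self_pow (inertiaDeg_pos P (𝓞 k)).ne' _

theorem card_le_finrank_of_under_eq {p : Ideal (𝓞 k)} (hp : p.IsPrime) (hp0 : p ≠ ⊥)
    (F : Finset (Ideal (𝓞 L))) (hF : ∀ P ∈ F, P.IsPrime ∧ P.under (𝓞 k) = p) :
    F.card ≤ Module.finrank k L := by
  have : p.IsMaximal := hp.isMaximal hp0
  have hfin := IsDedekindDomain.primesOver_finite p (𝓞 L)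
  have := hfin.fintype
  rw [IsFractionRing.finrank_eq (𝓞 k) k (𝓞 L) L, ← sum_ramification_inertia_eq_finrank p (𝓞 L)]
  calc F.card ≤ Fintype.card (p.primesOver (𝓞 L)) := by
        rw [← Set.toFinset_card]
        refine Finset.card_le_card fun P hP ↦ Set.mem_toFinset.mpr ?_
        exact ⟨(hF P hP).1, ⟨(hF P hP).2.symm⟩⟩
    _ = ∑ q : p.primesOver (𝓞 L), 1 := by simp
    _ ≤ _ := by
        refine Finset.sum_le_sum fun q _ ↦ ?_
        have := q.2.1
        exact Nat.mul_pos (ramificationIdx_pos q.1 (𝓞 k)) (inertiaDeg_pos q.1 (𝓞 k))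

theorem eq_of_under_eq_of_not_splitsIn {p : Ideal (𝓞 k)} (hsplit : ¬ SplitsIn k L p)
    {P Q : Ideal (𝓞 L)} (hP : P.IsPrime) (hQ : Q.IsPrime) (hP0 : P ≠ ⊥) (hQ0 : Q ≠ ⊥)
    (hPp : P.under (𝓞 k) = p) (hQp : Q.under (𝓞 k) = p) : P = Q := by
  by_contra hne
  exact hsplit ⟨P, Q, hne, hP, hQ, hP0, hQ0, hPp, hQp⟩

theorem inertiaDeg_eq_finrank_of_not_splitsIn {P : Ideal (𝓞 L)} (hP : P.IsPrime) (hP0 : P ≠ ⊥)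
    (hsplit : ¬ SplitsIn k L (P.under (𝓞 k))) (hdiff : ¬ P ∣ differentIdeal (𝓞 k) (𝓞 L)) :
    P.inertiaDeg (𝓞 k) = Module.finrank k L := by
  have : P.IsMaximal := hP.isMaximal hP0
  have : (P.under (𝓞 k)).IsMaximal := inferInstance
  have hram : P.ramificationIdx (𝓞 k) = 1 := by
    have := not_dvd_differentIdeal_iff.mp hdiff
    exact ramificationIdx_eq_one _ _
  have hfin := IsDedekindDomain.primesOver_finite (P.under (𝓞 k)) (𝓞 L)
  have := hfin.fintype
  rw [IsFractionRing.finrank_eq (𝓞 k) k (𝓞 L) L,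
    ← sum_ramification_inertia_eq_finrank (P.under (𝓞 k)) (𝓞 L),
    Fintype.sum_eq_single (⟨P, hP, ⟨rfl⟩⟩ : (P.under (𝓞 k)).primesOver (𝓞 L))]
  · simp [hram]
  · rintro ⟨Q, hQ, hQP⟩ hne
    refine absurd (Subtype.ext ?_) hne
    have hQ0 : Q ≠ ⊥ := by
      rintro rfl
      exact hP0 (eq_bot_of_comap_eq_bot (R := 𝓞 k) (hQP.over.trans (by simp)))
    exact eq_of_under_eq_of_not_splitsIn hsplit hQ hP hQ0 hP0 hQP.over.symm rfl

variable (k L) in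
theorem finite_primes_dvd_differentIdeal :
    {P : Ideal (𝓞 L) | P.IsPrime ∧ P ≠ ⊥ ∧ P ∣ differentIdeal (𝓞 k) (𝓞 L)}.Finite := by
  have h0 : differentIdeal (𝓞 k) (𝓞 L) ≠ ⊥ := differentIdeal_ne_bot
  refine ((finite_factors h0).image fun v ↦ v.asIdeal).subset ?_
  rintro P ⟨hP, hP0, hdvd⟩
  exact ⟨⟨P, hP, hP0⟩, hdvd, rfl⟩

variable (k L) in
/-- The primes of `k` of norm at most `y` that split in `L`. -/
noncomputable def splitPrimes (y : ℝ) : Finset (Ideal (𝓞 k)) :=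
  ((finite_setOf_isPrime_absNorm_le k y).inter_of_left {p | SplitsIn k L p}).toFinset

theorem mem_splitPrimes {y : ℝ} {p : Ideal (𝓞 k)} : p ∈ splitPrimes k L y ↔
    (p.IsPrime ∧ p ≠ ⊥ ∧ (absNorm p : ℝ) ≤ y) ∧ SplitsIn k L p :=
  Set.Finite.mem_toFinset _

theorem prod_primes_over_splitPrimes_le (hdeg : Module.finrank k L = 2) (y : ℝ)
    (F : Finset (Ideal (𝓞 L)))
    (hF : ∀ P ∈ F, P.IsPrime ∧ P ≠ ⊥ ∧ P.under (𝓞 k) ∈ splitPrimes k L y) :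
    ∏ P ∈ F, (1 - (absNorm P : ℝ)⁻¹)⁻¹ ≤
      (∏ p ∈ splitPrimes k L y, (1 - (absNorm p : ℝ)⁻¹)⁻¹) ^ 2 := by
  classical
  rw [← Finset.prod_fiberwise_of_maps_to fun P hP ↦ (hF P hP).2.2, ← Finset.prod_pow]
  refine Finset.prod_le_prod (fun p hp ↦ Finset.prod_nonneg fun P hP ↦ ?_) fun p hp ↦ ?_
  · obtain ⟨h1, h2, -⟩ := hF P (Finset.mem_filter.mp hP).1
    exact zero_le_one.trans (one_le_inv_one_sub h1 h2)
  · obtain ⟨⟨hp1, hp0, -⟩, -⟩ := mem_splitPrimes.mp hp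
    calc ∏ P ∈ F with P.under (𝓞 k) = p, (1 - (absNorm P : ℝ)⁻¹)⁻¹
        ≤ ∏ P ∈ F with P.under (𝓞 k) = p, (1 - (absNorm p : ℝ)⁻¹)⁻¹ := by
          refine Finset.prod_le_prod (fun P hP ↦ ?_) fun P hP ↦ ?_
          all_goals
            obtain ⟨hPF, hPp⟩ := Finset.mem_filter.mp hP
            obtain ⟨h1, h2, -⟩ := hF P hPF
          · exact zero_le_one.trans (one_le_inv_one_sub h1 h2)
          · have hp_half := inv_absNorm_le_half hp1 hp0
            have hle : (absNorm p : ℝ) ≤ absNorm P := by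
              exact_mod_cast hPp ▸ absNorm_under_le (k := k) h1 h2
            have hpos : (0 : ℝ) < absNorm p := by
              exact_mod_cast absNorm_pos hp0
            have : (absNorm P : ℝ)⁻¹ ≤ (absNorm p : ℝ)⁻¹ := by gcongr
            exact inv_anti₀ (by linarith) (by linarith)
      _ ≤ _ := by
          rw [Finset.prod_const]
          refine pow_le_pow_right₀ (one_le_inv_one_sub hp1 hp0) ?_
          rw [← hdeg]
          refine card_le_finrank_of_under_eq hp1 hp0 _ fun P hP ↦ ?_
          obtain ⟨hPF, hPp⟩ := Finset.mem_filter.mp hP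
          exact ⟨(hF P hPF).1, hPp⟩

theorem prod_inert_primes_eq (hdeg : Module.finrank k L = 2) (F : Finset (Ideal (𝓞 L)))
    (hF : ∀ P ∈ F, P.IsPrime ∧ P ≠ ⊥ ∧ ¬ SplitsIn k L (P.under (𝓞 k)) ∧
      ¬ P ∣ differentIdeal (𝓞 k) (𝓞 L)) [DecidableEq (Ideal (𝓞 k))] :
    ∏ P ∈ F, (1 - (absNorm P : ℝ)⁻¹)⁻¹ =
      ∏ p ∈ F.image fun P ↦ P.under (𝓞 k), (1 - ((absNorm p : ℝ)⁻¹) ^ 2)⁻¹ := by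
  rw [Finset.prod_image fun P hP Q hQ h ↦ by
    obtain ⟨hP1, hP2, hP3, -⟩ := hF P hP
    obtain ⟨hQ1, hQ2, -, -⟩ := hF Q hQ
    exact eq_of_under_eq_of_not_splitsIn hP3 hP1 hQ1 hP2 hQ2 rfl h.symm]
  refine Finset.prod_congr rfl fun P hP ↦ ?_
  obtain ⟨hP1, hP2, hP3, hP4⟩ := hF P hP
  rw [absNorm_eq_absNorm_under_pow (k := k) hP1 hP2,
    inertiaDeg_eq_finrank_of_not_splitsIn hP1 hP2 hP3 hP4, hdeg, Nat.cast_pow, inv_pow]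

theorem exists_prod_primes_le_mul_prod_splitPrimes_sq (hdeg : Module.finrank k L = 2) :
    ∃ D : ℝ, 0 < D ∧ ∀ y : ℝ,
      ∏ P ∈ (finite_setOf_isPrime_absNorm_le L y).toFinset, (1 - (absNorm P : ℝ)⁻¹)⁻¹ ≤
        D * (∏ p ∈ splitPrimes k L y, (1 - (absNorm p : ℝ)⁻¹)⁻¹) ^ 2 := by
  classical
  obtain ⟨C, hC⟩ := exists_prod_inv_one_sub_inv_absNorm_sq_le k
  set R := (finite_primes_dvd_differentIdeal k L).toFinset
  have hmemR {P : Ideal (𝓞 L)} : P ∈ R ↔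
      P.IsPrime ∧ P ≠ ⊥ ∧ P ∣ differentIdeal (𝓞 k) (𝓞 L) := Set.Finite.mem_toFinset _
  have hC1 : 1 ≤ C := by simpa using hC ∅
  have hR1 : 1 ≤ ∏ P ∈ R, (1 - (absNorm P : ℝ)⁻¹)⁻¹ :=
    Finset.one_le_prod fun P hP ↦ one_le_inv_one_sub (hmemR.mp hP).1 (hmemR.mp hP).2.1
  refine ⟨(∏ P ∈ R, (1 - (absNorm P : ℝ)⁻¹)⁻¹) * C, by positivity, fun y ↦ ?_⟩
  set T := (finite_setOf_isPrime_absNorm_le L y).toFinset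
  have hmemT {P : Ideal (𝓞 L)} : P ∈ T ↔ P.IsPrime ∧ P ≠ ⊥ ∧ (absNorm P : ℝ) ≤ y :=
    Set.Finite.mem_toFinset _
  have hone (F : Finset (Ideal (𝓞 L))) (hF : F ⊆ T) :
      0 ≤ ∏ P ∈ F, (1 - (absNorm P : ℝ)⁻¹)⁻¹ :=
    Finset.prod_nonneg fun P hP ↦ zero_le_one.trans
      (one_le_inv_one_sub (hmemT.mp (hF hP)).1 (hmemT.mp (hF hP)).2.1)
  rw [← Finset.prod_filter_mul_prod_filter_not T (fun P ↦ SplitsIn k L (P.under (𝓞 k))),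
    ← Finset.prod_filter_mul_prod_filter_not ({P ∈ T | ¬ SplitsIn k L (P.under (𝓞 k))})
      (fun P ↦ P ∣ differentIdeal (𝓞 k) (𝓞 L)), mul_comm]
  refine mul_le_mul (mul_le_mul ?_ ?_
      (hone _ ((Finset.filter_subset _ _).trans (Finset.filter_subset _ _))) (by positivity))
    ?_ (hone _ (Finset.filter_subset _ _)) (by positivity)
  · refine Finset.prod_le_prod_of_subset_of_one_le ?_ ?_ ?_
    · intro P hP
      simp only [Finset.mem_filter, hmemT] at hP
      exact hmemR.mpr ⟨hP.1.1.1, hP.1.1.2.1, hP.2⟩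
    · intro P hP
      simp only [Finset.mem_filter, hmemT] at hP
      exact zero_le_one.trans (one_le_inv_one_sub hP.1.1.1 hP.1.1.2.1)
    · exact fun P hP _ ↦ one_le_inv_one_sub (hmemR.mp hP).1 (hmemR.mp hP).2.1
  · rw [prod_inert_primes_eq (k := k) hdeg]
    · refine hC _ fun p hp ↦ ?_
      obtain ⟨P, hP, rfl⟩ := Finset.mem_image.mp hp
      simp only [Finset.mem_filter, hmemT] at hP
      have := hP.1.1.1
      exact ⟨inferInstance, mt eq_bot_of_comap_eq_bot hP.1.1.2.1⟩
    · intro P hP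
      simp only [Finset.mem_filter, hmemT] at hP
      exact ⟨hP.1.1.1, hP.1.1.2.1, hP.1.2, hP.2⟩
  · refine prod_primes_over_splitPrimes_le hdeg y _ fun P hP ↦ ?_
    simp only [Finset.mem_filter, hmemT] at hP
    obtain ⟨⟨h1, h2, h3⟩, h4⟩ := hP
    refine ⟨h1, h2, mem_splitPrimes.mpr
      ⟨⟨inferInstance, mt eq_bot_of_comap_eq_bot h2, le_trans ?_ h3⟩, h4⟩⟩
    exact_mod_cast absNorm_under_le h1 h2

end Extension

end

/-- The product of `1 − 1/|𝔭|` over the primes of `k` of norm at most `y` that split in a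
quadratic extension `L/k` is `O_{L,k}((log y)^{-1/2})`. -/
theorem stmt_5 (k L : Type*) [Field k] [NumberField k] [Field L] [NumberField L]
    [Algebra k L] (hdeg : Module.finrank k L = 2) :
    ∃ C : ℝ, ∀ y : ℝ, 3 ≤ y →
      (∏ᶠ P ∈ {P : Ideal (𝓞 k) | P ≠ ⊥ ∧ P.IsPrime ∧ (Ideal.absNorm P : ℝ) ≤ y ∧
          SplitsIn k L P}, (1 - 1 / (Ideal.absNorm P : ℝ))) ≤
        C * (Real.log y) ^ (-(1 / 2) : ℝ) := by
  obtain ⟨c, hc, hlow⟩ := exists_mul_log_le_prod_primes L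
  obtain ⟨D, hD, hup⟩ := exists_prod_primes_le_mul_prod_splitPrimes_sq hdeg
  refine ⟨√(D / c), fun y hy ↦ ?_⟩
  have hlog : 0 < Real.log y := Real.log_pos (by linarith)
  have hset : {P : Ideal (𝓞 k) | P ≠ ⊥ ∧ P.IsPrime ∧ (Ideal.absNorm P : ℝ) ≤ y ∧
      SplitsIn k L P} = splitPrimes k L y := by
    ext P
    rw [Finset.mem_coe, mem_splitPrimes, Set.mem_ofPred_eq]
    tauto
  rw [hset, finprod_mem_coe_finset, Real.rpow_neg hlog.le, ← Real.sqrt_eq_rpow, ← Real.sqrt_inv,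
    ← Real.sqrt_mul (by positivity)]
  refine Real.le_sqrt_of_sq_le ?_
  have h := (hlow y (by linarith)).trans (hup y)
  simp only [one_div]
  rw [Finset.prod_inv_distrib, inv_pow] at h
  have hpos : 0 < ∏ p ∈ splitPrimes k L y, (1 - (Ideal.absNorm p : ℝ)⁻¹) :=
    Finset.prod_pos fun p hp ↦ by
      obtain ⟨⟨h1, h2, -⟩, -⟩ := mem_splitPrimes.mp hp
      linarith [inv_absNorm_le_half h1 h2]
  rw [← div_eq_mul_inv, le_div_iff₀ (by positivity)] at h
  rw [← div_eq_mul_inv, div_div, le_div_iff₀ (by positivity), mul_comm]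
  exact h
end

section
/- Let L/k be a quadratic extension of number fields. There exists a constant C, depending on k and L, such that for all real y ≥ 3: Σ (|𝔡|/Φ(𝔡))² ≤ C·y·(log y)^{-1/2}, where the sum runs over all squarefree nonzero ideals 𝔡 of 𝓞_k with |𝔡| ≤ y such that no prime ideal divisor of 𝔡 splits in L. -/
open NumberField

/-- The multiplicative function `Φ(𝔞) = |𝔞|·∏_{𝔭 ∣ 𝔞}(1 − 1/|𝔭|)`, product over the distinct
prime ideal divisors of `𝔞`. -/
noncomputable def Phi {k : Type*} [Field k] [NumberField k] (a : Ideal (𝓞 k)) : ℝ :=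
  (Ideal.absNorm a : ℝ) *
    ∏ᶠ P ∈ {P : Ideal (𝓞 k) | P ≠ ⊥ ∧ P.IsPrime ∧ P ∣ a}, (1 - 1 / (Ideal.absNorm P : ℝ))

namespace NumberField

open Filter Topology UniqueFactorizationMonoid

section RealZeta

variable (K : Type*) [Field K] [NumberField K]

/-- The Dedekind zeta function of `K` at a real argument, as a sum over ideals. -/
noncomputable def realZeta (s : ℝ) : ℝ :=
  ∑' I : Ideal (𝓞 K), (Ideal.absNorm I : ℝ) ^ (-s)

theorem LSeriesSummable_card_absNorm {s : ℝ} (hs : 1 < s) :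
    LSeriesSummable (fun n ↦ (Nat.card {I : Ideal (𝓞 K) // Ideal.absNorm I = n} : ℂ)) s := by
  have h := LSeriesSummable_of_sum_norm_bigO_and_nonneg (s := (s : ℂ))
    (f := fun n ↦ (Nat.card {I : Ideal (𝓞 K) // Ideal.absNorm I = n} : ℝ)) (r := 1) ?_
    (fun _ ↦ Nat.cast_nonneg _) zero_le_one (by simpa using hs)
  · simpa using h
  have hlim := ((Ideal.tendsto_norm_le_div_atTop₀ K).comp tendsto_natCast_atTop_atTop).isBigO_one ℝ
  have hmul := hlim.mul (Asymptotics.isBigO_refl (fun n : ℕ ↦ (n : ℝ)) atTop)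
  refine (hmul.congr' ?_ ?_)
  · filter_upwards [eventually_gt_atTop 0] with n hn
    simp only [Function.comp_apply, Nat.cast_le]
    rw [div_mul_cancel₀ _ (by positivity), ← Nat.cast_sum]
    congr 1
    rw [← add_left_inj 1, ← Ideal.card_norm_le_eq_card_norm_le_add_one,
      show Finset.Icc 1 n = Finset.Ioc 0 n from Finset.Icc_succ_left_eq_Ioc _ _,
      show 1 = Nat.card {I : Ideal (𝓞 K) // Ideal.absNorm I = 0} by
        simp [Ideal.absNorm_eq_zero_iff],
      Finset.sum_Ioc_add_eq_sum_Icc (n.zero_le),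
      ← Finset.card_preimage_eq_sum_card_image_eq
        (fun k _ ↦ Ideal.finite_setOfPred_absNorm_eq k)]
    simp [Set.coe_eq_subtype]
  · filter_upwards with n using by simp

theorem sum_absNorm_fiber (s : ℝ) (n : ℕ) :
    ∑' I : {I : Ideal (𝓞 K) // Ideal.absNorm I = n}, (Ideal.absNorm I.1 : ℝ) ^ (-s) =
      Nat.card {I : Ideal (𝓞 K) // Ideal.absNorm I = n} * (n : ℝ) ^ (-s) := by
  have : Finite {I : Ideal (𝓞 K) // Ideal.absNorm I = n} :=
    (Ideal.finite_setOfPred_absNorm_eq (S := 𝓞 K) n).to_subtype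
  have := Fintype.ofFinite {I : Ideal (𝓞 K) // Ideal.absNorm I = n}
  rw [tsum_fintype, Finset.sum_congr rfl (fun I _ ↦ by rw [I.2]), Finset.sum_const,
    nsmul_eq_mul, Finset.card_univ, Nat.card_eq_fintype_card]

theorem term_card_absNorm {s : ℝ} (hs : 1 < s) (n : ℕ) :
    LSeries.term (fun n ↦ (Nat.card {I : Ideal (𝓞 K) // Ideal.absNorm I = n} : ℂ)) s n =
      ((∑' I : {I : Ideal (𝓞 K) // Ideal.absNorm I = n},
        (Ideal.absNorm I.1 : ℝ) ^ (-s) : ℝ) : ℂ) := by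
  rw [sum_absNorm_fiber]
  rcases eq_or_ne n 0 with rfl | hn
  · simp [Real.zero_rpow (by linarith : -s ≠ 0)]
  · rw [LSeries.term_of_ne_zero hn, Real.rpow_neg (Nat.cast_nonneg n)]
    push_cast
    rw [Complex.ofReal_cpow (Nat.cast_nonneg n)]
    simp [div_eq_mul_inv]

theorem summable_absNorm_rpow {s : ℝ} (hs : 1 < s) :
    Summable fun I : Ideal (𝓞 K) ↦ (Ideal.absNorm I : ℝ) ^ (-s) := by
  rw [← (Equiv.sigmaFiberEquiv (Ideal.absNorm : Ideal (𝓞 K) → ℕ)).summable_iff,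
    summable_sigma_of_nonneg (fun _ ↦ by simp only [Function.comp_apply]; positivity)]
  refine ⟨fun n ↦ ?_, ?_⟩
  · have : Finite {I : Ideal (𝓞 K) // Ideal.absNorm I = n} :=
      (Ideal.finite_setOfPred_absNorm_eq (S := 𝓞 K) n).to_subtype
    exact Summable.of_finite (L := .unconditional {I : Ideal (𝓞 K) // Ideal.absNorm I = n})
  · have h := LSeriesSummable_card_absNorm K hs
    rw [LSeriesSummable, funext (term_card_absNorm K hs), Complex.summable_ofReal] at h
    exact h

theorem dedekindZeta_eq_realZeta {s : ℝ} (hs : 1 < s) :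
    dedekindZeta K s = (realZeta K s : ℂ) := by
  rw [dedekindZeta, LSeries, funext (term_card_absNorm K hs), ← Complex.ofReal_tsum, realZeta,
    ← (Equiv.sigmaFiberEquiv (Ideal.absNorm : Ideal (𝓞 K) → ℕ)).tsum_eq]
  congr 1
  have h := summable_absNorm_rpow K hs
  rw [← (Equiv.sigmaFiberEquiv (Ideal.absNorm : Ideal (𝓞 K) → ℕ)).summable_iff] at h
  exact (h.tsum_sigma (f := fun x : (Σ n, {I : Ideal (𝓞 K) // Ideal.absNorm I = n}) ↦
    (Ideal.absNorm x.2.1 : ℝ) ^ (-s))).symm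

theorem tendsto_sub_one_mul_realZeta :
    Tendsto (fun s : ℝ ↦ (s - 1) * realZeta K s) (𝓝[>] 1) (𝓝 (dedekindZeta_residue K)) := by
  refine tendsto_ofReal_iff.mp ((tendsto_sub_one_mul_dedekindZeta_nhdsGT K).congr' ?_)
  filter_upwards [self_mem_nhdsWithin] with s hs
  rw [dedekindZeta_eq_realZeta K hs]
  simp

variable {K} in
theorem sum_absNorm_rpow_le_realZeta {s : ℝ} (hs : 1 < s) (S : Finset (Ideal (𝓞 K))) :
    ∑ I ∈ S, (Ideal.absNorm I : ℝ) ^ (-s) ≤ realZeta K s :=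
  (summable_absNorm_rpow K hs).sum_le_tsum S fun _ _ ↦ by positivity

theorem one_le_realZeta {s : ℝ} (hs : 1 < s) : 1 ≤ realZeta K s := by
  simpa using sum_absNorm_rpow_le_realZeta hs {(⊤ : Ideal (𝓞 K))}

variable {K} in
theorem one_le_absNorm {I : Ideal (𝓞 K)} (hI : I ≠ ⊥) : (1 : ℝ) ≤ Ideal.absNorm I := by
  exact_mod_cast Nat.one_le_iff_ne_zero.mpr (Ideal.absNorm_eq_zero_iff.not.mpr hI)

theorem realZeta_anti {s t : ℝ} (hs : 1 < s) (hst : s ≤ t) : realZeta K t ≤ realZeta K s := by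
  refine (summable_absNorm_rpow K (hs.trans_le hst)).tsum_le_tsum (fun I ↦ ?_)
    (summable_absNorm_rpow K hs)
  rcases eq_or_ne I ⊥ with rfl | hI
  · rw [Ideal.absNorm_bot, Nat.cast_zero, Real.zero_rpow (by linarith),
      Real.zero_rpow (by linarith)]
  · exact Real.rpow_le_rpow_of_exponent_le (one_le_absNorm hI) (by linarith)

/-- Near its pole at `1`, the zeta function has the order of magnitude of `1 / (s - 1)`. -/
theorem exists_bounds_realZeta : ∃ c C : ℝ, 0 < c ∧ 0 < C ∧ ∀ s : ℝ, 1 < s → s ≤ 2 →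
    c ≤ (s - 1) * realZeta K s ∧ (s - 1) * realZeta K s ≤ C := by
  have hr := dedekindZeta_residue_pos K
  have h := (tendsto_sub_one_mul_realZeta K).eventually
    (Ioo_mem_nhds (half_lt_self hr) (lt_two_mul_self hr))
  obtain ⟨u, hu, h⟩ := (mem_nhdsGT_iff_exists_Ioo_subset).mp h
  obtain ⟨v, hv1, hvu⟩ := exists_between (show (1 : ℝ) < u from hu)
  refine ⟨min (dedekindZeta_residue K / 2) (v - 1),
    max (2 * dedekindZeta_residue K) (realZeta K v), lt_min (by linarith) (by linarith),
    lt_max_of_lt_left (by linarith), fun s hs hs2 ↦ ?_⟩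
  rcases lt_or_ge s v with hsv | hsv
  · have := h ⟨hs, hsv.trans hvu⟩
    exact ⟨(min_le_left _ _).trans this.1.le, this.2.le.trans (le_max_left _ _)⟩
  · have h1 := one_le_realZeta K hs
    have h2 := realZeta_anti K hv1 hsv
    exact ⟨(min_le_right _ _).trans (by nlinarith), le_trans (by nlinarith) (le_max_right _ _)⟩

end RealZeta

section Squarefree

variable {K : Type*} [Field K] [NumberField K]

theorem prime_of_mem_primeFactors {D P : Ideal (𝓞 K)} (h : P ∈ primeFactors D) : Prime P :=
  prime_of_normalized_factor P (mem_primeFactors.mp h)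

theorem prod_primeFactors_of_squarefree {D : Ideal (𝓞 K)} (hD : Squarefree D) :
    ∏ P ∈ primeFactors D, P = D :=
  associated_iff_eq.mp (radical_associated hD.isRadical hD.ne_zero)

theorem primeFactors_prod_of_prime {U : Finset (Ideal (𝓞 K))} (hU : ∀ P ∈ U, Prime P) :
    primeFactors (∏ P ∈ U, P) = U := by
  have h := normalizedFactors_prod_of_prime (m := U.val) (by simpa using hU)
  have e : ∏ P ∈ U, P = U.val.prod := (Finset.prod_val U).symm
  ext P
  rw [mem_primeFactors, ← Finset.mem_val, e, h]

theorem absNorm_rpow_eq_prod {D : Ideal (𝓞 K)} (hD : Squarefree D) (t : ℝ) :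
    (Ideal.absNorm D : ℝ) ^ t = ∏ P ∈ primeFactors D, (Ideal.absNorm P : ℝ) ^ t := by
  rw [Real.finsetProd_rpow _ _ fun _ _ ↦ Nat.cast_nonneg _, ← Nat.cast_prod, ← map_prod,
    prod_primeFactors_of_squarefree hD]

/-- A finite sum of a multiplicative function over squarefree ideals is at most its Euler
product. -/
theorem sum_prod_primeFactors_le_prod {S T : Finset (Ideal (𝓞 K))} {w : Ideal (𝓞 K) → ℝ}
    (hw : ∀ P, 0 ≤ w P) (hS : ∀ D ∈ S, Squarefree D) (hT : ∀ D ∈ S, primeFactors D ⊆ T) :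
    ∑ D ∈ S, ∏ P ∈ primeFactors D, w P ≤ ∏ P ∈ T, (1 + w P) := by
  classical
  have hinj : Set.InjOn (primeFactors : Ideal (𝓞 K) → _) S := fun D hD E hE h ↦ by
    rw [← prod_primeFactors_of_squarefree (hS D hD), h, prod_primeFactors_of_squarefree (hS E hE)]
  rw [Finset.prod_one_add, ← Finset.sum_image (f := fun U ↦ ∏ P ∈ U, w P) hinj]
  refine Finset.sum_le_sum_of_subset_of_nonneg ?_ fun _ _ _ ↦ Finset.prod_nonneg fun _ _ ↦ hw _
  intro U hU
  obtain ⟨D, hD, rfl⟩ := Finset.mem_image.mp hU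
  exact Finset.mem_powerset.mpr (hT D hD)

theorem exists_squarefree_mul_sq (I : Ideal (𝓞 K)) : ∃ B C, Squarefree B ∧ I = B * C ^ 2 := by
  induction I using UniqueFactorizationMonoid.induction_on_prime with
  | h₁ => exact ⟨1, 0, squarefree_one, by simp⟩
  | h₂ x hx => exact ⟨1, 1, squarefree_one, by
      rw [isUnit_iff_eq_one.mp hx, one_pow, mul_one]⟩
  | h₃ a P ha hP ih =>
    obtain ⟨B, C, hB, rfl⟩ := ih
    by_cases h : P ∣ B
    · obtain ⟨B', rfl⟩ := h
      exact ⟨B', P * C, hB.of_mul_right, by ring⟩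
    · refine ⟨P * B, C, squarefree_mul_iff.mpr ⟨?_, hP.irreducible.squarefree, hB⟩, by ring⟩
      exact (hP.irreducible.isRelPrime_iff_not_dvd).mpr h

theorem two_le_absNorm_of_prime {P : Ideal (𝓞 K)} (hP : Prime P) : (2 : ℝ) ≤ Ideal.absNorm P := by
  have h0 : Ideal.absNorm P ≠ 0 := Ideal.absNorm_eq_zero_iff.not.mpr hP.ne_zero
  have h1 : Ideal.absNorm P ≠ 1 := fun h ↦ hP.not_isUnit <| by
    rw [Ideal.absNorm_eq_one_iff.mp h, ← Ideal.one_eq_top]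
    exact isUnit_one
  have h2 : 2 ≤ Ideal.absNorm P := by omega
  exact_mod_cast h2

theorem exp_sub_sq_le_one_add {x : ℝ} (hx : 0 ≤ x) : Real.exp (x - x ^ 2) ≤ 1 + x := by
  have h := Real.add_one_le_exp (-(x - x ^ 2))
  have h2 : Real.exp (x - x ^ 2) * Real.exp (-(x - x ^ 2)) = 1 := by
    rw [← Real.exp_add, add_neg_cancel, Real.exp_zero]
  have h3 := Real.exp_pos (x - x ^ 2)
  have h4 : 0 < -(x - x ^ 2) + 1 := by nlinarith [sq_nonneg (x - 1)]
  have h5 : Real.exp (x - x ^ 2) * (-(x - x ^ 2) + 1) ≤ 1 := by nlinarith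
  have h6 : 1 ≤ (1 + x) * (-(x - x ^ 2) + 1) := by nlinarith [pow_nonneg hx 3]
  exact le_of_mul_le_mul_right (h5.trans h6) h4

theorem absNorm_rpow_neg_sq_le {s : ℝ} (hs : 1 < s) (I : Ideal (𝓞 K)) :
    ((Ideal.absNorm I : ℝ) ^ (-s)) ^ 2 ≤ (Ideal.absNorm I : ℝ) ^ (-2 : ℝ) := by
  rcases eq_or_ne I ⊥ with rfl | hI
  · rw [Ideal.absNorm_bot, Nat.cast_zero, Real.zero_rpow (by linarith)]
    simp
  · rw [← Real.rpow_natCast, ← Real.rpow_mul (Nat.cast_nonneg _)]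
    exact Real.rpow_le_rpow_of_exponent_le (one_le_absNorm hI) (by push_cast; linarith)

theorem exp_sum_prime_le_realZeta {s : ℝ} (hs : 1 < s) {T : Finset (Ideal (𝓞 K))}
    (hT : ∀ P ∈ T, Prime P) :
    Real.exp (∑ P ∈ T, (Ideal.absNorm P : ℝ) ^ (-s)) ≤
      Real.exp (realZeta K 2) * realZeta K s := by
  classical
  have h1 : ∑ P ∈ T, ((Ideal.absNorm P : ℝ) ^ (-s)) ^ 2 ≤ realZeta K 2 :=
    (Finset.sum_le_sum fun P _ ↦ absNorm_rpow_neg_sq_le hs P).trans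
      (sum_absNorm_rpow_le_realZeta one_lt_two T)
  have h2 : ∏ P ∈ T, (1 + (Ideal.absNorm P : ℝ) ^ (-s)) ≤ realZeta K s := by
    have hinj : Set.InjOn (fun U : Finset (Ideal (𝓞 K)) ↦ ∏ P ∈ U, P) T.powerset := by
      intro U hU V hV h
      rw [Finset.mem_coe, Finset.mem_powerset] at hU hV
      rw [← primeFactors_prod_of_prime fun P hP ↦ hT P (hU hP),
        ← primeFactors_prod_of_prime fun P hP ↦ hT P (hV hP)]
      exact congrArg _ h
    rw [Finset.prod_one_add]
    refine le_of_eq_of_le ?_ (sum_absNorm_rpow_le_realZeta hs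
      (T.powerset.image fun U ↦ ∏ P ∈ U, P))
    rw [Finset.sum_image hinj]
    refine Finset.sum_congr rfl fun U _ ↦ ?_
    rw [map_prod, Nat.cast_prod, Real.finsetProd_rpow _ _ fun _ _ ↦ Nat.cast_nonneg _]
  calc Real.exp (∑ P ∈ T, (Ideal.absNorm P : ℝ) ^ (-s))
      ≤ Real.exp (realZeta K 2 + ∑ P ∈ T, ((Ideal.absNorm P : ℝ) ^ (-s) -
          ((Ideal.absNorm P : ℝ) ^ (-s)) ^ 2)) := by
        rw [Real.exp_le_exp, Finset.sum_sub_distrib]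
        linarith
    _ ≤ Real.exp (realZeta K 2) * realZeta K s := by
        rw [Real.exp_add, Real.exp_sum]
        gcongr
        refine le_trans (Finset.prod_le_prod (fun _ _ ↦ (Real.exp_pos _).le) fun P _ ↦ ?_) h2
        exact exp_sub_sq_le_one_add (by positivity)

theorem exists_sum_absNorm_rpow_le_exp {s : ℝ} (hs : 1 < s) (S : Finset (Ideal (𝓞 K))) :
    ∃ T : Finset (Ideal (𝓞 K)), (∀ P ∈ T, Prime P) ∧
      ∑ I ∈ S, (Ideal.absNorm I : ℝ) ^ (-s) ≤
        realZeta K 2 * Real.exp (∑ P ∈ T, (Ideal.absNorm P : ℝ) ^ (-s)) := by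
  classical
  choose B C hB hBC using exists_squarefree_mul_sq (K := K)
  have hinj : Function.Injective fun I ↦ (B I, C I) := fun I J h ↦ by
    rw [hBC I, hBC J, (Prod.mk.inj h).1, (Prod.mk.inj h).2]
  refine ⟨(S.image B).biUnion primeFactors, fun P hP ↦ ?_, ?_⟩
  · obtain ⟨D, -, hD⟩ := Finset.mem_biUnion.mp hP
    exact prime_of_mem_primeFactors hD
  have hsq : ∀ D ∈ S.image B, Squarefree D := fun D hD ↦ by
    obtain ⟨I, -, rfl⟩ := Finset.mem_image.mp hD
    exact hB I
  calc ∑ I ∈ S, (Ideal.absNorm I : ℝ) ^ (-s)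
      ≤ ∑ I ∈ S, (Ideal.absNorm (B I) : ℝ) ^ (-s) * (Ideal.absNorm (C I) : ℝ) ^ (-2 : ℝ) := by
        refine Finset.sum_le_sum fun I _ ↦ ?_
        conv_lhs => rw [hBC I]
        rw [map_mul, map_pow, Nat.cast_mul, Nat.cast_pow,
          Real.mul_rpow (by positivity) (by positivity), ← Real.rpow_natCast,
          ← Real.rpow_mul (by positivity), mul_comm ((2 : ℕ) : ℝ),
          Real.rpow_mul (by positivity), Real.rpow_natCast]
        gcongr
        exact absNorm_rpow_neg_sq_le hs _
    _ = ∑ x ∈ S.image fun I ↦ (B I, C I),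
          (Ideal.absNorm x.1 : ℝ) ^ (-s) * (Ideal.absNorm x.2 : ℝ) ^ (-2 : ℝ) := by
        rw [Finset.sum_image hinj.injOn]
    _ ≤ ∑ x ∈ S.image B ×ˢ S.image C,
          (Ideal.absNorm x.1 : ℝ) ^ (-s) * (Ideal.absNorm x.2 : ℝ) ^ (-2 : ℝ) := by
        refine Finset.sum_le_sum_of_subset_of_nonneg (fun x hx ↦ ?_) fun _ _ _ ↦ by positivity
        obtain ⟨I, hI, rfl⟩ := Finset.mem_image.mp hx
        exact Finset.mk_mem_product (Finset.mem_image_of_mem B hI) (Finset.mem_image_of_mem C hI)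
    _ = (∑ J ∈ S.image C, (Ideal.absNorm J : ℝ) ^ (-2 : ℝ)) *
          ∑ D ∈ S.image B, ∏ P ∈ primeFactors D, (Ideal.absNorm P : ℝ) ^ (-s) := by
        rw [Finset.sum_product, mul_comm,
          ← Finset.sum_congr rfl fun D hD ↦ absNorm_rpow_eq_prod (hsq D hD) (-s),
          Finset.sum_mul_sum]
    _ ≤ _ := by
        have := one_le_realZeta K one_lt_two
        refine mul_le_mul (sum_absNorm_rpow_le_realZeta one_lt_two _) ?_ ?_ (by linarith)
        · refine (sum_prod_primeFactors_le_prod (fun P ↦ by positivity) hsq fun D hD ↦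
            Finset.subset_biUnion_of_mem primeFactors hD).trans ?_
          exact Real.prod_one_add_le_exp_sum _ fun _ ↦ by positivity
        · exact Finset.sum_nonneg fun _ _ ↦ Finset.prod_nonneg fun _ _ ↦ by positivity

end Squarefree

section Quadratic

variable {k L : Type*} [Field k] [NumberField k] [Field L] [NumberField L] [Algebra k L]

theorem finrank_ringOfIntegers_eq : Module.finrank (𝓞 k) (𝓞 L) = Module.finrank k L :=
  (IsFractionRing.finrank_eq (𝓞 k) k (𝓞 L) L).symm

theorem under_prime {Q : Ideal (𝓞 L)} (hQ : Prime Q) : Prime (Q.under (𝓞 k)) := by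
  have := Ideal.isPrime_of_prime hQ
  exact Ideal.prime_of_isPrime (mt Ideal.eq_bot_of_comap_eq_bot hQ.ne_zero) inferInstance

theorem sum_ramificationIdx_mul_inertiaDeg_le (hdeg : Module.finrank k L = 2) (P : Ideal (𝓞 k))
    [P.IsPrime] {F : Finset (Ideal (𝓞 L))} (hF : ∀ Q ∈ F, Q ∈ P.primesOver (𝓞 L)) :
    ∑ Q ∈ F, Q.ramificationIdx (𝓞 k) * Q.inertiaDeg (𝓞 k) ≤ 2 := by
  have := (Algebra.QuasiFinite.finite_primesOver (S := 𝓞 L) P).fintype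
  rw [← hdeg, ← finrank_ringOfIntegers_eq, ← Ideal.sum_ramification_inertia_eq_finrank P (𝓞 L),
    ← Finset.sum_coe_sort, ← Finset.sum_image
      (s := Finset.univ) (g := fun Q : F ↦ (⟨Q.1, hF _ Q.2⟩ : P.primesOver (𝓞 L)))
      (f := fun Q ↦ Q.1.ramificationIdx (𝓞 k) * Q.1.inertiaDeg (𝓞 k))
      (fun a _ b _ h ↦ Subtype.ext (congrArg (fun x ↦ x.1) h))]
  exact Finset.sum_le_sum_of_subset (Finset.subset_univ _)

theorem card_le_two_of_mem_primesOver (hdeg : Module.finrank k L = 2) (P : Ideal (𝓞 k))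
    [P.IsPrime] {F : Finset (Ideal (𝓞 L))} (hF : ∀ Q ∈ F, Q ∈ P.primesOver (𝓞 L)) :
    F.card ≤ 2 := by
  refine le_trans ?_ (sum_ramificationIdx_mul_inertiaDeg_le hdeg P hF)
  rw [Finset.card_eq_sum_ones]
  refine Finset.sum_le_sum fun Q hQ ↦ ?_
  have := (hF Q hQ).1
  exact Nat.mul_pos (Q.ramificationIdx_pos (𝓞 k)) (Q.inertiaDeg_pos (𝓞 k))

theorem ramificationIdx_mul_inertiaDeg_eq_two (hdeg : Module.finrank k L = 2)
    {Q : Ideal (𝓞 L)} (hQ : Prime Q) (hs : ¬ SplitsIn k L (Q.under (𝓞 k))) :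
    Q.ramificationIdx (𝓞 k) * Q.inertiaDeg (𝓞 k) = 2 := by
  have := Ideal.isPrime_of_prime hQ
  have := (Algebra.QuasiFinite.finite_primesOver (S := 𝓞 L) (Q.under (𝓞 k))).fintype
  have h := Ideal.sum_ramification_inertia_eq_finrank (Q.under (𝓞 k)) (𝓞 L)
  rw [finrank_ringOfIntegers_eq, hdeg] at h
  rw [← h]
  refine (Fintype.sum_eq_single
    (f := fun q : (Q.under (𝓞 k)).primesOver (𝓞 L) ↦
      q.1.ramificationIdx (𝓞 k) * q.1.inertiaDeg (𝓞 k))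
    (⟨Q, ‹_›, Q.over_under⟩ : (Q.under (𝓞 k)).primesOver (𝓞 L))
    fun R hR ↦ absurd ?_ hs).symm
  have hR0 : R.1 ≠ ⊥ := Ideal.ne_bot_of_mem_primesOver (under_prime hQ).ne_zero R.2
  exact ⟨R, Q, fun h ↦ hR (Subtype.ext h), R.2.1, inferInstance, hR0, hQ.ne_zero,
    R.2.2.over.symm, rfl⟩

theorem dvd_differentIdeal_or_absNorm_eq_sq (hdeg : Module.finrank k L = 2)
    {Q : Ideal (𝓞 L)} (hQ : Prime Q) (hs : ¬ SplitsIn k L (Q.under (𝓞 k))) :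
    Q ∣ differentIdeal (𝓞 k) (𝓞 L) ∨ Ideal.absNorm Q = Ideal.absNorm (Q.under (𝓞 k)) ^ 2 := by
  have := Ideal.isPrime_of_prime hQ
  have h := ramificationIdx_mul_inertiaDeg_eq_two hdeg hQ hs
  by_cases hd : Q ∣ differentIdeal (𝓞 k) (𝓞 L)
  · exact .inl hd
  have := not_dvd_differentIdeal_iff.mp hd
  rw [Ideal.ramificationIdx_eq_one Q (𝓞 k), one_mul] at h
  rw [← Ideal.absNorm_pow_inertiaDeg (Q.under (𝓞 k)) Q, h]
  exact .inr rfl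

theorem absNorm_under_le {Q : Ideal (𝓞 L)} (hQ : Prime Q) :
    Ideal.absNorm (Q.under (𝓞 k)) ≤ Ideal.absNorm Q := by
  have := Ideal.isPrime_of_prime hQ
  rw [← Ideal.absNorm_pow_inertiaDeg (Q.under (𝓞 k)) Q]
  exact Nat.le_self_pow (Q.inertiaDeg_pos (𝓞 k)).ne' _

/-- Up to a bounded error, the sum over primes of `L` is at most twice the sum over the primes of
`k` that split. -/
theorem exists_sum_prime_le (hdeg : Module.finrank k L = 2) :
    ∃ C : ℝ, ∀ s : ℝ, 1 < s → ∀ T : Finset (Ideal (𝓞 L)), (∀ Q ∈ T, Prime Q) →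
      ∃ U : Finset (Ideal (𝓞 k)), (∀ P ∈ U, Prime P ∧ SplitsIn k L P) ∧
        ∑ Q ∈ T, (Ideal.absNorm Q : ℝ) ^ (-s) ≤
          2 * ∑ P ∈ U, (Ideal.absNorm P : ℝ) ^ (-s) + C := by
  classical
  let V := primeFactors (differentIdeal (𝓞 k) (𝓞 L))
  refine ⟨V.card + realZeta k 2, fun s hs T hT ↦ ?_⟩
  let A := T.filter fun Q ↦ SplitsIn k L (Q.under (𝓞 k))
  let B := T.filter fun Q ↦ ¬ SplitsIn k L (Q.under (𝓞 k))
  refine ⟨A.image (Ideal.under (𝓞 k)), fun P hP ↦ ?_, ?_⟩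
  · obtain ⟨Q, hQ, rfl⟩ := Finset.mem_image.mp hP
    rw [Finset.mem_filter] at hQ
    exact ⟨under_prime (hT Q hQ.1), hQ.2⟩
  have hA : ∑ Q ∈ A, (Ideal.absNorm Q : ℝ) ^ (-s) ≤
      2 * ∑ P ∈ A.image (Ideal.under (𝓞 k)), (Ideal.absNorm P : ℝ) ^ (-s) := by
    rw [← Finset.sum_fiberwise_of_maps_to (t := A.image (Ideal.under (𝓞 k)))
      fun Q hQ ↦ Finset.mem_image_of_mem _ hQ, Finset.mul_sum]
    refine Finset.sum_le_sum fun P hP ↦ ?_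
    obtain ⟨R, hR, rfl⟩ := Finset.mem_image.mp hP
    have hRp := hT R (Finset.mem_filter.mp hR).1
    have := Ideal.isPrime_of_prime hRp
    have hpos := (zero_lt_two.trans_le (two_le_absNorm_of_prime (under_prime (k := k) hRp)))
    have hcard := card_le_two_of_mem_primesOver hdeg (R.under (𝓞 k))
      (F := A.filter fun Q ↦ Q.under (𝓞 k) = R.under (𝓞 k)) fun Q hQ ↦ by
        rw [Finset.mem_filter] at hQ
        exact ⟨Ideal.isPrime_of_prime (hT Q (Finset.mem_filter.mp hQ.1).1), ⟨hQ.2.symm⟩⟩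
    refine (Finset.sum_le_card_nsmul _ _ ((Ideal.absNorm (R.under (𝓞 k)) : ℝ) ^ (-s))
      fun Q hQ ↦ ?_).trans ?_
    · rw [Finset.mem_filter] at hQ
      refine Real.rpow_le_rpow_of_nonpos hpos ?_ (by linarith)
      rw [← hQ.2]
      exact_mod_cast absNorm_under_le (hT Q (Finset.mem_filter.mp hQ.1).1)
    · rw [nsmul_eq_mul]
      gcongr
      exact_mod_cast hcard
  have hB : ∑ Q ∈ B, (Ideal.absNorm Q : ℝ) ^ (-s) ≤ V.card + realZeta k 2 := by
    rw [← Finset.sum_filter_add_sum_filter_not B fun Q ↦ Q ∣ differentIdeal (𝓞 k) (𝓞 L)]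
    have hBp : ∀ Q ∈ B, Prime Q := fun Q hQ ↦ hT Q (Finset.mem_filter.mp hQ).1
    refine add_le_add ?_ ?_
    · refine (Finset.sum_le_card_nsmul _ _ 1 fun Q hQ ↦ ?_).trans ?_
      · refine Real.rpow_le_one_of_one_le_of_nonpos (one_le_absNorm ?_) (by linarith)
        exact (hBp Q (Finset.mem_filter.mp hQ).1).ne_zero
      · rw [nsmul_one, Nat.cast_le]
        refine Finset.card_le_card fun Q hQ ↦ ?_
        rw [Finset.mem_filter] at hQ
        rw [mem_primeFactors, mem_normalizedFactors_iff differentIdeal_ne_bot]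
        exact ⟨hBp Q hQ.1, hQ.2⟩
    · set D := B.filter fun Q ↦ ¬ Q ∣ differentIdeal (𝓞 k) (𝓞 L) with hD
      have hsq : ∀ Q ∈ D, Prime Q ∧
          ¬ SplitsIn k L (Q.under (𝓞 k)) ∧
          Ideal.absNorm Q = Ideal.absNorm (Q.under (𝓞 k)) ^ 2 := fun Q hQ ↦ by
        simp only [hD, B, Finset.mem_filter] at hQ
        exact ⟨hT Q hQ.1.1, hQ.1.2, (dvd_differentIdeal_or_absNorm_eq_sq hdeg (hT Q hQ.1.1)
          hQ.1.2).resolve_left hQ.2⟩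
      have hinj : Set.InjOn (Ideal.under (𝓞 k)) (D : Set (Ideal (𝓞 L))) := fun Q hQ R hR h ↦ by
        have hQ := hsq Q hQ
        have hR := hsq R hR
        by_contra hne
        exact hQ.2.1 ⟨Q, R, hne, Ideal.isPrime_of_prime hQ.1, Ideal.isPrime_of_prime hR.1,
          hQ.1.ne_zero, hR.1.ne_zero, rfl, h.symm⟩
      refine le_trans ?_ (sum_absNorm_rpow_le_realZeta one_lt_two (D.image (Ideal.under (𝓞 k))))
      rw [Finset.sum_image hinj]
      refine Finset.sum_le_sum fun Q hQ ↦ ?_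
      rw [(hsq Q hQ).2.2, Nat.cast_pow, ← Real.rpow_natCast,
        ← Real.rpow_mul (Nat.cast_nonneg _)]
      exact Real.rpow_le_rpow_of_exponent_le
        (one_le_absNorm (under_prime (hsq Q hQ).1).ne_zero) (by push_cast; linarith)
  rw [← Finset.sum_filter_add_sum_filter_not T fun Q ↦ SplitsIn k L (Q.under (𝓞 k))]
  exact add_le_add hA hB

end Quadratic

section NonsplitPrimes

variable {k L : Type*} [Field k] [NumberField k] [Field L] [NumberField L] [Algebra k L]

theorem exists_exp_sum_sq_mul_realZeta_le (hdeg : Module.finrank k L = 2) :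
    ∃ A : ℝ, 0 < A ∧ ∀ s : ℝ, 1 < s → ∀ T : Finset (Ideal (𝓞 k)),
      (∀ P ∈ T, Prime P ∧ ¬ SplitsIn k L P) →
        Real.exp (∑ P ∈ T, (Ideal.absNorm P : ℝ) ^ (-s)) ^ 2 * realZeta L s ≤
          A * realZeta k s ^ 2 := by
  classical
  obtain ⟨C, hC⟩ := exists_sum_prime_le hdeg
  have hL2 := one_le_realZeta L one_lt_two
  refine ⟨realZeta L 2 * Real.exp C * Real.exp (realZeta k 2) ^ 2, by positivity,
    fun s hs T hT ↦ ?_⟩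
  set X := Real.exp (∑ P ∈ T, (Ideal.absNorm P : ℝ) ^ (-s)) with hX
  have hX0 : 0 < X := Real.exp_pos _
  rw [mul_comm, ← le_div_iff₀ (by positivity)]
  refine Real.tsum_le_of_sum_le (fun _ ↦ by positivity) fun S ↦ ?_
  rw [le_div_iff₀ (by positivity)]
  obtain ⟨T', hT', hS⟩ := exists_sum_absNorm_rpow_le_exp hs S
  obtain ⟨U, hU, hT'U⟩ := hC s hs T' hT'
  have hdisj : Disjoint T U :=
    Finset.disjoint_left.mpr fun P hPT hPU ↦ (hT P hPT).2 (hU P hPU).2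
  have hk := exp_sum_prime_le_realZeta hs (T := T ∪ U) fun P hP ↦
    (Finset.mem_union.mp hP).elim (fun h ↦ (hT P h).1) fun h ↦ (hU P h).1
  rw [Finset.sum_union hdisj, Real.exp_add, ← hX] at hk
  set Y := Real.exp (∑ P ∈ U, (Ideal.absNorm P : ℝ) ^ (-s)) with hY
  calc (∑ I ∈ S, (Ideal.absNorm I : ℝ) ^ (-s)) * X ^ 2
      ≤ (realZeta L 2 * Real.exp (2 * ∑ P ∈ U, (Ideal.absNorm P : ℝ) ^ (-s) + C)) * X ^ 2 := by
        gcongr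
        exact hS.trans (by gcongr)
    _ = realZeta L 2 * Real.exp C * (X * Y) ^ 2 := by
        rw [Real.exp_add, two_mul, Real.exp_add, ← hY]
        ring
    _ ≤ realZeta L 2 * Real.exp C * (Real.exp (realZeta k 2) * realZeta k s) ^ 2 := by
        gcongr
    _ = _ := by ring

/-- The primes that do not split carry at most half of the primes of `k`, in the sense of
logarithmic density. -/
theorem exists_exp_sum_nonsplit_le (hdeg : Module.finrank k L = 2) :
    ∃ C : ℝ, 0 < C ∧ ∀ s : ℝ, 1 < s → s ≤ 2 → ∀ T : Finset (Ideal (𝓞 k)),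
      (∀ P ∈ T, Prime P ∧ ¬ SplitsIn k L P) →
        Real.exp (∑ P ∈ T, (Ideal.absNorm P : ℝ) ^ (-s)) ≤ C * (s - 1) ^ (-(1 / 2) : ℝ) := by
  obtain ⟨A, hA, h⟩ := exists_exp_sum_sq_mul_realZeta_le hdeg
  obtain ⟨c, _, hc, _, hcL⟩ := exists_bounds_realZeta L
  obtain ⟨_, D, _, hD, hDk⟩ := exists_bounds_realZeta k
  refine ⟨√(A * D ^ 2 / c), by positivity, fun s hs hs2 T hT ↦ ?_⟩
  have hs0 : 0 < s - 1 := sub_pos.mpr hs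
  have hmain := h s hs T hT
  set X := Real.exp (∑ P ∈ T, (Ideal.absNorm P : ℝ) ^ (-s))
  have hX0 : 0 < X := Real.exp_pos _
  have hk := one_le_realZeta k hs
  have hrpow : ((s - 1) ^ (-(1 / 2) : ℝ)) ^ 2 = (s - 1)⁻¹ := by
    rw [← Real.rpow_natCast, ← Real.rpow_mul hs0.le, ← Real.rpow_neg_one]
    norm_num
  rw [← sq_le_sq₀ hX0.le (by positivity), mul_pow, Real.sq_sqrt (by positivity), hrpow,
    ← div_eq_mul_inv, le_div_iff₀ hs0, le_div_iff₀ hc]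
  calc X ^ 2 * (s - 1) * c ≤ X ^ 2 * (s - 1) * ((s - 1) * realZeta L s) := by
        gcongr
        exact (hcL s hs hs2).1
    _ = (s - 1) ^ 2 * (X ^ 2 * realZeta L s) := by ring
    _ ≤ (s - 1) ^ 2 * (A * realZeta k s ^ 2) := by gcongr
    _ = A * ((s - 1) * realZeta k s) ^ 2 := by ring
    _ ≤ A * D ^ 2 := by
        gcongr
        exact (hDk s hs hs2).2

end NonsplitPrimes

section Weights

variable {k : Type*} [Field k] [NumberField k]

/-- The value of the multiplicative function `(|𝔡| / Φ(𝔡)) ^ 2` at a prime. -/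
noncomputable def weight (P : Ideal (𝓞 k)) : ℝ :=
  ((1 - 1 / (Ideal.absNorm P : ℝ))⁻¹) ^ 2

theorem weight_nonneg (P : Ideal (𝓞 k)) : 0 ≤ weight P := sq_nonneg _

theorem div_Phi_sq_eq_prod_weight {D : Ideal (𝓞 k)} (hD : D ≠ ⊥) :
    ((Ideal.absNorm D : ℝ) / Phi D) ^ 2 = ∏ P ∈ primeFactors D, weight P := by
  have hset : {P : Ideal (𝓞 k) | P ≠ ⊥ ∧ P.IsPrime ∧ P ∣ D} = primeFactors D := by
    ext P
    rw [Finset.mem_coe, mem_primeFactors, mem_normalizedFactors_iff hD]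
    exact ⟨fun h ↦ ⟨Ideal.prime_of_isPrime h.1 h.2.1, h.2.2⟩,
      fun h ↦ ⟨h.1.ne_zero, Ideal.isPrime_of_prime h.1, h.2⟩⟩
  have hN : (Ideal.absNorm D : ℝ) ≠ 0 := (zero_lt_one.trans_le (one_le_absNorm hD)).ne'
  rw [Phi, hset, finprod_mem_coe_finset]
  simp only [weight]
  rw [Finset.prod_pow, Finset.prod_inv_distrib, div_mul_cancel_left₀ hN]

theorem weight_le_one_add {P : Ideal (𝓞 k)} (hP : Prime P) :
    weight P ≤ 1 + 6 * (Ideal.absNorm P : ℝ)⁻¹ := by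
  have h := two_le_absNorm_of_prime hP
  rw [weight, one_div]
  set x := (Ideal.absNorm P : ℝ)⁻¹ with hx
  have hx0 : 0 < x := by positivity
  have hx1 : x ≤ 1 / 2 := by
    rw [hx, one_div]
    exact inv_anti₀ two_pos h
  rw [inv_pow, inv_le_iff_one_le_mul₀ (by nlinarith)]
  nlinarith [mul_nonneg (mul_nonneg hx0.le (by linarith : 0 ≤ 1 - 2 * x))
    (by linarith : 0 ≤ 4 - 3 * x)]

theorem weight_le_four {P : Ideal (𝓞 k)} (hP : Prime P) : weight P ≤ 4 := by
  have h := weight_le_one_add hP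
  have : (Ideal.absNorm P : ℝ)⁻¹ ≤ 2⁻¹ := inv_anti₀ two_pos (two_le_absNorm_of_prime hP)
  linarith

theorem one_le_log {y : ℝ} (hy : 3 ≤ y) : 1 ≤ Real.log y := by
  rw [Real.le_log_iff_exp_le (by linarith)]
  linarith [Real.exp_one_lt_d9]

theorem exists_sum_prod_weight_mul_inv_le {L : Type*} [Field L] [NumberField L] [Algebra k L]
    (hdeg : Module.finrank k L = 2) :
    ∃ C : ℝ, 0 < C ∧ ∀ y : ℝ, 3 ≤ y → ∀ S : Finset (Ideal (𝓞 k)),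
      (∀ D ∈ S, Squarefree D ∧ (Ideal.absNorm D : ℝ) ≤ y ∧
        ∀ P ∈ primeFactors D, ¬ SplitsIn k L P) →
      ∑ D ∈ S, (∏ P ∈ primeFactors D, weight P) * (Ideal.absNorm D : ℝ)⁻¹ ≤
        C * Real.log y ^ (1 / 2 : ℝ) := by
  classical
  obtain ⟨C, hC, h⟩ := exists_exp_sum_nonsplit_le hdeg
  refine ⟨Real.exp 1 * (Real.exp (6 * realZeta k 2) * C), by positivity, fun y hy S hS ↦ ?_⟩
  have hlog := one_le_log hy
  have hlog0 : 0 < Real.log y := by linarith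
  set s := 1 + (Real.log y)⁻¹ with hs_def
  have hs : 1 < s := by simpa [hs_def] using hlog0
  have hs2 : s ≤ 2 := by linarith [inv_le_one_of_one_le₀ hlog]
  set T := S.biUnion primeFactors with hT_def
  have hT : ∀ P ∈ T, Prime P ∧ ¬ SplitsIn k L P := fun P hP ↦ by
    obtain ⟨D, hD, hP⟩ := Finset.mem_biUnion.mp hP
    exact ⟨prime_of_mem_primeFactors hP, (hS D hD).2.2 P hP⟩
  have hinv : ∀ D ∈ S, (Ideal.absNorm D : ℝ)⁻¹ ≤ Real.exp 1 * (Ideal.absNorm D : ℝ) ^ (-s) := by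
    intro D hD
    have hN := zero_lt_one.trans_le (one_le_absNorm (hS D hD).1.ne_zero)
    have h1 : (Ideal.absNorm D : ℝ) ^ (Real.log y)⁻¹ ≤ Real.exp 1 := by
      refine (Real.rpow_le_rpow hN.le (hS D hD).2.1 (by positivity)).trans_eq ?_
      rw [Real.rpow_def_of_pos (by linarith), mul_inv_cancel₀ hlog0.ne']
    calc (Ideal.absNorm D : ℝ)⁻¹
        = (Ideal.absNorm D : ℝ) ^ (Real.log y)⁻¹ * (Ideal.absNorm D : ℝ) ^ (-s) := by
          rw [← Real.rpow_add hN, hs_def, ← Real.rpow_neg_one]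
          ring_nf
      _ ≤ _ := by gcongr
  have hfactor : ∀ P ∈ T, weight P * (Ideal.absNorm P : ℝ) ^ (-s) ≤
      (Ideal.absNorm P : ℝ) ^ (-s) + 6 * (Ideal.absNorm P : ℝ) ^ (-2 : ℝ) := by
    intro P hP
    have hN := one_le_absNorm (hT P hP).1.ne_zero
    have h1 : (Ideal.absNorm P : ℝ)⁻¹ * (Ideal.absNorm P : ℝ) ^ (-s) ≤
        (Ideal.absNorm P : ℝ) ^ (-2 : ℝ) := by
      rw [← Real.rpow_neg_one, ← Real.rpow_add (by linarith)]
      exact Real.rpow_le_rpow_of_exponent_le hN (by linarith)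
    have h2 := mul_le_mul_of_nonneg_right (weight_le_one_add (hT P hP).1)
      (show 0 ≤ (Ideal.absNorm P : ℝ) ^ (-s) by positivity)
    linarith
  calc ∑ D ∈ S, (∏ P ∈ primeFactors D, weight P) * (Ideal.absNorm D : ℝ)⁻¹
      ≤ ∑ D ∈ S, Real.exp 1 *
          ∏ P ∈ primeFactors D, weight P * (Ideal.absNorm P : ℝ) ^ (-s) := by
        refine Finset.sum_le_sum fun D hD ↦ ?_
        rw [Finset.prod_mul_distrib, ← absNorm_rpow_eq_prod (hS D hD).1, mul_left_comm]
        exact mul_le_mul_of_nonneg_left (hinv D hD)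
          (Finset.prod_nonneg fun P _ ↦ weight_nonneg P)
    _ ≤ Real.exp 1 * ∏ P ∈ T, (1 + weight P * (Ideal.absNorm P : ℝ) ^ (-s)) := by
        rw [← Finset.mul_sum]
        gcongr
        exact sum_prod_primeFactors_le_prod
          (fun P ↦ mul_nonneg (weight_nonneg P) (by positivity)) (fun D hD ↦ (hS D hD).1)
          fun D hD ↦ Finset.subset_biUnion_of_mem primeFactors hD
    _ ≤ Real.exp 1 * Real.exp (∑ P ∈ T, weight P * (Ideal.absNorm P : ℝ) ^ (-s)) := by
        gcongr
        exact Real.prod_one_add_le_exp_sum _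
          fun P ↦ mul_nonneg (weight_nonneg P) (by positivity)
    _ ≤ Real.exp 1 * Real.exp (∑ P ∈ T, (Ideal.absNorm P : ℝ) ^ (-s) + 6 * realZeta k 2) := by
        gcongr
        refine (Finset.sum_le_sum hfactor).trans ?_
        rw [Finset.sum_add_distrib, ← Finset.mul_sum]
        gcongr
        exact sum_absNorm_rpow_le_realZeta one_lt_two T
    _ ≤ Real.exp 1 * (Real.exp (6 * realZeta k 2) * (C * Real.log y ^ (1 / 2 : ℝ))) := by
        rw [Real.exp_add, mul_comm (Real.exp (∑ P ∈ T, _))]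
        have := h s hs hs2 T hT
        rw [hs_def, add_sub_cancel_left, Real.inv_rpow hlog0.le, Real.rpow_neg hlog0.le,
          inv_inv, ← hs_def] at this
        gcongr
    _ = _ := by ring

end Weights

section Chebyshev

variable {K : Type*} [Field K] [NumberField K]

theorem sum_log_absNorm_le_of_natCast_mem {p : ℕ} (hp : p ≠ 0) {F : Finset (Ideal (𝓞 K))}
    (hF : ∀ P ∈ F, Prime P ∧ (p : 𝓞 K) ∈ P) :
    ∑ P ∈ F, Real.log (Ideal.absNorm P) ≤ Module.finrank ℤ (𝓞 K) * Real.log p := by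
  have hdvd : ∏ P ∈ F, P ∣ Ideal.span {(p : 𝓞 K)} :=
    Finset.prod_primes_dvd _ (fun P hP ↦ (hF P hP).1) fun P hP ↦ by
      rw [Ideal.dvd_span_singleton]
      exact (hF P hP).2
  have h := map_dvd Ideal.absNorm hdvd
  rw [map_prod, Ideal.absNorm_span_natCast] at h
  have hpos : ∀ P ∈ F, (Ideal.absNorm P : ℝ) ≠ 0 := fun P hP ↦
    (zero_lt_one.trans_le (one_le_absNorm (hF P hP).1.ne_zero)).ne'
  rw [← Real.log_prod hpos, ← Real.log_pow]
  refine Real.log_le_log (Finset.prod_pos fun P hP ↦ (Nat.cast_nonneg _).lt_of_ne' (hpos P hP)) ?_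
  exact_mod_cast Nat.le_of_dvd (by positivity) h

/-- Chebyshev's upper bound for the prime ideals of a number field. -/
theorem sum_log_absNorm_prime_le {x : ℝ} (hx : 0 ≤ x) {T : Finset (Ideal (𝓞 K))}
    (hT : ∀ P ∈ T, Prime P ∧ (Ideal.absNorm P : ℝ) ≤ x) :
    ∑ P ∈ T, Real.log (Ideal.absNorm P) ≤ Module.finrank ℤ (𝓞 K) * (Real.log 4 * x) := by
  classical
  have hex : ∀ P : Ideal (𝓞 K), Prime P → ∃ p : ℕ, (p : 𝓞 K) ∈ P ∧ p.Prime ∧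
      p ≤ Ideal.absNorm P := fun P hP ↦ by
    have := (Ideal.isPrime_of_prime hP).isMaximal hP.ne_zero
    obtain ⟨p, n, hn, hmem, hp, hN⟩ := Ideal.exists_prime_and_absNorm_eq_pow P
    exact ⟨p, hmem, hp, hN ▸ Nat.le_self_pow hn.ne' p⟩
  choose! q hmem hprime hle using hex
  have hmaps : ∀ P ∈ T, q P ∈ (Finset.Ioc 0 ⌊x⌋₊).filter Nat.Prime := fun P hP ↦ by
    have := hprime P (hT P hP).1
    simp only [Finset.mem_filter, Finset.mem_Ioc]
    exact ⟨⟨this.pos, Nat.le_floor (le_trans (mod_cast hle P (hT P hP).1) (hT P hP).2)⟩, this⟩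
  rw [← Finset.sum_fiberwise_of_maps_to hmaps]
  calc _ ≤ ∑ p ∈ (Finset.Ioc 0 ⌊x⌋₊).filter Nat.Prime,
        (Module.finrank ℤ (𝓞 K) : ℝ) * Real.log p := by
        refine Finset.sum_le_sum fun p hp ↦ ?_
        refine sum_log_absNorm_le_of_natCast_mem (Finset.mem_filter.mp hp).2.ne_zero
          fun P hP ↦ ?_
        obtain ⟨hPT, rfl⟩ := Finset.mem_filter.mp hP
        exact ⟨(hT P hPT).1, hmem P (hT P hPT).1⟩
    _ = Module.finrank ℤ (𝓞 K) * Chebyshev.theta x := by rw [← Finset.mul_sum, Chebyshev.theta]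
    _ ≤ _ := by
        gcongr
        exact Chebyshev.theta_le_log4_mul_x hx

end Chebyshev

section Assembly

variable {K : Type*} [Field K] [NumberField K]

theorem log_absNorm_eq_sum {D : Ideal (𝓞 K)} (hD : Squarefree D) :
    Real.log (Ideal.absNorm D) = ∑ P ∈ primeFactors D, Real.log (Ideal.absNorm P) := by
  conv_lhs => rw [← prod_primeFactors_of_squarefree hD]
  rw [map_prod, Nat.cast_prod, Real.log_prod fun P hP ↦ ?_]
  linarith [two_le_absNorm_of_prime (prime_of_mem_primeFactors hP)]

theorem sum_prod_weight_mul_log_le {y : ℝ} {S : Finset (Ideal (𝓞 K))}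
    (hS : ∀ D ∈ S, Squarefree D ∧ (Ideal.absNorm D : ℝ) ≤ y)
    (hdvd : ∀ D ∈ S, ∀ M, M ∣ D → M ∈ S) :
    ∑ D ∈ S, (∏ P ∈ primeFactors D, weight P) * Real.log (Ideal.absNorm D) ≤
      4 * Module.finrank ℤ (𝓞 K) * Real.log 4 * y *
        ∑ D ∈ S, (∏ P ∈ primeFactors D, weight P) * (Ideal.absNorm D : ℝ)⁻¹ := by
  classical
  let B : Ideal (𝓞 K) → Finset (Ideal (𝓞 K)) := fun M ↦
    S.biUnion primeFactors |>.filter fun P ↦ (Ideal.absNorm P : ℝ) ≤ y * (Ideal.absNorm M : ℝ)⁻¹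
  let A := S.sigma fun D ↦ primeFactors D
  let cof : (Σ _ : Ideal (𝓞 K), Ideal (𝓞 K)) → Σ _ : Ideal (𝓞 K), Ideal (𝓞 K) := fun x ↦
    ⟨∏ Q ∈ (primeFactors x.1).erase x.2, Q, x.2⟩
  let h : (Σ _ : Ideal (𝓞 K), Ideal (𝓞 K)) → ℝ := fun x ↦
    4 * ((∏ P ∈ primeFactors x.1, weight P) * Real.log (Ideal.absNorm x.2))
  have hmul : ∀ x ∈ A, x.2 * (cof x).1 = x.1 := fun x hx ↦ by
    obtain ⟨hD, hP⟩ := Finset.mem_sigma.mp hx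
    rw [Finset.mul_prod_erase _ (fun Q ↦ Q) hP, prod_primeFactors_of_squarefree (hS _ hD).1]
  have hinj : Set.InjOn cof A := fun x hx x' hx' he ↦ by
    have h2 : x.2 = x'.2 := congrArg (fun z ↦ z.2) he
    have h1 : x.1 = x'.1 := by rw [← hmul x hx, ← hmul x' hx', he, h2]
    cases x; cases x'; cases h1; cases h2; rfl
  have hmaps : A.image cof ⊆ S.sigma B := fun z hz ↦ by
    obtain ⟨x, hx, rfl⟩ := Finset.mem_image.mp hz
    obtain ⟨hD, hP⟩ := Finset.mem_sigma.mp hx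
    have hM : (cof x).1 ∈ S := hdvd _ hD _ ⟨x.2, by rw [mul_comm, hmul x hx]⟩
    refine Finset.mem_sigma.mpr ⟨hM, Finset.mem_filter.mpr
      ⟨Finset.mem_biUnion.mpr ⟨x.1, hD, hP⟩, ?_⟩⟩
    have hN := zero_lt_one.trans_le (one_le_absNorm (hS _ hM).1.ne_zero)
    rw [← div_eq_mul_inv, le_div_iff₀ hN]
    have := (hS _ hD).2
    rw [← hmul x hx, map_mul, Nat.cast_mul] at this
    exact this
  have hlog : ∀ I : Ideal (𝓞 K), 0 ≤ Real.log (Ideal.absNorm I) :=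
    fun I ↦ Real.log_natCast_nonneg _
  have hf : ∀ D : Ideal (𝓞 K), 0 ≤ ∏ P ∈ primeFactors D, weight P :=
    fun D ↦ Finset.prod_nonneg fun P _ ↦ weight_nonneg P
  calc ∑ D ∈ S, (∏ P ∈ primeFactors D, weight P) * Real.log (Ideal.absNorm D)
      = ∑ x ∈ A, (∏ P ∈ primeFactors x.1, weight P) * Real.log (Ideal.absNorm x.2) := by
        rw [Finset.sum_sigma]
        refine Finset.sum_congr rfl fun D hD ↦ ?_
        rw [log_absNorm_eq_sum (hS D hD).1, Finset.mul_sum]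
    _ ≤ ∑ x ∈ A, h (cof x) := by
        refine Finset.sum_le_sum fun x hx ↦ ?_
        obtain ⟨hD, hP⟩ := Finset.mem_sigma.mp hx
        have hpf : primeFactors (cof x).1 = (primeFactors x.1).erase x.2 :=
          primeFactors_prod_of_prime fun Q hQ ↦
            prime_of_mem_primeFactors (Finset.mem_of_mem_erase hQ)
        have hnonneg := mul_nonneg (hf (cof x).1) (hlog x.2)
        rw [← Finset.mul_prod_erase _ weight hP, ← hpf, mul_assoc]
        exact mul_le_mul_of_nonneg_right
          (weight_le_four (prime_of_mem_primeFactors hP)) hnonneg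
    _ = ∑ z ∈ A.image cof, h z := (Finset.sum_image hinj).symm
    _ ≤ ∑ z ∈ S.sigma B, h z := Finset.sum_le_sum_of_subset_of_nonneg hmaps fun z _ _ ↦
        mul_nonneg zero_le_four (mul_nonneg (hf _) (hlog _))
    _ = ∑ M ∈ S, 4 * ((∏ P ∈ primeFactors M, weight P) *
          ∑ P ∈ B M, Real.log (Ideal.absNorm P)) := by
        rw [Finset.sum_sigma]
        exact Finset.sum_congr rfl fun M _ ↦ by rw [Finset.mul_sum, Finset.mul_sum]
    _ ≤ ∑ M ∈ S, 4 * ((∏ P ∈ primeFactors M, weight P) *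
          (Module.finrank ℤ (𝓞 K) * (Real.log 4 * (y * (Ideal.absNorm M : ℝ)⁻¹)))) := by
        refine Finset.sum_le_sum fun M hM ↦ ?_
        have hy : 0 ≤ y := (Nat.cast_nonneg _).trans (hS M hM).2
        refine mul_le_mul_of_nonneg_left (mul_le_mul_of_nonneg_left ?_ (hf M)) zero_le_four
        refine sum_log_absNorm_prime_le (by positivity) fun P hP ↦ ?_
        obtain ⟨hP, hle⟩ := Finset.mem_filter.mp hP
        obtain ⟨D, -, hD⟩ := Finset.mem_biUnion.mp hP
        exact ⟨prime_of_mem_primeFactors hD, hle⟩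
    _ = _ := by
        rw [Finset.mul_sum]
        exact Finset.sum_congr rfl fun M _ ↦ by ring

theorem sum_prod_weight_mul_log_le_mul_sum_inv {y : ℝ} {S : Finset (Ideal (𝓞 K))}
    (hS : ∀ D ∈ S, Squarefree D ∧ (Ideal.absNorm D : ℝ) ≤ y)
    (hdvd : ∀ D ∈ S, ∀ M, M ∣ D → M ∈ S) :
    (∑ D ∈ S, ∏ P ∈ primeFactors D, weight P) * Real.log y ≤
      (1 + 4 * Module.finrank ℤ (𝓞 K) * Real.log 4) * y *
        ∑ D ∈ S, (∏ P ∈ primeFactors D, weight P) * (Ideal.absNorm D : ℝ)⁻¹ := by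
  have hlog : ∀ D ∈ S, Real.log y ≤ y * (Ideal.absNorm D : ℝ)⁻¹ + Real.log (Ideal.absNorm D) := by
    intro D hD
    have hN := zero_lt_one.trans_le (one_le_absNorm (hS D hD).1.ne_zero)
    have hy := hN.trans_le (hS D hD).2
    have h := Real.log_le_self (show 0 ≤ y * (Ideal.absNorm D : ℝ)⁻¹ by positivity)
    rw [Real.log_mul hy.ne' (by positivity), Real.log_inv] at h
    linarith
  have h := sum_prod_weight_mul_log_le hS hdvd
  calc (∑ D ∈ S, ∏ P ∈ primeFactors D, weight P) * Real.log y
      ≤ ∑ D ∈ S, (∏ P ∈ primeFactors D, weight P) *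
          (y * (Ideal.absNorm D : ℝ)⁻¹ + Real.log (Ideal.absNorm D)) := by
        rw [Finset.sum_mul]
        exact Finset.sum_le_sum fun D hD ↦ mul_le_mul_of_nonneg_left (hlog D hD)
          (Finset.prod_nonneg fun P _ ↦ weight_nonneg P)
    _ = y * ∑ D ∈ S, (∏ P ∈ primeFactors D, weight P) * (Ideal.absNorm D : ℝ)⁻¹ +
          ∑ D ∈ S, (∏ P ∈ primeFactors D, weight P) * Real.log (Ideal.absNorm D) := by
        simp only [mul_add, Finset.sum_add_distrib, Finset.mul_sum, mul_left_comm]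
    _ ≤ _ := by linarith

end Assembly

end NumberField

/-- Second moment estimate: the sum of `(|𝔡|/Φ(𝔡))²` over squarefree ideals `𝔡` of norm at most
`y` having no prime divisor split in the quadratic extension `L/k` is `O_{k,L}(y·(log y)^{-1/2})`. -/
theorem stmt_6 (k L : Type*) [Field k] [NumberField k] [Field L] [NumberField L]
    [Algebra k L] (hdeg : Module.finrank k L = 2) :
    ∃ C : ℝ, ∀ y : ℝ, 3 ≤ y →
      (∑ᶠ 𝔡 ∈ {𝔡 : Ideal (𝓞 k) | 𝔡 ≠ ⊥ ∧ Squarefree 𝔡 ∧ (Ideal.absNorm 𝔡 : ℝ) ≤ y ∧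
          ∀ P : Ideal (𝓞 k), P.IsPrime → P ∣ 𝔡 → ¬ SplitsIn k L P},
        ((Ideal.absNorm 𝔡 : ℝ) / Phi 𝔡) ^ 2) ≤
        C * y * (Real.log y) ^ (-(1 / 2) : ℝ) := by
  classical
  obtain ⟨C, hC, h⟩ := NumberField.exists_sum_prod_weight_mul_inv_le hdeg
  refine ⟨(1 + 4 * Module.finrank ℤ (𝓞 k) * Real.log 4) * C, fun y hy ↦ ?_⟩
  have hlog : 0 < Real.log y := zero_lt_one.trans_le (NumberField.one_le_log hy)
  set A := {𝔡 : Ideal (𝓞 k) | 𝔡 ≠ ⊥ ∧ Squarefree 𝔡 ∧ (Ideal.absNorm 𝔡 : ℝ) ≤ y ∧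
    ∀ P : Ideal (𝓞 k), P.IsPrime → P ∣ 𝔡 → ¬ SplitsIn k L P} with hA
  have hfin : A.Finite := (Ideal.finite_setOfPred_absNorm_le ⌊y⌋₊).subset
    fun D hD ↦ Nat.le_floor hD.2.2.1
  have hmem : ∀ {D}, D ∈ hfin.toFinset ↔ D ∈ A := hfin.mem_toFinset
  rw [finsum_mem_eq_finite_toFinset_sum _ hfin, Finset.sum_congr rfl fun D hD ↦
    NumberField.div_Phi_sq_eq_prod_weight (hmem.mp hD).1]
  have hdvd : ∀ D ∈ hfin.toFinset, ∀ M, M ∣ D → M ∈ hfin.toFinset := fun D hD M hM ↦ by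
    obtain ⟨h0, hsq, hle, hns⟩ := hmem.mp hD
    refine hmem.mpr ⟨ne_zero_of_dvd_ne_zero h0 hM, hsq.squarefree_of_dvd hM, le_trans ?_ hle,
      fun P hP hPM ↦ hns P hP (hPM.trans hM)⟩
    exact_mod_cast Nat.le_of_dvd (Nat.pos_of_ne_zero (Ideal.absNorm_eq_zero_iff.not.mpr h0))
      (map_dvd Ideal.absNorm hM)
  have hmain := NumberField.sum_prod_weight_mul_log_le_mul_sum_inv (y := y)
    (fun D hD ↦ ⟨(hmem.mp hD).2.1, (hmem.mp hD).2.2.1⟩) hdvd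
  have hinv := h y hy hfin.toFinset fun D hD ↦ ⟨(hmem.mp hD).2.1, (hmem.mp hD).2.2.1, fun P hP ↦
    (hmem.mp hD).2.2.2 P (Ideal.isPrime_of_prime (NumberField.prime_of_mem_primeFactors hP))
      (UniqueFactorizationMonoid.dvd_of_mem_normalizedFactors
        (UniqueFactorizationMonoid.mem_primeFactors.mp hP))⟩
  refine le_of_mul_le_mul_right (hmain.trans ?_) hlog
  have hpow : Real.log y ^ (1 / 2 : ℝ) = Real.log y ^ (-(1 / 2) : ℝ) * Real.log y := by
    conv_rhs => rw [← Real.rpow_add_one hlog.ne']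
    norm_num
  rw [hpow] at hinv
  have hlog4 : 0 ≤ Real.log 4 := Real.log_nonneg (by norm_num)
  refine (mul_le_mul_of_nonneg_left hinv (by positivity)).trans_eq (by ring)
end
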